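/- arXiv:1412.0386 — 5 statements merged into one kernel-verified Lean document; each statement's English description precedes it below -/
import Mathlib

section
/- The geometric realization of the multiple chessboard complex Δ_{7,3}^{2,1} (a 7×3 chessboard with at most 2 rooks in each of the 3 rows and at most 1 rook in each of the 7 columns) is 3-connected but not 4-connected. -/
open scoped BigOperators

/-- A face of the multiple chessboard complex `Δ_{m,n}^{p,q}`. -/
def IsFace (m n : ℕ) (k : Fin n → ℕ) (l : Fin m → ℕ)
    (A : Finset (Fin m × Fin n)) : Prop :=
  (∀ i : Fin n, (A.filter fun v => v.2 = i).card ≤ k i) ∧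
  (∀ j : Fin m, (A.filter fun v => v.1 = j).card ≤ l j)

/-- The geometric realization of the multiple chessboard complex. -/
def Realization (m n : ℕ) (k : Fin n → ℕ) (l : Fin m → ℕ) :
    Set ((Fin m × Fin n) → ℝ) :=
  {f | (∀ v, 0 ≤ f v ∧ f v ≤ 1) ∧ ∑ v, f v = 1 ∧
      IsFace m n k l (Finset.univ.filter fun v => 0 < f v)}

/-- `c`-connectedness of a topological space, for `c : ℤ`. -/
def CConnected (c : ℤ) (X : Type) [TopologicalSpace X] : Prop :=
  Nonempty X ∧ (0 ≤ c → PathConnectedSpace X) ∧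
  ∀ i : ℕ, 1 ≤ i → (i : ℤ) ≤ c → ∀ x : X, Subsingleton (HomotopyGroup (Fin i) X x)

namespace ChessboardComplex

/-! ### Contractible complexes glued from simplices -/

section Combinatorics

variable {V : Type*}

/-- Set systems obtained from full simplices by gluing along set systems of the same kind. -/
inductive Glued : Set (Finset V) → Prop
  | simplex (s : Finset V) (hs : s.Nonempty) : Glued {A | A ⊆ s}
  | union (C D : Set (Finset V)) (hC : Glued C) (hD : Glued D) (hCD : Glued (C ∩ D)) :
      Glued (C ∪ D)

theorem Glued.isLowerSet {C : Set (Finset V)} (hC : Glued C) : IsLowerSet C := by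
  induction hC with
  | simplex s hs => exact fun A B h hA => h.trans hA
  | union C D _ _ _ ihC ihD _ => exact ihC.union ihD

/-- `SkeletonGlued d K`: some subcomplex of `K` glued from simplices lies between the families of
faces with at most `d` and at most `d + 1` vertices. -/
def SkeletonGlued (d : ℕ) (K : Set (Finset V)) : Prop :=
  ∃ C, Glued C ∧ C ⊆ K ∧ (∀ A ∈ K, A.card ≤ d → A ∈ C) ∧ ∀ A ∈ C, A.card ≤ d + 1

theorem skeletonGlued_zero {K : Set (Finset V)} (hK : IsLowerSet K) (v : V) (hv : {v} ∈ K) :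
    SkeletonGlued 0 K := by
  refine ⟨_, Glued.simplex {v} (by simp), fun A hA => hK hA hv, fun A _ hA => ?_, fun A hA => ?_⟩
  · have : A = ∅ := by simpa using hA
    simp [this]
  · simpa using Finset.card_le_card hA

variable [DecidableEq V]

/-- The cone with apex `v` over a set system whose members avoid `v`. -/
def cone (v : V) (C : Set (Finset V)) : Set (Finset V) := {A | A.erase v ∈ C}

theorem glued_cone [Finite V] (v : V) (C : Set (Finset V)) (hC : IsLowerSet C)
    (h0 : ∅ ∈ C) (hv : ∀ A ∈ C, v ∉ A) : Glued (cone v C) := by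
  induction hn : C.ncard using Nat.strong_induction_on generalizing C with
  | _ n ih =>
    subst hn
    by_cases hne : ∃ A ∈ C, A.Nonempty
    · have hfin : (C ∩ {A | A.Nonempty}).Finite := Set.toFinite _
      obtain ⟨σ, ⟨hσC, hσ⟩, hmax⟩ := hfin.exists_maximalFor Finset.card _
        (by obtain ⟨A, hA, hA'⟩ := hne; exact ⟨A, hA, hA'⟩)
      have hmax' : ∀ A ∈ C, σ ⊆ A → A = σ := by
        intro A hA h
        have := hmax ⟨hA, hσ.mono h⟩ (Finset.card_le_card h)
        exact (Finset.eq_of_subset_of_card_le h this).symm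
      have hvσ := hv σ hσC
      have hlt : (C \ {σ}).ncard < C.ncard :=
        Set.ncard_lt_ncard (Set.sdiff_singleton_ssubset.2 hσC)
      have hD : {A | A ⊆ σ ∧ A ≠ σ} ⊆ C \ {σ} := fun A hA => ⟨hC hA.1 hσC, hA.2⟩
      have e : cone v C = cone v (C \ {σ}) ∪ {A | A ⊆ insert v σ} := by
        ext A
        simp only [cone, Set.mem_union, Set.mem_ofPred_eq, Set.mem_sdiff, Set.mem_singleton_iff,
          Finset.subset_insert_iff]
        refine ⟨fun h => ?_, ?_⟩
        · by_cases h' : A.erase v = σ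
          · exact Or.inr (h' ▸ subset_rfl)
          · exact Or.inl ⟨h, h'⟩
        · rintro (h | h)
          · exact h.1
          · exact hC h hσC
      rw [e]
      refine Glued.union _ _ ?_ (Glued.simplex _ ⟨v, by simp⟩) ?_
      · refine ih _ hlt _ ?_ ⟨h0, hσ.ne_empty.symm⟩ (fun A hA => hv A hA.1) rfl
        rintro A B h ⟨hA, hA'⟩
        refine ⟨hC h hA, ?_⟩
        rintro rfl
        exact hA' (hmax' _ hA h)
      · have e2 : cone v (C \ {σ}) ∩ {A | A ⊆ insert v σ} = cone v {A | A ⊆ σ ∧ A ≠ σ} := by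
          ext A
          simp only [cone, Set.mem_inter_iff, Set.mem_ofPred_eq, Set.mem_sdiff,
            Set.mem_singleton_iff, Finset.subset_insert_iff]
          constructor
          · rintro ⟨⟨_, h⟩, h'⟩
            exact ⟨h', h⟩
          · rintro ⟨h, h'⟩
            exact ⟨⟨hC h hσC, h'⟩, h⟩
        rw [e2]
        refine ih _ ((Set.ncard_le_ncard hD).trans_lt hlt) _ ?_
          ⟨Finset.empty_subset _, hσ.ne_empty.symm⟩ (fun A hA => hv A (hD hA).1) rfl
        rintro A B h ⟨hA, hA'⟩
        refine ⟨h.trans hA, ?_⟩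
        rintro rfl
        exact hA' (hA.antisymm h)
    · have e : cone v C = {A | A ⊆ {v}} := by
        ext A
        simp only [cone, Set.mem_ofPred_eq]
        rw [← insert_empty_eq v, Finset.subset_insert_iff]
        constructor
        · intro h
          by_contra h'
          exact hne ⟨_, h, Finset.nonempty_iff_ne_empty.2 fun h'' => h' (by simp [h''])⟩
        · intro h
          rwa [Finset.subset_empty.1 h]
      rw [e]
      exact Glued.simplex _ (by simp)

theorem skeletonGlued_of_cone [Finite V] (d : ℕ) {K : Set (Finset V)} (hK : IsLowerSet K)
    (h0 : ∅ ∈ K) (v : V) (hv : ∀ A ∈ K, insert v A ∈ K) : SkeletonGlued d K := by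
  refine ⟨cone v {A | A ∈ K ∧ v ∉ A ∧ A.card ≤ d}, glued_cone _ _ ?_ (by simpa)
    (fun A hA => hA.2.1),
    ?_, ?_, ?_⟩
  · rintro A B h ⟨h1, h2, h3⟩
    exact ⟨hK h h1, fun h' => h2 (h h'), (Finset.card_le_card h).trans h3⟩
  · rintro A ⟨h1, -, -⟩
    refine hK ?_ (hv _ h1)
    rw [Finset.subset_insert_iff]
  · intro A hA h
    exact ⟨hK (Finset.erase_subset _ _) hA, by simp,
      (Finset.card_le_card (Finset.erase_subset _ _)).trans h⟩
  · rintro A ⟨-, -, h⟩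
    have := Finset.pred_card_le_card_erase (s := A) (a := v)
    omega

theorem SkeletonGlued.of_deletion_link [Finite V] {d : ℕ} {K : Set (Finset V)} (hK : IsLowerSet K)
    (v : V) (hdel : SkeletonGlued (d + 1) {A | A ∈ K ∧ v ∉ A})
    (hlink : SkeletonGlued d {A | insert v A ∈ K ∧ v ∉ A}) (hv : {v} ∈ K) :
    SkeletonGlued (d + 1) K := by
  obtain ⟨C, hC, hCK, hCs, hCd⟩ := hdel
  obtain ⟨D, hD, hDK, hDs, hDd⟩ := hlink
  have hDC : D ⊆ C := fun A hA =>
    hCs A ⟨hK (Finset.subset_insert _ _) (hDK hA).1, (hDK hA).2⟩ (hDd A hA)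
  refine ⟨C ∪ cone v D, Glued.union _ _ hC (glued_cone v D hD.isLowerSet
    (hDs ∅ ⟨by simpa using hv, by simp⟩ (by simp)) fun A hA => (hDK hA).2) ?_, ?_, ?_, ?_⟩
  · have : C ∩ cone v D = D := by
      ext A
      constructor
      · rintro ⟨h1, h2⟩
        have := (hCK h1).2
        simpa [cone, this] using h2
      · intro h
        exact ⟨hDC h, by simpa [cone, (hDK h).2] using h⟩
    rwa [this]
  · rintro A (h | h)
    · exact (hCK h).1
    · refine hK ?_ (hDK h).1
      rw [Finset.subset_insert_iff]
  · intro A hA h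
    by_cases hvA : v ∈ A
    · refine Or.inr (hDs _ ⟨by rwa [Finset.insert_erase hvA], by simp⟩ ?_)
      rw [Finset.card_erase_of_mem hvA]
      omega
    · exact Or.inl (hCs A ⟨hA, hvA⟩ h)
  · rintro A (h | h)
    · exact hCd A h
    · have := hDd _ h
      have := Finset.pred_card_le_card_erase (s := A) (a := v)
      omega

end Combinatorics

section Search

/-- The faces of the multiple chessboard complex with row capacities `k` and column capacities `1`
all of whose rooks are placed on the squares listed in `S`. -/
def boardComplex (S : List (Fin 7 × Fin 3)) (k : Fin 3 → ℕ) : Set (Finset (Fin 7 × Fin 3)) :=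
  {A | (∀ v ∈ A, v ∈ S) ∧ IsFace 7 3 k (fun _ => 1) A}

/-- The squares left for the link of `v`. -/
def linkSquares (S : List (Fin 7 × Fin 3)) (k : Fin 3 → ℕ) (v : Fin 7 × Fin 3) :
    List (Fin 7 × Fin 3) :=
  S.filter fun u => decide (u.1 ≠ v.1) && decide (0 < k u.2)

/-- The row capacities after placing a rook in row `i`. -/
def decreaseCapacity (k : Fin 3 → ℕ) (i : Fin 3) : Fin 3 → ℕ :=
  fun r => if r = i then k r - 1 else k r

/-- A heuristic choice of the next square to delete from the board. -/
def nextSquare (S : List (Fin 7 × Fin 3)) (k : Fin 3 → ℕ) : Option (Fin 7 × Fin 3) :=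
  match S with
  | [] => none
  | h :: _ =>
    match (S.filter fun u => decide (u.2 = h.2)).argmin
        fun v => (S.filter fun u => decide (u.1 = v.1)).length with
    | none => none
    | some t =>
      match S.find? fun u => decide (u.1 = t.1) && decide (u.2 ≠ t.2) with
      | some u => some u
      | none =>
        if k t.2 < (S.filter fun u => decide (u.2 = t.2)).length then
          S.find? fun u => decide (u.2 = t.2) && decide (u.1 ≠ t.1)
        else none

/-- Search for a vertex decomposition showing that `boardComplex S k` is `SkeletonGlued d`. -/
def decomposable : ℕ → ℕ → List (Fin 7 × Fin 3) → (Fin 3 → ℕ) → Bool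
  | 0, _, _, _ => false
  | _ + 1, 0, S, k => S.any fun v => decide (0 < k v.2)
  | n + 1, d + 1, S, k =>
    match nextSquare S k with
    | none => S.any fun v => decide (0 < k v.2) && S.all (fun u => decide (u.1 = v.1 → u = v)) &&
        decide ((S.filter fun u => decide (u.2 = v.2)).length ≤ k v.2)
    | some v => decide (v ∈ S) && decide (0 < k v.2) &&
        decomposable n d (linkSquares S (decreaseCapacity k v.2) v) (decreaseCapacity k v.2) &&
        decomposable n (d + 1) (S.filter fun u => decide (u ≠ v)) k

/-- All squares of the board, ordered by rows. -/
def allSquares : List (Fin 7 × Fin 3) :=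
  (List.finRange 3).flatMap fun i => (List.finRange 7).map fun j => (j, i)

theorem decomposable_allSquares : decomposable 60 4 allSquares (fun _ => 2) = true := by
  decide +kernel

theorem isLowerSet_boardComplex (S : List (Fin 7 × Fin 3)) (k : Fin 3 → ℕ) :
    IsLowerSet (boardComplex S k) := fun _ _ h hA =>
  ⟨fun v hv => hA.1 v (h hv),
    fun i => (Finset.card_le_card (Finset.filter_subset_filter _ h)).trans (hA.2.1 i),
    fun j => (Finset.card_le_card (Finset.filter_subset_filter _ h)).trans (hA.2.2 j)⟩

theorem empty_mem_boardComplex (S : List (Fin 7 × Fin 3)) (k : Fin 3 → ℕ) :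
    ∅ ∈ boardComplex S k := by
  simp [boardComplex, IsFace]

theorem singleton_mem_boardComplex {S : List (Fin 7 × Fin 3)} {k : Fin 3 → ℕ}
    {v : Fin 7 × Fin 3} (hS : v ∈ S) (hk : 0 < k v.2) : {v} ∈ boardComplex S k := by
  refine ⟨by simpa using hS, fun i => ?_, fun j => ?_⟩
  · rw [Finset.filter_singleton]
    split_ifs with h
    · subst h
      rw [Finset.card_singleton]
      exact hk
    · simp
  · exact (Finset.card_filter_le _ _).trans (by simp)

theorem deletion_boardComplex (S : List (Fin 7 × Fin 3)) (k : Fin 3 → ℕ) (v : Fin 7 × Fin 3) :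
    {A | A ∈ boardComplex S k ∧ v ∉ A} = boardComplex (S.filter fun u => decide (u ≠ v)) k := by
  ext A
  simp only [boardComplex, Set.mem_ofPred_eq, List.mem_filter, decide_eq_true_eq]
  constructor
  · rintro ⟨⟨h1, h2⟩, h3⟩
    exact ⟨fun u hu => ⟨h1 u hu, fun h => h3 (h ▸ hu)⟩, h2⟩
  · rintro ⟨h1, h2⟩
    exact ⟨⟨fun u hu => (h1 u hu).1, h2⟩, fun h => (h1 v h).2 rfl⟩

theorem link_boardComplex {S : List (Fin 7 × Fin 3)} {k : Fin 3 → ℕ} {v : Fin 7 × Fin 3}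
    (hS : v ∈ S) (hk : 0 < k v.2) :
    {A | insert v A ∈ boardComplex S k ∧ v ∉ A} =
      boardComplex (linkSquares S (decreaseCapacity k v.2) v) (decreaseCapacity k v.2) := by
  ext A
  simp only [boardComplex, Set.mem_ofPred_eq, linkSquares, List.mem_filter, Bool.and_eq_true,
    decide_eq_true_eq]
  constructor
  · rintro ⟨⟨h1, h2, h3⟩, h4⟩
    have hrow : ∀ i, (A.filter fun u => u.2 = i).card ≤ decreaseCapacity k v.2 i := by
      intro i
      have := h2 i
      rw [Finset.filter_insert] at this
      unfold decreaseCapacity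
      split_ifs at this ⊢ with h h' h'
      · rw [Finset.card_insert_of_notMem (by simp [h4])] at this
        omega
      · exact absurd h.symm h'
      · exact absurd h'.symm h
      · exact this
    refine ⟨fun u hu => ⟨h1 u (Finset.mem_insert_of_mem hu), fun h => ?_, ?_⟩, hrow, fun j =>
      (Finset.card_le_card (Finset.filter_subset_filter _ (Finset.subset_insert _ _))).trans (h3 j)⟩
    · have := Finset.card_le_one.1 (h3 v.1) u (by simp [hu, h]) v (by simp)
      exact h4 (this ▸ hu)
    · exact (Finset.card_pos.2 ⟨u, by simp [hu]⟩).trans_le (hrow u.2)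
  · rintro ⟨h1, h2, h3⟩
    have h4 : v ∉ A := fun h => (h1 v h).2.1 rfl
    refine ⟨⟨fun u hu => ?_, fun i => ?_, fun j => ?_⟩, h4⟩
    · obtain rfl | hu := Finset.mem_insert.1 hu
      · exact hS
      · exact (h1 u hu).1
    · have := h2 i
      unfold decreaseCapacity at this
      rw [Finset.filter_insert]
      split_ifs at this ⊢ with h h' h'
      · rw [Finset.card_insert_of_notMem (by simp [h4])]
        subst h
        omega
      · exact absurd h.symm h'
      · exact absurd h'.symm h
      · exact this
    · rw [Finset.filter_insert]
      split_ifs with h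
      · have : A.filter (fun u => u.1 = j) = ∅ :=
          Finset.filter_eq_empty_iff.2 fun u hu hu' => (h1 u hu).2.1 (hu'.trans h.symm)
        simp [this]
      · exact h3 j

theorem skeletonGlued_of_decomposable (n d : ℕ) (S : List (Fin 7 × Fin 3)) (k : Fin 3 → ℕ)
    (h : decomposable n d S k = true) : SkeletonGlued d (boardComplex S k) := by
  induction n generalizing d S k with
  | zero => simp [decomposable] at h
  | succ n ih =>
    cases d with
    | zero =>
      simp only [decomposable, List.any_eq_true, decide_eq_true_eq] at h
      obtain ⟨v, hS, hk⟩ := h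
      exact skeletonGlued_zero (isLowerSet_boardComplex S k) v (singleton_mem_boardComplex hS hk)
    | succ d =>
      rw [decomposable] at h
      split at h
      · simp only [List.any_eq_true, Bool.and_eq_true, List.all_eq_true, decide_eq_true_eq] at h
        obtain ⟨v, hS, ⟨hk, hcol⟩, hrow⟩ := h
        refine skeletonGlued_of_cone _ (isLowerSet_boardComplex S k) (empty_mem_boardComplex S k) v
          fun A hA => ⟨fun u hu => ?_, fun i => ?_, fun j => ?_⟩
        · obtain rfl | hu := Finset.mem_insert.1 hu
          · exact hS
          · exact hA.1 u hu
        · by_cases hi : v.2 = i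
          · subst hi
            refine le_trans ?_ hrow
            refine (Finset.card_le_card ?_).trans (List.toFinset_card_le _)
            intro u hu
            obtain ⟨hu, hu'⟩ := Finset.mem_filter.1 hu
            obtain rfl | hu := Finset.mem_insert.1 hu
            · simpa using hS
            · simpa using ⟨hA.1 u hu, hu'⟩
          · rw [Finset.filter_insert, if_neg hi]
            exact hA.2.1 i
        · by_cases hj : v.1 = j
          · refine Finset.card_le_one.2 fun a ha b hb => ?_
            have key : ∀ u ∈ (insert v A).filter (fun u => u.1 = j), u = v := by
              intro u hu
              obtain ⟨hu, hu'⟩ := Finset.mem_filter.1 hu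
              obtain rfl | hu := Finset.mem_insert.1 hu
              · rfl
              · exact hcol u (hA.1 u hu) (hu'.trans hj.symm)
            rw [key a ha, key b hb]
          · rw [Finset.filter_insert, if_neg hj]
            exact hA.2.2 j
      · simp only [Bool.and_eq_true, decide_eq_true_eq] at h
        obtain ⟨⟨⟨hS, hk⟩, h1⟩, h2⟩ := h
        refine SkeletonGlued.of_deletion_link (isLowerSet_boardComplex S k) _ ?_ ?_
          (singleton_mem_boardComplex hS hk)
        · rw [deletion_boardComplex]
          exact ih _ _ _ h2
        · rw [link_boardComplex hS hk]
          exact ih _ _ _ h1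

theorem skeletonGlued_chessboard :
    SkeletonGlued 4 {A | IsFace 7 3 (fun _ => 2) (fun _ => 1) A} := by
  have h := skeletonGlued_of_decomposable 60 4 _ _ decomposable_allSquares
  have e : boardComplex allSquares (fun _ => 2) = {A | IsFace 7 3 (fun _ => 2) (fun _ => 1) A} := by
    ext A
    simp [boardComplex, allSquares]
  rwa [e] at h

end Search

open Set Topology

section Realization

variable {V : Type*} [Fintype V]

/-- The set of vertices with positive barycentric coordinate. -/
noncomputable def supp (x : V → ℝ) : Finset V := Finset.univ.filter fun v => 0 < x v

theorem mem_supp {x : V → ℝ} {v : V} : v ∈ supp x ↔ 0 < x v := by simp [supp]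

/-- The geometric realization of a set system. -/
def geom (K : Set (Finset V)) : Set (V → ℝ) :=
  {x | (∀ v, 0 ≤ x v) ∧ ∑ v, x v = 1 ∧ supp x ∈ K}

theorem geom_union (K L : Set (Finset V)) : geom (K ∪ L) = geom K ∪ geom L := by
  ext x
  simp only [geom, Set.mem_union, Set.mem_ofPred_eq]
  tauto

theorem geom_inter (K L : Set (Finset V)) : geom (K ∩ L) = geom K ∩ geom L := by
  ext x
  simp only [geom, Set.mem_inter_iff, Set.mem_ofPred_eq]
  tauto

theorem geom_mono {K L : Set (Finset V)} (h : K ⊆ L) : geom K ⊆ geom L :=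
  fun _ hx => ⟨hx.1, hx.2.1, h hx.2.2⟩

theorem geom_simplex (s : Finset V) :
    geom {A | A ⊆ s} = {x | (∀ v, 0 ≤ x v) ∧ ∑ v, x v = 1 ∧ ∀ v, v ∉ s → x v = 0} := by
  ext x
  simp only [geom, Set.mem_ofPred_eq, Finset.subset_iff, mem_supp]
  refine and_congr_right fun h => and_congr_right fun _ => forall_congr' fun v => ?_
  have := h v
  constructor
  · intro h1 h2
    by_contra h3
    exact h2 (h1 (lt_of_le_of_ne this (Ne.symm h3)))
  · intro h1 h2
    by_contra h3
    exact h2.ne' (h1 h3)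

theorem isClosed_geom_simplex (s : Finset V) : IsClosed (geom {A | A ⊆ s}) := by
  rw [geom_simplex]
  refine IsClosed.inter ?_ (IsClosed.inter ?_ ?_)
  · change IsClosed {x : V → ℝ | ∀ v, 0 ≤ x v}
    simp only [Set.ofPred_forall]
    exact isClosed_iInter fun v => isClosed_le continuous_const (continuous_apply v)
  · exact isClosed_eq (by fun_prop) continuous_const
  · change IsClosed {x : V → ℝ | ∀ v, v ∉ s → x v = 0}
    simp only [Set.ofPred_forall]
    exact isClosed_iInter fun v => isClosed_iInter fun _ =>
      isClosed_eq (continuous_apply v) continuous_const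

theorem isClosed_geom {K : Set (Finset V)} (hK : IsLowerSet K) : IsClosed (geom K) := by
  have e : geom K = ⋃ s ∈ K, geom {A | A ⊆ s} := by
    ext x
    simp only [mem_iUnion, exists_prop]
    refine ⟨fun h => ⟨supp x, h.2.2, h.1, h.2.1, Finset.Subset.refl _⟩, ?_⟩
    rintro ⟨s, hs, h⟩
    exact ⟨h.1, h.2.1, hK h.2.2 hs⟩
  rw [e]
  exact K.toFinite.isClosed_biUnion fun s _ => isClosed_geom_simplex s

/-- `T` is an absolute extensor for closed subsets of `Y`. -/
def IsExtensor (Y : Type*) [TopologicalSpace Y] {W : Type*} [TopologicalSpace W] (T : Set W) :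
    Prop :=
  ∀ (Z : Set Y) (f : Y → W), IsClosed Z → ContinuousOn f Z → MapsTo f Z T →
    ∃ F : Y → W, Continuous F ∧ (∀ y, F y ∈ T) ∧ EqOn F f Z

theorem isExtensor_simplex (Y : Type*) [TopologicalSpace Y] [NormalSpace Y] (s : Finset V)
    (hs : s.Nonempty) : IsExtensor Y (geom {A | A ⊆ s}) := by
  classical
  intro Z f hZ hf hfT
  obtain ⟨v₀, hv₀⟩ := hs
  obtain ⟨G, hG⟩ := ContinuousMap.exists_restrict_eq hZ ⟨Z.domRestrict f, hf.domRestrict⟩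
  have hG' : ∀ y ∈ Z, G y = f y := fun y hy => DFunLike.congr_fun hG ⟨y, hy⟩
  rw [geom_simplex] at hfT ⊢
  let S : Y → ℝ := fun y => ∑ v ∈ s, max 0 (G y v)
  let F : Y → V → ℝ := fun y v =>
    ((if v ∈ s then max 0 (G y v) else 0) + (if v = v₀ then max 0 (1 - S y) else 0)) / max 1 (S y)
  have hpos : ∀ y, 0 < max 1 (S y) := fun y => lt_max_of_lt_left one_pos
  have hS : Continuous S := by fun_prop
  refine ⟨F, ?_, fun y => ⟨fun v => ?_, ?_, fun v hv => ?_⟩, fun y hy => ?_⟩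
  · refine continuous_pi fun v => Continuous.div ?_ (by fun_prop) fun y => (hpos y).ne'
    refine Continuous.add ?_ ?_ <;> split_ifs <;> fun_prop
  · refine div_nonneg (add_nonneg ?_ ?_) (hpos y).le <;> split_ifs <;> simp
  · simp only [F]
    rw [← Finset.sum_div, div_eq_one_iff_eq (hpos y).ne', Finset.sum_add_distrib]
    simp only [Finset.sum_ite_mem, Finset.univ_inter, Finset.sum_ite_eq', Finset.mem_univ, if_true]
    change S y + _ = _
    rcases le_total 1 (S y) with h | h
    · rw [max_eq_left (by linarith), max_eq_right h, add_zero]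
    · rw [max_eq_right (by linarith), max_eq_left h]
      ring
  · have : v ≠ v₀ := fun h => hv (h ▸ hv₀)
    simp [F, hv, this]
  · obtain ⟨h1, h2, h3⟩ := hfT hy
    have hS1 : S y = 1 := by
      simp only [S, hG' y hy]
      rw [← h2]
      refine (Finset.sum_congr rfl fun v _ => max_eq_right (h1 v)).trans ?_
      exact Finset.sum_subset (Finset.subset_univ s) fun v _ hv => h3 v hv
    funext v
    simp only [F, hS1, hG' y hy]
    by_cases hv : v ∈ s
    · simp [hv, h1 v]
    · simp [hv, h3 v hv]

theorem IsExtensor.union {Y W : Type*} [PseudoMetricSpace Y] [TopologicalSpace W] {A B : Set W}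
    (hAc : IsClosed A) (hBc : IsClosed B) (hA : IsExtensor Y A) (hB : IsExtensor Y B)
    (hAB : IsExtensor Y (A ∩ B)) : IsExtensor Y (A ∪ B) := by
  classical
  intro Z f hZ hf hfT
  let ZA := Z ∩ f ⁻¹' A
  let ZB := Z ∩ f ⁻¹' B
  have hZA : IsClosed ZA := hf.preimage_isClosed_of_isClosed hZ hAc
  have hZB : IsClosed ZB := hf.preimage_isClosed_of_isClosed hZ hBc
  have hZAB : ∀ y ∈ Z, y ∈ ZA ∨ y ∈ ZB := fun y hy =>
    (hfT hy).imp (fun h => ⟨hy, h⟩) fun h => ⟨hy, h⟩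
  rcases ZA.eq_empty_or_nonempty with hZA0 | hZAn
  · obtain ⟨F, h1, h2, h3⟩ := hB Z f hZ hf fun y hy =>
      ((hZAB y hy).resolve_left (by simp [hZA0])).2
    exact ⟨F, h1, fun y => Or.inr (h2 y), h3⟩
  rcases ZB.eq_empty_or_nonempty with hZB0 | hZBn
  · obtain ⟨F, h1, h2, h3⟩ := hA Z f hZ hf fun y hy =>
      ((hZAB y hy).resolve_right (by simp [hZB0])).2
    exact ⟨F, h1, fun y => Or.inl (h2 y), h3⟩
  let a : Y → ℝ := fun y => Metric.infDist y ZA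
  let b : Y → ℝ := fun y => Metric.infDist y ZB
  have ha : Continuous a := Metric.continuous_infDist_pt ZA
  have hb : Continuous b := Metric.continuous_infDist_pt ZB
  have ha0 : ∀ y, y ∈ ZA ↔ a y = 0 := fun y => hZA.mem_iff_infDist_zero hZAn
  have hb0 : ∀ y, y ∈ ZB ↔ b y = 0 := fun y => hZB.mem_iff_infDist_zero hZBn
  have ha' : ∀ y, 0 ≤ a y := fun y => Metric.infDist_nonneg
  have hb' : ∀ y, 0 ≤ b y := fun y => Metric.infDist_nonneg
  let Y₀ : Set Y := {y | a y = b y}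
  have hY₀ : IsClosed Y₀ := isClosed_eq ha hb
  have h₀ : ∀ y ∈ Y₀, y ∈ Z → y ∈ ZA ∧ y ∈ ZB := by
    intro y (hy : a y = b y) hyZ
    rw [ha0, hb0]
    rcases hZAB y hyZ with h | h
    · rw [ha0] at h
      exact ⟨h, hy ▸ h⟩
    · rw [hb0] at h
      exact ⟨hy ▸ h, h⟩
  obtain ⟨F₀, hF₀, hF₀T, hF₀Z⟩ := hAB (Z ∩ Y₀) f (hZ.inter hY₀) (hf.mono inter_subset_left)
    fun y hy => ⟨(h₀ y hy.2 hy.1).1.2, (h₀ y hy.2 hy.1).2.2⟩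
  have key : ∀ (Z' : Set Y) (D : Set W), IsExtensor Y D → Z' = Z ∩ f ⁻¹' D → IsClosed Z' →
      (∀ y, F₀ y ∈ D) → ∃ G : Y → W, Continuous G ∧ (∀ y, G y ∈ D) ∧ EqOn G f Z' ∧
        EqOn G F₀ Y₀ := by
    intro Z' D hD hZ' hZc hFD
    have hagree : ∀ y ∈ Z', y ∈ Y₀ → f y = F₀ y := fun y hy hy' =>
      (hF₀Z ⟨(hZ' ▸ hy).1, hy'⟩).symm
    have h1 : EqOn (Z'.piecewise f F₀) f Z' := fun y hy => piecewise_eq_of_mem _ _ _ hy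
    have h2 : EqOn (Z'.piecewise f F₀) F₀ Y₀ := by
      intro y hy
      by_cases h : y ∈ Z'
      · rw [piecewise_eq_of_mem _ _ _ h, hagree y h hy]
      · exact piecewise_eq_of_notMem _ _ _ h
    obtain ⟨G, hG, hGD, hGe⟩ := hD (Z' ∪ Y₀) (Z'.piecewise f F₀) (hZc.union hY₀)
      (ContinuousOn.union_of_isClosed
        ((hf.mono (hZ' ▸ inter_subset_left)).congr h1) (hF₀.continuousOn.congr h2) hZc hY₀) (by
        rintro y (hy | hy)
        · rw [h1 hy]
          exact (hZ' ▸ hy).2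
        · rw [h2 hy]
          exact hFD y)
    exact ⟨G, hG, hGD, fun y hy => (hGe (Or.inl hy)).trans (h1 hy),
      fun y hy => (hGe (Or.inr hy)).trans (h2 hy)⟩
  obtain ⟨GA, hGA, hGAT, hGAf, hGA0⟩ := key ZA A hA rfl hZA fun y => (hF₀T y).1
  obtain ⟨GB, hGB, hGBT, hGBf, hGB0⟩ := key ZB B hB rfl hZB fun y => (hF₀T y).2
  refine ⟨fun y => if a y ≤ b y then GA y else GB y,
    Continuous.if_le hGA hGB ha hb fun y hy => (hGA0 hy).trans (hGB0 hy).symm, fun y => ?_,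
    fun y hy => ?_⟩
  · dsimp only
    split_ifs
    · exact Or.inl (hGAT y)
    · exact Or.inr (hGBT y)
  · dsimp only
    split_ifs with h
    · refine hGAf ?_
      rcases hZAB y hy with h' | h'
      · exact h'
      · rw [hb0] at h'
        rw [ha0]
        have := ha' y
        linarith
    · refine hGBf ?_
      rcases hZAB y hy with h' | h'
      · rw [ha0] at h'
        have := hb' y
        exact absurd (h'.le.trans this) h
      · exact h'

theorem Glued.isExtensor (Y : Type*) [MetricSpace Y] {C : Set (Finset V)} (hC : Glued C) :
    IsExtensor Y (geom C) := by
  induction hC with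
  | simplex s hs => exact isExtensor_simplex Y s hs
  | union C D hC hD hCD ihC ihD ihCD =>
    rw [geom_union]
    rw [geom_inter] at ihCD
    exact ihC.union (isClosed_geom hC.isLowerSet) (isClosed_geom hD.isLowerSet) ihD ihCD

end Realization

section Approximation

/-- A bump function on the star of the origin in the Freudenthal triangulation. -/
def hat {ι : Type*} [Fintype ι] (d : ι → ℝ) : ℝ :=
  (∏ i, max 0 (1 - |d i|)) * ∏ i, ∏ j, max 0 (1 - (d i - d j))

variable {ι : Type*} [Fintype ι]

theorem hat_nonneg (d : ι → ℝ) : 0 ≤ hat d :=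
  mul_nonneg (Finset.prod_nonneg fun _ _ => le_max_left _ _)
    (Finset.prod_nonneg fun _ _ => Finset.prod_nonneg fun _ _ => le_max_left _ _)

theorem hat_pos_iff (d : ι → ℝ) : 0 < hat d ↔ (∀ i, |d i| < 1) ∧ ∀ i j, d i - d j < 1 := by
  constructor
  · intro h
    have h1 := left_ne_zero_of_mul h.ne'
    have h2 := right_ne_zero_of_mul h.ne'
    simp only [Finset.prod_ne_zero_iff, Finset.mem_univ, true_imp_iff] at h1 h2
    constructor
    · intro i
      by_contra h
      exact h1 i (max_eq_left (by linarith))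
    · intro i j
      by_contra h
      exact h2 i j (max_eq_left (by linarith))
  · rintro ⟨h1, h2⟩
    refine mul_pos (Finset.prod_pos fun i _ => lt_max_of_lt_right ?_)
      (Finset.prod_pos fun i _ => Finset.prod_pos fun j _ => lt_max_of_lt_right ?_)
    · linarith [h1 i]
    · linarith [h2 i j]

theorem continuous_hat : Continuous (hat : (ι → ℝ) → ℝ) := by
  unfold hat
  fun_prop

/-- Only few translates of the bump function are positive at a point with an integral coordinate. -/
theorem card_filter_hat_pos_le [DecidableEq ι] (y : ι → ℝ) (k : ι) (m : ℤ) (hk : y k = m)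
    (G : Finset (ι → ℤ)) :
    (G.filter fun v => 0 < hat fun i => y i - v i).card ≤ Fintype.card ι := by
  have hrange : ∀ v : ι → ℤ, (0 < hat fun i => y i - v i) →
      ∀ i, 0 ≤ v i - ⌊y i⌋ ∧ v i - ⌊y i⌋ ≤ 1 := by
    intro v hv i
    have h := abs_lt.1 (((hat_pos_iff _).1 hv).1 i)
    have h1 := Int.floor_le (y i)
    have h2 := Int.lt_floor_add_one (y i)
    constructor
    · have : (⌊y i⌋ : ℝ) < v i + 1 := by linarith
      have : ⌊y i⌋ < v i + 1 := by exact_mod_cast this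
      omega
    · have : (v i : ℝ) < ⌊y i⌋ + 2 := by linarith
      have : v i < ⌊y i⌋ + 2 := by exact_mod_cast this
      omega
  have hmem : ∀ v ∈ G.filter fun v => 0 < hat fun i => y i - v i,
      ∑ i, (v i - ⌊y i⌋) ∈ Finset.Ico (0 : ℤ) (Fintype.card ι) := by
    intro v hv
    have hv := (Finset.mem_filter.1 hv).2
    have hr := hrange v hv
    rw [Finset.mem_Ico]
    refine ⟨Finset.sum_nonneg fun i _ => (hr i).1, ?_⟩
    have hvk : v k - ⌊y k⌋ < 1 := by
      have h := abs_lt.1 (((hat_pos_iff _).1 hv).1 k)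
      rw [hk] at h ⊢
      rw [Int.floor_intCast]
      have : (v k : ℝ) < m + 1 := by linarith
      have : v k < m + 1 := by exact_mod_cast this
      omega
    calc ∑ i, (v i - ⌊y i⌋) < ∑ _i : ι, (1 : ℤ) :=
          Finset.sum_lt_sum (fun i _ => (hr i).2) ⟨k, Finset.mem_univ _, hvk⟩
      _ = Fintype.card ι := by simp
  refine (Finset.card_le_card_of_injOn _ hmem ?_).trans (by simp)
  intro v hv w hw hvw
  have hv := (Finset.mem_filter.1 hv).2
  have hw := (Finset.mem_filter.1 hw).2
  have hcomp : ∀ v w : ι → ℤ, (0 < hat fun i => y i - v i) → (0 < hat fun i => y i - w i) →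
      ∀ i j, v i < w i → v j ≤ w j := by
    intro v w hv hw i j hi
    by_contra! hj
    have h1 := ((hat_pos_iff _).1 hv).2 i j
    have h2 := ((hat_pos_iff _).1 hw).2 j i
    have hi' : (v i : ℝ) + 1 ≤ w i := by exact_mod_cast hi
    have hj' : (w j : ℝ) + 1 ≤ v j := by exact_mod_cast hj
    linarith
  have hsum : ∑ i, v i = ∑ i, w i := by
    simpa using hvw
  have key : ∀ v w : ι → ℤ, (0 < hat fun i => y i - v i) → (0 < hat fun i => y i - w i) →
      ∑ i, v i = ∑ i, w i → ∀ i, w i ≤ v i := by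
    intro v w hv hw hsum i
    by_contra! hi
    exact (Finset.sum_lt_sum (fun j _ => hcomp v w hv hw i j hi) ⟨i, Finset.mem_univ _, hi⟩).ne hsum
  exact funext fun i => le_antisymm (key w v hw hv hsum.symm i) (key v w hv hw hsum i)

variable {V : Type*} [Fintype V]

theorem exists_card_inv_le {x : V → ℝ} (hx : ∑ v, x v = 1) :
    ∃ v, (Fintype.card V : ℝ)⁻¹ ≤ x v := by
  by_contra! h
  have hne : Nonempty V := by
    by_contra h'
    rw [not_nonempty_iff] at h'
    simp at hx
  have : ∑ v, x v < ∑ _v : V, (Fintype.card V : ℝ)⁻¹ :=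
    Finset.sum_lt_sum_of_nonempty Finset.univ_nonempty fun v _ => h v
  simp [hx] at this

/-- Simplicial approximation on the boundary of a cube. -/
theorem exists_simplicial_approximation [DecidableEq ι] (f : (ι → ℝ) → V → ℝ)
    (hf : ContinuousOn f (Metric.sphere 0 1))
    (hf1 : ∀ x ∈ Metric.sphere (0 : ι → ℝ) 1, ∑ v, f x v = 1) :
    ∃ F : (ι → ℝ) → V → ℝ, ContinuousOn F (Metric.sphere 0 1) ∧
      ∀ x ∈ Metric.sphere (0 : ι → ℝ) 1, (∀ v, 0 ≤ F x v) ∧ ∑ v, F x v = 1 ∧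
        supp (F x) ⊆ supp (f x) ∧ (supp (F x)).card ≤ Fintype.card ι := by
  classical
  rcases (Metric.sphere (0 : ι → ℝ) 1).eq_empty_or_nonempty with hS | ⟨x₁, hx₁⟩
  · simp [hS]
  obtain ⟨v₁, -⟩ := exists_card_inv_le (hf1 x₁ hx₁)
  have hcard : (0 : ℝ) < (Fintype.card V : ℝ)⁻¹ := by
    have : Nonempty V := ⟨v₁⟩
    positivity
  have huc := (isCompact_sphere (0 : ι → ℝ) 1).uniformContinuousOn_of_continuous hf
  obtain ⟨δ, hδ, hδf⟩ := Metric.uniformContinuousOn_iff.1 huc _ hcard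
  obtain ⟨N, hN⟩ := exists_nat_gt (2 / δ)
  have hN0 : (0 : ℝ) < N := (div_pos two_pos hδ).trans hN
  let w : (ι → ℤ) → (ι → ℝ) → ℝ := fun u x => hat fun i => N * x i - u i
  have hw : ∀ u, Continuous (w u) := fun u => continuous_hat.comp (by fun_prop)
  have hclose : ∀ u x y, 0 < w u x → 0 < w u y → dist x y < δ := by
    intro u x y hx hy
    have hx := ((hat_pos_iff _).1 hx).1
    have hy := ((hat_pos_iff _).1 hy).1
    rw [dist_pi_lt_iff hδ]
    intro i
    have hx := abs_lt.1 (hx i)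
    have hy := abs_lt.1 (hy i)
    rw [div_lt_iff₀ hδ] at hN
    have : |N * (x i - y i)| < N * δ := by
      rw [abs_lt]
      constructor <;> linarith
    rw [abs_mul, abs_of_pos hN0] at this
    exact lt_of_mul_lt_mul_left this hN0.le
  have hg : ∀ u, ∃ v, ∀ x ∈ Metric.sphere (0 : ι → ℝ) 1, 0 < w u x → 0 < f x v := by
    intro u
    by_cases h : ∃ x₀ ∈ Metric.sphere (0 : ι → ℝ) 1, 0 < w u x₀
    · obtain ⟨x₀, hx₀, hux₀⟩ := h
      obtain ⟨v, hv⟩ := exists_card_inv_le (hf1 x₀ hx₀)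
      refine ⟨v, fun x hx hux => ?_⟩
      have h1 := hδf x hx x₀ hx₀ (hclose u x x₀ hux hux₀)
      have h2 := (dist_le_pi_dist (f x) (f x₀) v).trans_lt h1
      rw [Real.dist_eq] at h2
      linarith [(abs_lt.1 h2).1]
    · exact ⟨v₁, fun x hx hux => absurd ⟨x, hx, hux⟩ h⟩
  choose g hg using hg
  let G : Finset (ι → ℤ) := Fintype.piFinset fun _ => Finset.Icc (-(N : ℤ)) N
  let W : (ι → ℝ) → ℝ := fun x => ∑ u ∈ G, w u x
  have hWc : Continuous W := continuous_finsetSum _ fun u _ => hw u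
  have hW : ∀ x ∈ Metric.sphere (0 : ι → ℝ) 1, 0 < W x := by
    intro x hx
    refine Finset.sum_pos' (fun u _ => hat_nonneg _) ⟨fun i => ⌊N * x i⌋, ?_, ?_⟩
    · refine Fintype.mem_piFinset.2 fun i => Finset.mem_Icc.2 ?_
      have hxi : |x i| ≤ 1 := by
        have := norm_le_pi_norm x i
        rwa [mem_sphere_zero_iff_norm.1 hx, Real.norm_eq_abs] at this
      have hxi := abs_le.1 hxi
      constructor
      · rw [Int.le_floor]
        push_cast
        nlinarith
      · rw [← Int.floor_natCast (R := ℝ) N]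
        exact Int.floor_le_floor (by nlinarith)
    · refine (hat_pos_iff _).2 ⟨fun i => ?_, fun i j => ?_⟩
      · rw [Int.self_sub_floor, Int.abs_fract]
        exact Int.fract_lt_one _
      · rw [Int.self_sub_floor, Int.self_sub_floor]
        linarith [Int.fract_lt_one (N * x i), Int.fract_nonneg (N * x j)]
  let F : (ι → ℝ) → V → ℝ := fun x v => (∑ u ∈ G, if g u = v then w u x else 0) / W x
  have hFpos : ∀ x v, 0 < F x v → ∃ u ∈ G, 0 < w u x ∧ g u = v := by
    intro x v h
    by_contra! h'
    refine h.ne' ?_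
    simp only [F]
    rw [Finset.sum_eq_zero, zero_div]
    intro u hu
    split_ifs with hguv
    · exact le_antisymm (not_lt.1 fun h => h' u hu h hguv) (hat_nonneg _)
    · rfl
  refine ⟨F, ?_, fun x hx => ⟨fun v => ?_, ?_, fun v hv => ?_, ?_⟩⟩
  · refine continuousOn_pi.2 fun v => ContinuousOn.div ?_ hWc.continuousOn fun x hx => (hW x hx).ne'
    refine (continuous_finsetSum _ fun u _ => ?_).continuousOn
    split_ifs
    · exact hw u
    · exact continuous_const
  · refine div_nonneg (Finset.sum_nonneg fun u _ => ?_) (hW x hx).le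
    split_ifs
    · exact hat_nonneg _
    · exact le_rfl
  · simp only [F]
    rw [← Finset.sum_div, div_eq_one_iff_eq (hW x hx).ne', Finset.sum_comm]
    simp [W]
  · obtain ⟨u, -, hu, rfl⟩ := hFpos x v (mem_supp.1 hv)
    exact mem_supp.2 (hg u x hx hu)
  · have hsub : supp (F x) ⊆ (G.filter fun u => 0 < w u x).image g := by
      intro v hv
      obtain ⟨u, huG, hu, rfl⟩ := hFpos x v (mem_supp.1 hv)
      exact Finset.mem_image_of_mem _ (Finset.mem_filter.2 ⟨huG, hu⟩)
    refine (Finset.card_le_card hsub).trans (Finset.card_image_le.trans ?_)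
    obtain ⟨k, hk⟩ : ∃ k, |x k| = 1 := by
      by_contra! h
      have hlt : ∀ i, ‖x i‖ < 1 := fun i =>
        lt_of_le_of_ne ((norm_le_pi_norm x i).trans (mem_sphere_zero_iff_norm.1 hx).le) (h i)
      exact ((pi_norm_lt_iff one_pos).2 hlt).ne (mem_sphere_zero_iff_norm.1 hx)
    rcases eq_or_eq_neg_of_abs_eq hk with hk | hk
    · exact card_filter_hat_pos_le (fun i => N * x i) k N (by simp [hk]) G
    · exact card_filter_hat_pos_le (fun i => N * x i) k (-N) (by simp [hk]) G

end Approximation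

section Connectivity

variable {V : Type*} [Fintype V] [DecidableEq V] {ι : Type*} [Fintype ι] [DecidableEq ι]

theorem SkeletonGlued.exists_extension {d : ℕ} {K : Set (Finset V)} (hK : IsLowerSet K)
    (hd : SkeletonGlued d K) (hι : Fintype.card ι ≤ d) (f : (ι → ℝ) → V → ℝ)
    (hf : ContinuousOn f (Metric.sphere 0 1)) (hfK : MapsTo f (Metric.sphere 0 1) (geom K)) :
    ∃ F : (ι → ℝ) → V → ℝ, ContinuousOn F (Metric.closedBall 0 1) ∧
      MapsTo F (Metric.closedBall 0 1) (geom K) ∧ EqOn F f (Metric.sphere 0 1) := by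
  obtain ⟨C, hC, hCK, hCs, -⟩ := hd
  obtain ⟨F₁, hF₁, hF₁'⟩ := exists_simplicial_approximation f hf fun x hx => (hfK hx).2.1
  obtain ⟨F₂, hF₂, hF₂C, hF₂e⟩ := hC.isExtensor (ι → ℝ) (Metric.sphere 0 1) F₁
    Metric.isClosed_sphere hF₁ fun x hx => by
      obtain ⟨h1, h2, h3, h4⟩ := hF₁' x hx
      exact ⟨h1, h2, hCs _ (hK h3 (hfK hx).2.2) (h4.trans hι)⟩
  let p : (ι → ℝ) → ι → ℝ := fun y => ‖y‖⁻¹ • y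
  let F₃ : (ι → ℝ) → V → ℝ := fun y =>
    (2 - 2 * ‖y‖) • F₁ (p y) + (2 * ‖y‖ - 1) • f (p y)
  let F : (ι → ℝ) → V → ℝ := fun y => if ‖y‖ ≤ 1 / 2 then F₂ ((2 : ℝ) • y) else F₃ y
  have hp : ∀ y : ι → ℝ, 1 / 2 ≤ ‖y‖ → p y ∈ Metric.sphere (0 : ι → ℝ) 1 := by
    intro y hy
    have hy0 : ‖y‖ ≠ 0 := by linarith
    simp only [p, mem_sphere_zero_iff_norm, norm_smul, norm_inv, norm_norm]
    exact inv_mul_cancel₀ hy0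
  have hF₃F : ∀ y : ι → ℝ, 1 / 2 ≤ ‖y‖ → F y = F₃ y := by
    intro y hy
    by_cases h : ‖y‖ ≤ 1 / 2
    · have h' : ‖y‖ = 1 / 2 := le_antisymm h hy
      have : p y = (2 : ℝ) • y := by simp [p, h']
      simp only [F, if_pos h, F₃]
      rw [← this, hF₂e (hp y hy), h']
      simp
      norm_num
    · simp only [F, if_neg h]
  refine ⟨F, ?_, fun y hy => ?_, fun y hy => ?_⟩
  · have e : Metric.closedBall (0 : ι → ℝ) 1 ⊆
        {y | ‖y‖ ≤ 1 / 2} ∪ {y | 1 / 2 ≤ ‖y‖} := fun y _ =>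
      (le_total ‖y‖ (1 / 2)).imp id id
    refine ContinuousOn.mono (ContinuousOn.union_of_isClosed ?_ ?_
      (isClosed_le continuous_norm continuous_const)
      (isClosed_le continuous_const continuous_norm)) e
    · refine (hF₂.comp (continuous_const_smul (2 : ℝ))).continuousOn.congr fun y hy => ?_
      exact if_pos hy
    · refine ContinuousOn.congr ?_ hF₃F
      have hpc : ContinuousOn p {y | 1 / 2 ≤ ‖y‖} :=
        (continuous_norm.continuousOn.inv₀ fun y (hy : 1 / 2 ≤ ‖y‖) => by linarith).smul
          continuousOn_id
      exact ((by fun_prop : Continuous fun y : ι → ℝ => 2 - 2 * ‖y‖).continuousOn.smul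
        (hF₁.comp hpc hp)).add
        ((by fun_prop : Continuous fun y : ι → ℝ => 2 * ‖y‖ - 1).continuousOn.smul
        (hf.comp hpc hp))
  · rw [mem_closedBall_zero_iff] at hy
    by_cases h : ‖y‖ ≤ 1 / 2
    · simp only [F, if_pos h]
      exact geom_mono hCK (hF₂C _)
    · push Not at h
      rw [hF₃F y h.le]
      obtain ⟨h1, h2, h3, -⟩ := hF₁' _ (hp y h.le)
      obtain ⟨k1, k2, k3⟩ := hfK (hp y h.le)
      have ha : 0 ≤ 2 - 2 * ‖y‖ := by linarith
      have hb : 0 ≤ 2 * ‖y‖ - 1 := by linarith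
      refine ⟨fun v => add_nonneg (mul_nonneg ha (h1 v)) (mul_nonneg hb (k1 v)), ?_, ?_⟩
      · simp only [F₃, Pi.add_apply, Pi.smul_apply, smul_eq_mul, Finset.sum_add_distrib,
          ← Finset.mul_sum, h2, k2]
        ring
      · refine hK (fun v hv => ?_) k3
        by_contra hv'
        have e1 : f (p y) v = 0 := le_antisymm (not_lt.1 fun h => hv' (mem_supp.2 h)) (k1 v)
        have e2 : F₁ (p y) v = 0 :=
          le_antisymm (not_lt.1 fun h => hv' (h3 (mem_supp.2 h))) (h1 v)
        have := mem_supp.1 hv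
        simp [F₃, e1, e2] at this
  · rw [mem_sphere_zero_iff_norm] at hy
    rw [hF₃F y (by rw [hy]; norm_num)]
    simp only [F₃, p, hy]
    simp
    norm_num

theorem SkeletonGlued.pathConnectedSpace {d : ℕ} {K : Set (Finset V)} (hK : IsLowerSet K)
    (hd : SkeletonGlued d K) (h1 : 1 ≤ d) (hne : (geom K).Nonempty) :
    PathConnectedSpace (geom K) := by
  rw [← isPathConnected_iff_pathConnectedSpace]
  obtain ⟨x, hx⟩ := hne
  refine ⟨x, hx, fun {y} hy => ?_⟩
  let f : (Fin 1 → ℝ) → V → ℝ := fun t => ((1 - t 0) / 2) • x + ((1 + t 0) / 2) • y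
  have hs : ∀ t : Fin 1 → ℝ, ‖t‖ = |t 0| := fun t => by
    rw [← Real.norm_eq_abs]
    exact le_antisymm ((pi_norm_le_iff_of_nonneg (norm_nonneg _)).2 fun i => by
      rw [Subsingleton.elim i 0]) (norm_le_pi_norm t 0)
  obtain ⟨F, hF, hFK, hFf⟩ := hd.exists_extension hK (by simpa using h1) f
    (by fun_prop : Continuous f).continuousOn (by
      intro t ht
      rw [mem_sphere_zero_iff_norm, hs] at ht
      rcases eq_or_eq_neg_of_abs_eq ht with h | h
      · simpa [f, h] using hy
      · simp only [f, h]
        norm_num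
        exact hx)
  have hball : ∀ t ∈ Icc (0 : ℝ) 1, (fun _ : Fin 1 => 2 * t - 1) ∈ Metric.closedBall 0 1 := by
    intro t ht
    rw [mem_closedBall_zero_iff, hs, abs_le]
    constructor <;> linarith [ht.1, ht.2]
  have h0 : F (fun _ => -1) = x := by
    rw [hFf (by simp [hs])]
    simp only [f]
    norm_num
  have h1 : F (fun _ => 1) = y := by
    rw [hFf (by simp [hs])]
    simp [f]
  refine JoinedIn.ofLine (f := fun t => F fun _ => 2 * t - 1)
    (hF.comp (by fun_prop) hball) ?_ ?_ ?_
  · simpa using h0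
  · norm_num
    exact h1
  · rintro _ ⟨t, ht, rfl⟩
    exact hFK (hball t ht)

open scoped Topology.Homotopy unitInterval

theorem SkeletonGlued.subsingleton_homotopyGroup {d : ℕ} {K : Set (Finset V)} (hK : IsLowerSet K)
    (hd : SkeletonGlued d K) (n : ℕ) (hn : n + 1 ≤ d) (x : geom K) :
    Subsingleton (HomotopyGroup (Fin n) (geom K) x) := by
  have key : ∀ g : GenLoop (Fin n) (geom K) x, GenLoop.Homotopic g GenLoop.const := by
    intro g
    let q : (Option (Fin n) → ℝ) → (Fin n → I) := fun y i =>
      projIcc 0 1 zero_le_one ((1 + y (some i)) / 2)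
    have hq : Continuous q := continuous_pi fun i => continuous_projIcc.comp (by fun_prop)
    let f : (Option (Fin n) → ℝ) → V → ℝ := fun y => if y none = -1 then (g (q y)).1 else x.1
    let Z₁ : Set (Option (Fin n) → ℝ) := {y | y none = -1}
    let Z₂ : Set (Option (Fin n) → ℝ) := {y | y none = 1} ∪ ⋃ i, {y | |y (some i)| = 1}
    have hsZ : Metric.sphere (0 : Option (Fin n) → ℝ) 1 ⊆ Z₁ ∪ Z₂ := by
      intro y hy
      rw [mem_sphere_zero_iff_norm] at hy
      obtain ⟨k, hk⟩ : ∃ k, |y k| = 1 := by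
        by_contra! h
        have hlt : ∀ i, ‖y i‖ < 1 := fun i =>
          lt_of_le_of_ne ((norm_le_pi_norm y i).trans hy.le) (h i)
        exact ((pi_norm_lt_iff one_pos).2 hlt).ne hy
      cases k with
      | none =>
        rcases eq_or_eq_neg_of_abs_eq hk with h | h
        · exact Or.inr (Or.inl h)
        · exact Or.inl h
      | some i => exact Or.inr (Or.inr (mem_iUnion.2 ⟨i, hk⟩))
    have hqb : ∀ y : Option (Fin n) → ℝ, ∀ i, |y (some i)| = 1 → g (q y) = x := by
      intro y i hi
      refine g.2 _ ⟨i, ?_⟩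
      rcases eq_or_eq_neg_of_abs_eq hi with h | h
      · right
        simp [q, h]
      · left
        simp [q, h]
    have hf2 : ∀ y ∈ Z₂, f y = x.1 := by
      rintro y (hy | hy)
      · have hy : y none = 1 := hy
        have : ¬ ((1 : ℝ) = -1) := by norm_num
        simp [f, hy, this]
      · obtain ⟨i, hi⟩ := mem_iUnion.1 hy
        simp only [f]
        split_ifs
        · rw [hqb y i hi]
        · rfl
    have hgc : Continuous fun y => (g (q y)).1 :=
      continuous_subtype_val.comp ((map_continuous g.1).comp hq)
    have hfc : ContinuousOn f (Z₁ ∪ Z₂) := by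
      refine ContinuousOn.union_of_isClosed ?_ ?_ ?_ ?_
      · exact hgc.continuousOn.congr fun y hy => if_pos hy
      · exact continuousOn_const.congr hf2
      · exact isClosed_eq (continuous_apply _) continuous_const
      · refine IsClosed.union (isClosed_eq (continuous_apply _) continuous_const) ?_
        exact isClosed_iUnion_of_finite fun i =>
          isClosed_eq (continuous_apply (some i)).abs continuous_const
    obtain ⟨F, hF, hFK, hFf⟩ := hd.exists_extension hK (by simpa using hn) f (hfc.mono hsZ) (by
      intro y _
      simp only [f]
      split_ifs
      · exact (g (q y)).2
      · exact x.2)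
    let r : I × (Fin n → I) → Option (Fin n) → ℝ := fun p k =>
      k.elim (2 * (p.1 : ℝ) - 1) fun i => 2 * (p.2 i : ℝ) - 1
    have hr : Continuous r := continuous_pi fun k => by
      cases k <;> simp only [r, Option.elim] <;> fun_prop
    have habs : ∀ t : I, |2 * (t : ℝ) - 1| ≤ 1 := fun t => by
      rw [abs_le]
      constructor <;> linarith [t.2.1, t.2.2]
    have hrle : ∀ p, ‖r p‖ ≤ 1 := fun p => (pi_norm_le_iff_of_nonneg zero_le_one).2 fun k => by
      cases k with
      | none => exact habs _
      | some i => exact habs _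
    have hrb : ∀ p, r p ∈ Metric.closedBall (0 : Option (Fin n) → ℝ) 1 := fun p =>
      mem_closedBall_zero_iff.2 (hrle p)
    have hrs : ∀ p k, |r p k| = 1 → r p ∈ Metric.sphere (0 : Option (Fin n) → ℝ) 1 := fun p k h =>
      mem_sphere_zero_iff_norm.2 (le_antisymm (hrle p) (h ▸ norm_le_pi_norm (r p) k))
    have hqr : ∀ t c, q (r (t, c)) = c := fun t c => by
      funext i
      have : (1 + (2 * (c i : ℝ) - 1)) / 2 = c i := by ring
      simp only [q, r, Option.elim, this, projIcc_val]
    refine ⟨⟨⟨⟨fun p => ⟨F (r p), hFK (hrb p)⟩, ?_⟩, fun c => ?_, fun c => ?_⟩, fun t c hc => ?_⟩⟩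
    · exact (hF.comp_continuous hr hrb).subtype_mk _
    · refine Subtype.ext ?_
      change F (r (0, c)) = (g c).1
      rw [hFf (hrs (0, c) none (by simp [r]))]
      simp only [f, hqr]
      exact if_pos (by simp [r])
    · refine Subtype.ext ?_
      change F (r (1, c)) = x.1
      have hr1 : r (1, c) none = 1 := by
        simp only [r, Option.elim, Icc.coe_one]
        norm_num
      rw [hFf (hrs (1, c) none (by simp [hr1]))]
      exact hf2 _ (Or.inl hr1)
    · refine Subtype.ext ?_
      change F (r (t, c)) = (g c).1
      obtain ⟨i, hi⟩ := hc
      have hri : |r (t, c) (some i)| = 1 := by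
        simp only [r, Option.elim]
        rcases hi with hi | hi <;> rw [hi] <;> norm_num
      have hgx : g c = x := g.2 c ⟨i, hi⟩
      rw [hFf (hrs (t, c) (some i) hri), hgx]
      exact hf2 _ (Or.inr (mem_iUnion.2 ⟨i, hri⟩))
  refine ⟨fun a b => ?_⟩
  induction a using Quotient.inductionOn
  induction b using Quotient.inductionOn
  exact Quotient.sound ((key _).trans (key _).symm)

end Connectivity

section Chains

/-- Augmented ordered chains modulo two. -/
abbrev Chain (Y : Type*) := List Y →₀ ZMod 2

variable {Y Z : Type*}

theorem Chain.add_self (c : Chain Y) : c + c = 0 := by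
  ext l
  exact CharTwo.add_self_eq_zero (c l)

/-- The cone operator, adding a vertex in front. -/
noncomputable def coneMap (y : Y) : Chain Y →ₗ[ZMod 2] Chain Y :=
  Finsupp.lmapDomain (ZMod 2) (ZMod 2) (List.cons y)

@[simp] theorem coneMap_single (y : Y) (l : List Y) (a : ZMod 2) :
    coneMap y (Finsupp.single l a) = Finsupp.single (y :: l) a := by
  simp [coneMap]

/-- The boundary of a list: the sum of its codimension one sublists. -/
noncomputable def listBoundary : List Y → Chain Y
  | [] => 0
  | y :: l => Finsupp.single l 1 + coneMap y (listBoundary l)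

/-- The linear extension of a map from lists to chains. -/
noncomputable def extend {M : Type*} [AddCommGroup M] [Module (ZMod 2) M] (f : List Y → M) :
    Chain Y →ₗ[ZMod 2] M :=
  Finsupp.linearCombination (ZMod 2) f

@[simp] theorem extend_single {M : Type*} [AddCommGroup M] [Module (ZMod 2) M] (f : List Y → M)
    (l : List Y) (a : ZMod 2) : extend f (Finsupp.single l a) = a • f l := by
  simp [extend]

/-- The boundary operator. -/
noncomputable def boundary : Chain Y →ₗ[ZMod 2] Chain Y := extend listBoundary

@[simp] theorem boundary_single (l : List Y) (a : ZMod 2) :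
    boundary (Finsupp.single l a) = a • listBoundary l := extend_single _ _ _

theorem boundary_coneMap (y : Y) (c : Chain Y) :
    boundary (coneMap y c) = c + coneMap y (boundary c) := by
  induction c using Finsupp.induction_linear with
  | zero => simp
  | add f g hf hg =>
    simp only [map_add, hf, hg]
    abel
  | single l a => simp [listBoundary]

theorem boundary_listBoundary (l : List Y) : boundary (listBoundary l) = 0 := by
  induction l with
  | nil => simp [listBoundary]
  | cons y l ih =>
    simp only [listBoundary, map_add, boundary_coneMap, ih, map_zero, add_zero, boundary_single,
      one_smul]
    exact Chain.add_self _

/-- The chain map induced by a map of vertices. -/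
noncomputable def pushforward (f : Y → Z) : Chain Y →ₗ[ZMod 2] Chain Z :=
  Finsupp.lmapDomain (ZMod 2) (ZMod 2) (List.map f)

@[simp] theorem pushforward_single (f : Y → Z) (l : List Y) (a : ZMod 2) :
    pushforward f (Finsupp.single l a) = Finsupp.single (l.map f) a := by
  simp [pushforward]

theorem pushforward_coneMap (f : Y → Z) (y : Y) (c : Chain Y) :
    pushforward f (coneMap y c) = coneMap (f y) (pushforward f c) := by
  induction c using Finsupp.induction_linear with
  | zero => simp
  | add f g hf hg => simp only [map_add, hf, hg]
  | single l a => simp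

theorem pushforward_listBoundary (f : Y → Z) (l : List Y) :
    pushforward f (listBoundary l) = listBoundary (l.map f) := by
  induction l with
  | nil => simp [listBoundary]
  | cons y l ih => simp [listBoundary, pushforward_coneMap, ih]

theorem boundary_pushforward (f : Y → Z) (c : Chain Y) :
    boundary (pushforward f c) = pushforward f (boundary c) := by
  induction c using Finsupp.induction_linear with
  | zero => simp
  | add f g hf hg => simp only [map_add, hf, hg]
  | single l a => simp [pushforward_listBoundary]

/-- The chains all of whose lists satisfy a predicate. -/
noncomputable def chainsOn (P : List Y → Prop) : Submodule (ZMod 2) (Chain Y) :=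
  Submodule.span (ZMod 2) ((fun l => Finsupp.single l 1) '' {l | P l})

theorem single_mem_chainsOn {P : List Y → Prop} {l : List Y} (h : P l) :
    Finsupp.single l 1 ∈ chainsOn P :=
  Submodule.subset_span ⟨l, h, rfl⟩

theorem map_mem_of_mem_chainsOn {M : Type*} [AddCommGroup M] [Module (ZMod 2) M]
    {P : List Y → Prop} {S : Submodule (ZMod 2) M} (f : Chain Y →ₗ[ZMod 2] M)
    (h : ∀ l, P l → f (Finsupp.single l 1) ∈ S) {c : Chain Y} (hc : c ∈ chainsOn P) : f c ∈ S := by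
  have : chainsOn P ≤ S.comap f := by
    refine Submodule.span_le.2 ?_
    rintro _ ⟨l, hl, rfl⟩
    exact h l hl
  exact this hc

theorem map_eq_of_mem_chainsOn {M : Type*} [AddCommGroup M] [Module (ZMod 2) M]
    {P : List Y → Prop} (f g : Chain Y →ₗ[ZMod 2] M)
    (h : ∀ l, P l → f (Finsupp.single l 1) = g (Finsupp.single l 1)) {c : Chain Y}
    (hc : c ∈ chainsOn P) : f c = g c := by
  refine LinearMap.eqOn_span ?_ hc
  rintro _ ⟨l, hl, rfl⟩
  exact h l hl

theorem chainsOn_mono {P Q : List Y → Prop} (h : ∀ l, P l → Q l) : chainsOn P ≤ chainsOn Q :=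
  Submodule.span_mono (image_mono h)

theorem listBoundary_mem_chainsOn (l : List Y) :
    listBoundary l ∈ chainsOn fun m => m.length + 1 = l.length ∧ m ⊆ l := by
  induction l with
  | nil => simp [listBoundary]
  | cons y l ih =>
    refine Submodule.add_mem _ (single_mem_chainsOn ⟨rfl, List.subset_cons_self y l⟩)
      (map_mem_of_mem_chainsOn _ (fun m hm => ?_) ih)
    rw [coneMap_single]
    exact single_mem_chainsOn ⟨by simp [hm.1], List.cons_subset_cons y hm.2⟩

section Subdivision

variable {E : Type*} [NormedAddCommGroup E] [NormedSpace ℝ E]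

/-- The barycenter of a list of points. -/
noncomputable def barycenter (l : List E) : E := (l.length : ℝ)⁻¹ • l.sum

/-- Barycentric subdivision of lists of length `n`. -/
noncomputable def subdivision : ℕ → Chain E →ₗ[ZMod 2] Chain E
  | 0 => LinearMap.id
  | n + 1 => extend fun l => coneMap (barycenter l) (subdivision n (listBoundary l))

theorem boundary_subdivision (n : ℕ) (l : List E) (hl : l.length = n + 1) :
    boundary (subdivision (n + 1) (Finsupp.single l 1)) = subdivision n (listBoundary l) := by
  induction n generalizing l with
  | zero =>
    obtain ⟨y, rfl⟩ := List.length_eq_one_iff.1 hl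
    simp [subdivision, listBoundary]
  | succ n ih =>
    rw [subdivision, extend_single, one_smul, boundary_coneMap]
    have : boundary (subdivision (n + 1) (listBoundary l)) = 0 := by
      have h := map_eq_of_mem_chainsOn (boundary ∘ₗ subdivision (n + 1))
        (subdivision n ∘ₗ boundary) (fun m hm => by
          have : m.length = n + 1 := by have := hm.1; omega
          simp [ih m this]) (listBoundary_mem_chainsOn l)
      simpa [boundary_listBoundary] using h
    rw [this, map_zero, add_zero]

theorem barycenter_mem {C : Set E} (hC : Convex ℝ C) {l : List E} (hl : l ≠ [])
    (h : ∀ x ∈ l, x ∈ C) : barycenter l ∈ C := by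
  have hpos : (0 : ℝ) < l.length := by
    exact_mod_cast List.length_pos_iff.2 hl
  have e : barycenter l = ∑ i : Fin l.length, (l.length : ℝ)⁻¹ • l[i] := by
    rw [← Finset.smul_sum, barycenter, ← Fin.sum_univ_getElem]
    rfl
  rw [e]
  refine hC.sum_mem (fun _ _ => inv_nonneg.2 hpos.le) ?_ fun i _ => h _ (List.getElem_mem _)
  simp [hpos.ne']

theorem dist_barycenter_le {l : List E} {D : ℝ} {n : ℕ} (hn : l.length ≤ n + 1)
    (hD : ∀ x ∈ l, ∀ y ∈ l, dist x y ≤ D) {v : E} (hv : v ∈ l) :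
    dist (barycenter l) v ≤ n / (n + 1) * D := by
  have hpos : (0 : ℝ) < l.length := by
    exact_mod_cast List.length_pos_iff.2 (List.ne_nil_of_mem hv)
  have hD0 : 0 ≤ D := dist_nonneg.trans (hD v hv v hv)
  obtain ⟨k, hk, rfl⟩ := List.mem_iff_getElem.1 hv
  have e : barycenter l - l[k] = (l.length : ℝ)⁻¹ • ∑ i : Fin l.length, (l[i] - l[k]) := by
    rw [Finset.sum_sub_distrib, smul_sub, barycenter]
    congr 1
    · congr 1
      exact (Fin.sum_univ_getElem l).symm
    · rw [Finset.sum_const, Finset.card_univ, Fintype.card_fin, ← Nat.cast_smul_eq_nsmul ℝ,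
        inv_smul_smul₀ hpos.ne']
  have hsum : ‖∑ i : Fin l.length, (l[i] - l[k])‖ ≤ (l.length - 1) * D := by
    rw [← Finset.sum_erase_add _ _ (Finset.mem_univ (⟨k, hk⟩ : Fin l.length))]
    simp only [Fin.getElem_fin, sub_self, add_zero]
    refine (norm_sum_le_of_le _ (f := fun i : Fin l.length => l[(i : ℕ)] - l[k]) (n := fun _ => D)
      fun i _ => ?_).trans ?_
    · rw [← dist_eq_norm]
      exact hD _ (List.getElem_mem _) _ hv
    · rw [Finset.sum_const, Finset.card_erase_of_mem (Finset.mem_univ _), Finset.card_univ,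
        Fintype.card_fin, nsmul_eq_mul, Nat.cast_sub (by omega), Nat.cast_one]
  rw [dist_eq_norm, e, norm_smul, norm_inv, Real.norm_natCast]
  refine (mul_le_mul_of_nonneg_left hsum (inv_nonneg.2 hpos.le)).trans ?_
  rw [← mul_assoc]
  refine mul_le_mul_of_nonneg_right ?_ hD0
  have hn' : (l.length : ℝ) ≤ n + 1 := by exact_mod_cast hn
  rw [inv_mul_le_iff₀ hpos, mul_div_assoc', le_div_iff₀ (by positivity)]
  nlinarith

theorem subdivision_mem_chainsOn (n k : ℕ) (hk : k ≤ n + 1) (C : Set E) (hC : Convex ℝ C) (D : ℝ)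
    (l : List E) (hl : l.length = k) (hlC : ∀ x ∈ l, x ∈ C)
    (hD : ∀ x ∈ l, ∀ y ∈ l, dist x y ≤ D) :
    subdivision k (Finsupp.single l 1) ∈ chainsOn fun m => m.length = k ∧ (∀ x ∈ m, x ∈ C) ∧
      ∀ x ∈ m, ∀ y ∈ m, dist x y ≤ n / (n + 1) * D := by
  induction k generalizing l C with
  | zero =>
    obtain rfl := List.length_eq_zero_iff.1 hl
    exact single_mem_chainsOn (by simp)
  | succ k ih =>
    have hne : l ≠ [] := by
      rintro rfl
      simp at hl
    obtain ⟨v, hv⟩ := List.exists_mem_of_ne_nil l hne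
    have hD0 : 0 ≤ D := dist_nonneg.trans (hD v hv v hv)
    let C' : Set E := C ∩ Metric.closedBall (barycenter l) (n / (n + 1) * D)
    have hlC' : ∀ x ∈ l, x ∈ C' := fun x hx => ⟨hlC x hx, by
      rw [Metric.mem_closedBall, dist_comm]
      exact dist_barycenter_le (hl ▸ hk) hD hx⟩
    rw [subdivision, extend_single, one_smul]
    refine map_mem_of_mem_chainsOn (coneMap (barycenter l)) (fun m hm => ?_)
      (map_mem_of_mem_chainsOn (subdivision k) (fun m hm => ih (by omega) C'
        (hC.inter (convex_closedBall _ _)) m (by have := hm.1; omega)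
        (fun x hx => hlC' x (hm.2 hx)) fun x hx y hy => hD x (hm.2 hx) y (hm.2 hy))
        (listBoundary_mem_chainsOn l))
    rw [coneMap_single]
    obtain ⟨h1, h2, h3⟩ := hm
    refine single_mem_chainsOn ⟨by simp [h1], fun x hx => ?_, fun x hx y hy => ?_⟩
    · rcases List.mem_cons.1 hx with rfl | hx
      · exact barycenter_mem hC hne hlC
      · exact (h2 x hx).1
    · rcases List.mem_cons.1 hx with rfl | hx <;> rcases List.mem_cons.1 hy with rfl | hy
      · rw [dist_self]
        positivity
      · exact dist_comm y _ ▸ (h2 y hy).2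
      · exact (h2 x hx).2
      · exact h3 x hx y hy

theorem boundary_subdivision_iterate (n N : ℕ) {c : Chain E}
    (hc : c ∈ chainsOn fun l => l.length = n + 1) :
    boundary ((subdivision (n + 1))^[N] c) = (subdivision n)^[N] (boundary c) := by
  induction N generalizing c with
  | zero => rfl
  | succ N ih =>
    have h1 : subdivision (n + 1) c ∈ chainsOn fun l => l.length = n + 1 := by
      refine map_mem_of_mem_chainsOn _ (fun l hl => ?_) hc
      obtain ⟨D, hD⟩ : ∃ D, ∀ x ∈ l, ∀ y ∈ l, dist x y ≤ D := by
        obtain ⟨D, hD⟩ := Metric.isBounded_iff.1 l.finite_toSet.isBounded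
        exact ⟨D, fun x hx y hy => hD hx hy⟩
      exact chainsOn_mono (fun m hm => hm.1)
        (subdivision_mem_chainsOn n (n + 1) le_rfl univ convex_univ D l hl (by simp) hD)
    rw [Function.iterate_succ_apply, Function.iterate_succ_apply, ih h1]
    congr 1
    have h2 := map_eq_of_mem_chainsOn (boundary ∘ₗ subdivision (n + 1)) (subdivision n ∘ₗ boundary)
      (fun l hl => by simp [boundary_subdivision n l hl]) hc
    simpa only [LinearMap.comp_apply] using h2

theorem subdivision_iterate_mem_chainsOn (n k N : ℕ) (hk : k ≤ n + 1) (C : Set E)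
    (hC : Convex ℝ C) (D : ℝ) {c : Chain E} (hc : c ∈ chainsOn fun m => m.length = k ∧
      (∀ x ∈ m, x ∈ C) ∧ ∀ x ∈ m, ∀ y ∈ m, dist x y ≤ D) :
    (subdivision k)^[N] c ∈ chainsOn fun m => m.length = k ∧ (∀ x ∈ m, x ∈ C) ∧
      ∀ x ∈ m, ∀ y ∈ m, dist x y ≤ (n / (n + 1)) ^ N * D := by
  induction N with
  | zero => simpa using hc
  | succ N ih =>
    rw [Function.iterate_succ_apply']
    refine map_mem_of_mem_chainsOn _ (fun l hl => ?_) ih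
    rw [pow_succ', mul_assoc]
    exact subdivision_mem_chainsOn n k hk C hC _ l hl.1 hl.2.1 hl.2.2

end Subdivision

section Prism

/-- The prism operator joining a chain map `Ψ` to the identity. -/
noncomputable def prism (Ψ : ℕ → Chain Y →ₗ[ZMod 2] Chain Y) : ℕ → Chain Y →ₗ[ZMod 2] Chain Y
  | 0 => 0
  | n + 1 => extend fun l => match l with
    | [] => 0
    | y :: l => coneMap y (Ψ (n + 1) (Finsupp.single (y :: l) 1) + Finsupp.single (y :: l) 1 +
        prism Ψ n (listBoundary (y :: l)))

variable {Ψ : ℕ → Chain Y →ₗ[ZMod 2] Chain Y} {P : List Y → Prop}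

theorem boundary_prism (hP : ∀ l m, P l → m ⊆ l → P m)
    (hΨ : ∀ n l, l.length = n + 1 → P l →
      boundary (Ψ (n + 1) (Finsupp.single l 1)) = Ψ n (listBoundary l))
    (hΨ0 : Ψ 0 (Finsupp.single [] 1) = Finsupp.single [] 1)
    (n : ℕ) (l : List Y) (hl : l.length = n + 1) (hPl : P l) :
    boundary (prism Ψ (n + 1) (Finsupp.single l 1)) =
      Ψ (n + 1) (Finsupp.single l 1) + Finsupp.single l 1 + prism Ψ n (listBoundary l) := by
  induction n generalizing l with
  | zero =>
    obtain ⟨y, rfl⟩ := List.length_eq_one_iff.1 hl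
    have h : boundary (Ψ (0 + 1) (Finsupp.single [y] 1) + Finsupp.single [y] 1) = 0 := by
      rw [map_add, hΨ 0 _ hl hPl]
      simp [listBoundary, hΨ0, Chain.add_self]
    simp only [prism, extend_single, one_smul, LinearMap.zero_apply, add_zero, boundary_coneMap, h,
      map_zero]
  | succ n ih =>
    cases l with
    | nil => simp at hl
    | cons y l =>
      rw [prism, extend_single, one_smul]
      simp only
      rw [boundary_coneMap, map_add boundary, map_add boundary, hΨ (n + 1) _ hl hPl,
        boundary_single, one_smul]
      have h := map_eq_of_mem_chainsOn (boundary ∘ₗ prism Ψ (n + 1))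
        (Ψ (n + 1) + LinearMap.id + prism Ψ n ∘ₗ boundary) (fun m hm => by
          have := hm.1
          simp [ih m (by omega) (hP _ _ hPl hm.2)]) (listBoundary_mem_chainsOn (y :: l))
      simp only [LinearMap.comp_apply, LinearMap.add_apply, LinearMap.id_apply,
        boundary_listBoundary, map_zero, add_zero] at h
      rw [h, Chain.add_self, map_zero, add_zero]

theorem prism_mem_chainsOn (hP : ∀ l m, P l → m ⊆ l → P m)
    (hΨ : ∀ n l, l.length = n → P l →
      Ψ n (Finsupp.single l 1) ∈ chainsOn fun m => m.length = n ∧ m ⊆ l)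
    (n : ℕ) (l : List Y) (hl : l.length = n) (hPl : P l) :
    prism Ψ n (Finsupp.single l 1) ∈ chainsOn fun m => m.length = n + 1 ∧ m ⊆ l := by
  induction n generalizing l with
  | zero => simp [prism]
  | succ n ih =>
    cases l with
    | nil => simp at hl
    | cons y l =>
      rw [prism, extend_single, one_smul]
      have h : Ψ (n + 1) (Finsupp.single (y :: l) 1) + Finsupp.single (y :: l) 1 +
          prism Ψ n (listBoundary (y :: l)) ∈
            chainsOn fun m => m.length = n + 1 ∧ m ⊆ y :: l := by
        refine Submodule.add_mem _ (Submodule.add_mem _ (hΨ _ _ hl hPl)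
          (single_mem_chainsOn ⟨hl, List.Subset.refl _⟩))
          (map_mem_of_mem_chainsOn _ (fun m hm => ?_) (listBoundary_mem_chainsOn _))
        exact chainsOn_mono (fun k hk => ⟨hk.1, List.Subset.trans hk.2 hm.2⟩)
          (ih m (by have := hm.1; omega) (hP _ _ hPl hm.2))
      refine map_mem_of_mem_chainsOn (coneMap y) (fun m hm => ?_) h
      rw [coneMap_single]
      exact single_mem_chainsOn ⟨by simp [hm.1],
        List.cons_subset.2 ⟨List.mem_cons_self, hm.2⟩⟩

end Prism

end Chains

section SphereExtension

open scoped Topology.Homotopy unitInterval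

theorem exists_extension_of_subsingleton_homotopyGroup {X : Type*} [TopologicalSpace X] {n : ℕ}
    (s : (Fin n → ℝ) × ℝ → X) (hs : ContinuousOn s {0}ᶜ)
    (hX : Subsingleton (HomotopyGroup (Fin n) X (s (0, 1)))) :
    ∃ S : (Fin n → ℝ) × ℝ → X, Continuous S ∧
      ∀ v, 1 ≤ 4 * ‖v.1‖ + v.2 ^ 2 → S v = s v := by
  let y : (Fin n → I) → Fin n → ℝ := fun c i => 2 * (c i : ℝ) - 1
  have hy : Continuous y := by fun_prop
  have hy1 : ∀ c, ‖y c‖ ≤ 1 := fun c => (pi_norm_le_iff_of_nonneg zero_le_one).2 fun i => by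
    rw [Real.norm_eq_abs, abs_le]
    constructor <;> linarith [(c i).2.1, (c i).2.2]
  have hyb : ∀ c ∈ Cube.boundary (Fin n), ‖y c‖ = 1 := by
    rintro c ⟨i, hi⟩
    refine le_antisymm (hy1 c) ?_
    have h := norm_le_pi_norm (y c) i
    have : ‖y c i‖ = 1 := by
      simp only [y]
      rcases hi with hi | hi <;> rw [hi] <;> norm_num
    rwa [this] at h
  have hyinj : Function.Injective y := fun c d h => funext fun i => Subtype.ext (by
    have := congrFun h i
    simp only [y] at this
    linarith)
  let r : I × (Fin n → I) → ℝ := fun p => (1 - p.1) * (1 - ‖y p.2‖)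
  have hr : Continuous r := by fun_prop
  let Q : I × (Fin n → I) → (Fin n → ℝ) × ℝ := fun p => (r p • y p.2, 1 - 2 * r p)
  have hQ : Continuous Q := by fun_prop
  have hr0 : ∀ p, 0 ≤ r p := fun p => mul_nonneg (sub_nonneg.2 p.1.2.2) (sub_nonneg.2 (hy1 _))
  have hQ0 : ∀ c, Q (0, c) ≠ 0 := by
    intro c h
    have h1 := congrArg Prod.snd h
    have h2 := congrArg (fun v => ‖v.1‖) h
    simp only [Q, r, norm_smul, Prod.snd_zero, Prod.fst_zero, norm_zero, mul_eq_zero,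
      norm_eq_zero, Icc.coe_zero] at h1 h2
    rcases h2 with (h2 | h2) | h2
    · norm_num at h2
    · rw [h2] at h1
      norm_num at h1
    · rw [h2] at h1
      norm_num at h1
  have hrb : ∀ t, ∀ c ∈ Cube.boundary (Fin n), r (t, c) = 0 := fun t c hc => by
    simp [r, hyb c hc]
  have hQr : ∀ p, r p = 0 → Q p = (0, 1) := fun p hp => by simp [Q, hp]
  let f : GenLoop (Fin n) X (s (0, 1)) := ⟨⟨fun c => s (Q (0, c)),
    hs.comp_continuous (by fun_prop) fun c => hQ0 c⟩, fun c hc => by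
      change s (Q (0, c)) = _
      rw [hQr _ (hrb 0 c hc)]⟩
  obtain ⟨H⟩ : GenLoop.Homotopic f GenLoop.const :=
    Quotient.exact (@Subsingleton.elim _ hX (Quotient.mk _ f) (Quotient.mk _ GenLoop.const))
  have H0 : ∀ c, H (0, c) = s (Q (0, c)) := fun c => H.apply_zero c
  have Hr : ∀ p, r p = 0 → H p = s (0, 1) := by
    rintro ⟨t, c⟩ hp
    rcases mul_eq_zero.1 hp with h | h
    · have ht : t = 1 := Subtype.ext (by simp only [Icc.coe_one]; linarith)
      rw [ht]
      exact H.apply_one c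
    · have hc : c ∈ Cube.boundary (Fin n) := by
        by_contra hc
        have hlt : ‖y c‖ < 1 := by
          refine (pi_norm_lt_iff one_pos).2 fun i => ?_
          have h0 : (c i : ℝ) ≠ 0 := fun h => hc ⟨i, Or.inl (Subtype.ext h)⟩
          have h1 : (c i : ℝ) ≠ 1 := fun h => hc ⟨i, Or.inr (Subtype.ext h)⟩
          have h0 := lt_of_le_of_ne (c i).2.1 h0.symm
          have h1 := lt_of_le_of_ne (c i).2.2 h1
          rw [Real.norm_eq_abs, abs_lt]
          constructor <;> linarith
        simp only at h
        linarith
      exact (H.eq_fst t hc).trans (f.2 c hc)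
  let B : Set ((Fin n → ℝ) × ℝ) := {v | 4 * ‖v.1‖ + v.2 ^ 2 ≤ 1}
  have hQn : ∀ p, 4 * ‖(Q p).1‖ + (Q p).2 ^ 2 = 1 - 4 * r p * (1 - r p - ‖y p.2‖) := fun p => by
    simp only [Q, norm_smul, Real.norm_of_nonneg (hr0 p)]
    ring
  have hrle : ∀ p, r p ≤ 1 - ‖y p.2‖ := fun p =>
    mul_le_of_le_one_left (sub_nonneg.2 (hy1 _)) (by linarith [p.1.2.1])
  have hQB : ∀ p, Q p ∈ B := fun p => by
    change 4 * ‖(Q p).1‖ + (Q p).2 ^ 2 ≤ 1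
    rw [hQn]
    nlinarith [mul_nonneg (hr0 p) (sub_nonneg.2 (hrle p))]
  have hsurj : ∀ v ∈ B, ∃ p, Q p = v ∧ (4 * ‖v.1‖ + v.2 ^ 2 = 1 → H p = s v) := by
    rintro ⟨u, h⟩ hv
    have hv : 4 * ‖u‖ + h ^ 2 ≤ 1 := hv
    have hu := norm_nonneg u
    have hh := abs_le.1 ((sq_le_one_iff_abs_le_one h).1 (by linarith))
    rcases hh.2.eq_or_lt with rfl | hlt
    · have hu0 : u = 0 := norm_eq_zero.1 (by linarith)
      subst hu0
      have h1 : r (1, fun _ => 1) = 0 := by simp [r]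
      exact ⟨_, hQr _ h1, fun _ => Hr _ h1⟩
    · let ρ : ℝ := (1 - h) / 2
      have hρ : 0 < ρ := by simp only [ρ]; linarith
      have hub : ‖ρ⁻¹ • u‖ ≤ 1 - ρ := by
        rw [norm_smul, norm_inv, Real.norm_of_nonneg hρ.le, inv_mul_le_iff₀ hρ]
        simp only [ρ]
        nlinarith
      have hmem : ∀ i, (1 + (ρ⁻¹ • u) i) / 2 ∈ I := fun i => by
        have := abs_le.1 ((norm_le_pi_norm (ρ⁻¹ • u) i).trans hub)
        constructor <;> linarith
      let c : Fin n → I := fun i => ⟨(1 + (ρ⁻¹ • u) i) / 2, hmem i⟩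
      have hc : y c = ρ⁻¹ • u := funext fun i => by
        simp only [y, c]
        ring
      have hm : ρ ≤ 1 - ‖y c‖ := by rw [hc]; linarith
      have hm0 : 0 < 1 - ‖y c‖ := hρ.trans_le hm
      let t : I := ⟨1 - ρ / (1 - ‖y c‖), by
        have h1 := (div_le_one hm0).2 hm
        have h2 := div_nonneg hρ.le hm0.le
        constructor <;> linarith⟩
      have hrt : r (t, c) = ρ := by
        simp only [r, t, sub_sub_cancel]
        exact div_mul_cancel₀ _ hm0.ne'
      have hQt : Q (t, c) = (u, h) := by
        simp only [Q, hrt, hc, smul_inv_smul₀ hρ.ne']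
        simp only [ρ]
        ring_nf
      refine ⟨(t, c), hQt, fun heq => ?_⟩
      have h1 := hQn (t, c)
      rw [hQt, heq, hrt] at h1
      have h2 : 1 - ρ - ‖y c‖ = 0 := by
        have : ρ * (1 - ρ - ‖y c‖) = 0 := by linarith
        exact (mul_eq_zero.1 this).resolve_left hρ.ne'
      have ht : t = 0 := Subtype.ext (by
        have : 1 - ‖y c‖ = ρ := by linarith
        simp [t, this, hρ.ne'])
      rw [← hQt, ht]
      exact H0 c
  have hfib : ∀ p q, Q p = Q q → H p = H q := by
    rintro ⟨t, c⟩ ⟨t', c'⟩ h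
    have h1 : r (t, c) = r (t', c') := by
      have := congrArg Prod.snd h
      simp only [Q] at this
      linarith
    by_cases h0 : r (t, c) = 0
    · rw [Hr _ h0, Hr _ (h1 ▸ h0)]
    · have h2 := congrArg Prod.fst h
      simp only [Q] at h2
      rw [← h1] at h2
      obtain rfl := hyinj (smul_right_injective _ h0 h2)
      have h3 : (1 - (t : ℝ)) = 1 - t' := mul_right_cancel₀ (right_ne_zero_of_mul h0) h1
      have ht : t = t' := Subtype.ext (by linarith)
      rw [ht]
  let Q' : C(I × (Fin n → I), B) := ⟨fun p => ⟨Q p, hQB p⟩, hQ.subtype_mk _⟩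
  have hQ' : IsQuotientMap Q' := (map_continuous Q').isClosedMap.isQuotientMap (map_continuous Q')
    fun v => (hsurj v.1 v.2).imp fun p hp => Subtype.ext hp.1
  let S₀ : C(B, X) := hQ'.lift (H : C(I × (Fin n → I), X))
    fun p q h => hfib p q (congrArg Subtype.val h)
  have hS₀ : ∀ p, S₀ ⟨Q p, hQB p⟩ = H p := fun p =>
    DFunLike.congr_fun (hQ'.lift_comp (H : C(I × (Fin n → I), X))
      fun p q h => hfib p q (congrArg Subtype.val h)) p
  classical
  let S : (Fin n → ℝ) × ℝ → X := fun v => if h : v ∈ B then S₀ ⟨v, h⟩ else s v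
  have hS : ∀ v, 1 ≤ 4 * ‖v.1‖ + v.2 ^ 2 → S v = s v := by
    intro v hv
    by_cases h : v ∈ B
    · simp only [S, dif_pos h]
      obtain ⟨p, rfl, hp⟩ := hsurj v h
      rw [hS₀, hp (le_antisymm h hv)]
    · simp only [S, dif_neg h]
  refine ⟨S, ?_, hS⟩
  have hc1 : IsClosed B := isClosed_le (by fun_prop) continuous_const
  have hc2 : IsClosed {v : (Fin n → ℝ) × ℝ | 1 ≤ 4 * ‖v.1‖ + v.2 ^ 2} :=
    isClosed_le continuous_const (by fun_prop)
  rw [← continuousOn_univ]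
  refine ContinuousOn.mono (ContinuousOn.union_of_isClosed ?_ ?_ hc1 hc2)
    fun v _ => (le_total (4 * ‖v.1‖ + v.2 ^ 2) 1).imp id id
  · rw [continuousOn_iff_continuous_domRestrict]
    refine (map_continuous S₀).congr fun v => ?_
    simp [S]
  · refine (hs.mono fun v hv h => ?_).congr hS
    rw [mem_singleton_iff] at h
    subst h
    norm_num at hv

end SphereExtension

section Cochains

variable {V : Type*}

/-- The codimension one sublists of a list. -/
def sublistsOne : List V → List (List V)
  | [] => []
  | y :: l => l :: (sublistsOne l).map (List.cons y)

/-- The sum of a list of lists, as a chain. -/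
noncomputable def sumChain (L : List (List V)) : Chain V :=
  (L.map fun l => Finsupp.single l 1).sum

theorem map_sumChain {M : Type*} [AddCommGroup M] [Module (ZMod 2) M]
    (f : Chain V →ₗ[ZMod 2] M) (L : List (List V)) :
    f (sumChain L) = (L.map fun l => f (Finsupp.single l 1)).sum := by
  rw [sumChain, map_list_sum, List.map_map]
  rfl

theorem sumChain_sublistsOne (l : List V) : sumChain (sublistsOne l) = listBoundary l := by
  induction l with
  | nil => rfl
  | cons y l ih =>
    rw [listBoundary, ← ih, map_sumChain, sublistsOne, sumChain, List.map_cons, List.sum_cons,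
      List.map_map]
    congr 3
    funext m
    simp

theorem sumChain_mem_chainsOn {P : List V → Prop} (L : List (List V)) (h : ∀ l ∈ L, P l) :
    sumChain L ∈ chainsOn P := by
  refine list_sum_mem fun c hc => ?_
  obtain ⟨l, hl, rfl⟩ := List.mem_map.1 hc
  exact single_mem_chainsOn (h l hl)

variable [DecidableEq V]

/-- The cochain counting the lists that contain a given set of vertices. -/
noncomputable def indicatorCochain (ψ : Finset V) : Chain V →ₗ[ZMod 2] ZMod 2 :=
  extend fun l => if ψ ⊆ l.toFinset then 1 else 0

theorem indicatorCochain_single (ψ : Finset V) (l : List V) :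
    indicatorCochain ψ (Finsupp.single l 1) = if ψ ⊆ l.toFinset then 1 else 0 := by
  simp [indicatorCochain]

theorem indicatorCochain_coneMap (ψ : Finset V) (y : V) (c : Chain V) :
    indicatorCochain ψ (coneMap y c) = indicatorCochain (ψ.erase y) c := by
  induction c using Finsupp.induction_linear with
  | zero => simp
  | add f g hf hg => simp only [map_add, hf, hg]
  | single l a =>
    simp [indicatorCochain, Finset.subset_insert_iff]

theorem indicatorCochain_listBoundary_of_length_le (ψ : Finset V) (l : List V)
    (h : l.length ≤ ψ.card) : indicatorCochain ψ (listBoundary l) = 0 := by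
  refine map_eq_of_mem_chainsOn (indicatorCochain ψ) 0 (fun m hm => ?_)
    (listBoundary_mem_chainsOn l)
  rw [indicatorCochain_single, if_neg, LinearMap.zero_apply]
  intro hψ
  have := (Finset.card_le_card hψ).trans m.toFinset_card_le
  have := hm.1
  omega

theorem indicatorCochain_listBoundary (ψ : Finset V) (l : List V) (h : l.length = ψ.card + 1) :
    indicatorCochain ψ (listBoundary l) =
      if ψ ⊆ l.toFinset ∧ l.toFinset.card = ψ.card + 1 then 1 else 0 := by
  induction l generalizing ψ with
  | nil => simp at h
  | cons y l ih =>
    have hl : l.length = ψ.card := by simpa using h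
    rw [listBoundary, map_add, indicatorCochain_single, indicatorCochain_coneMap,
      List.toFinset_cons]
    simp only [Finset.subset_insert_iff]
    have hcard := l.toFinset_card_le
    by_cases hy : y ∈ ψ
    · have hpos := Finset.card_pos.2 ⟨y, hy⟩
      have he := Finset.card_erase_of_mem hy
      rw [ih _ (by omega)]
      by_cases hyl : y ∈ l.toFinset
      · rw [Finset.insert_eq_of_mem hyl, if_neg (c := _ ∧ l.toFinset.card = ψ.card + 1)
          (by omega)]
        have e1 : ψ.erase y ⊆ l.toFinset ↔ ψ ⊆ l.toFinset := by
          rw [← Finset.subset_insert_iff, Finset.insert_eq_of_mem hyl]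
        by_cases hψ : ψ ⊆ l.toFinset
        · have := Finset.card_le_card hψ
          rw [if_pos hψ, if_pos ⟨e1.2 hψ, by omega⟩]
          rfl
        · rw [if_neg hψ, if_neg fun h => hψ (e1.1 h.1), add_zero]
      · rw [if_neg fun h => hyl (h hy), zero_add, Finset.card_insert_of_notMem hyl]
        refine if_congr (and_congr_right fun _ => ?_) rfl rfl
        omega
    · rw [Finset.erase_eq_of_notMem hy, indicatorCochain_listBoundary_of_length_le _ _ hl.le,
        add_zero]
      refine if_congr ⟨fun hψ => ⟨hψ, ?_⟩, And.left⟩ rfl rfl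
      have := Finset.card_le_card hψ
      have hyl : y ∉ l.toFinset := by
        rwa [← Finset.eq_of_subset_of_card_le hψ (by omega)]
      rw [Finset.card_insert_of_notMem hyl]
      omega

theorem sumChain_eq_zero (L : List (List V)) (h : ∀ l ∈ L, Even (L.count l)) :
    sumChain L = 0 := by
  have key : ∀ (L : List (List V)) (m : List V), sumChain L m = (L.count m : ZMod 2) := by
    intro L m
    induction L with
    | nil => rfl
    | cons l L ih =>
      rw [sumChain] at ih ⊢
      rw [List.map_cons, List.sum_cons, Finsupp.add_apply, ih, List.count_cons,
        Finsupp.single_apply]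
      by_cases hlm : l = m <;> simp [hlm, add_comm]
  ext m
  rw [key, Finsupp.zero_apply, ZMod.natCast_eq_zero_iff_even]
  by_cases hm : m ∈ L
  · exact h m hm
  · rw [List.count_eq_zero_of_not_mem hm]
    exact Even.zero

theorem boundary_sumChain_eq_zero (L : List (List V))
    (h : ∀ l ∈ L.flatMap sublistsOne, Even ((L.flatMap sublistsOne).count l)) :
    boundary (sumChain L) = 0 := by
  rw [← sumChain_eq_zero _ h]
  clear h
  induction L with
  | nil => simp [sumChain]
  | cons l L ih =>
    rw [sumChain] at ih ⊢
    rw [List.map_cons, List.sum_cons, map_add, ih, boundary_single, one_smul,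
      ← sumChain_sublistsOne]
    simp [sumChain]

end Cochains

section Chessboard

/-- The faces on which a cocycle of the chessboard complex is nonzero. -/
def cocycleFacets : List (List (Fin 7 × Fin 3)) :=
  [[(1, 0), (2, 1), (3, 0), (5, 2), (6, 1)],
    [(0, 2), (1, 0), (2, 1), (5, 2), (6, 1)],
    [(0, 2), (1, 0), (4, 0), (5, 2), (6, 1)],
    [(0, 2), (1, 0), (3, 1), (5, 2), (6, 1)],
    [(1, 0), (2, 0), (3, 1), (5, 2), (6, 1)],
    [(1, 0), (2, 0), (4, 2), (5, 2), (6, 1)],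
    [(0, 1), (1, 0), (4, 2), (5, 2), (6, 1)],
    [(1, 0), (3, 0), (4, 2), (5, 2), (6, 1)]]

instance : DecidablePred (IsFace 7 3 (fun _ => 2) (fun _ => 1)) := fun _ =>
  inferInstanceAs (Decidable (_ ∧ _))

theorem card_of_mem_cocycleFacets : ∀ ψ ∈ cocycleFacets, ψ.toFinset.card = 5 := by
  decide +kernel

theorem even_countP_cocycleFacets : ∀ ψ ∈ cocycleFacets, ∀ v,
    IsFace 7 3 (fun _ => 2) (fun _ => 1) (insert v ψ.toFinset) → v ∉ ψ →
    Even (cocycleFacets.countP fun χ => χ.toFinset ⊆ insert v ψ.toFinset) := by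
  decide +kernel

/-- A cocycle of the chessboard complex. -/
noncomputable def cocycle : Chain (Fin 7 × Fin 3) →ₗ[ZMod 2] ZMod 2 :=
  (cocycleFacets.map fun ψ => indicatorCochain ψ.toFinset).sum

theorem cocycle_apply (c : Chain (Fin 7 × Fin 3)) :
    cocycle c = (cocycleFacets.map fun ψ => indicatorCochain ψ.toFinset c).sum := by
  simp [cocycle, cocycleFacets]

theorem cocycle_listBoundary (l : List (Fin 7 × Fin 3)) (hl : l.length = 6)
    (hface : IsFace 7 3 (fun _ => 2) (fun _ => 1) l.toFinset) : cocycle (listBoundary l) = 0 := by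
  have h1 : ∀ ψ ∈ cocycleFacets, indicatorCochain ψ.toFinset (listBoundary l) =
      if ψ.toFinset ⊆ l.toFinset ∧ l.toFinset.card = 6 then 1 else 0 := by
    intro ψ hψ
    have := card_of_mem_cocycleFacets ψ hψ
    rw [indicatorCochain_listBoundary _ _ (by omega), this]
  rw [cocycle_apply, List.map_congr_left h1]
  by_cases hc : l.toFinset.card = 6
  · have h2 : ∀ (L : List (List (Fin 7 × Fin 3))) (A : Finset (Fin 7 × Fin 3)),
        (L.map fun χ => if χ.toFinset ⊆ A then (1 : ZMod 2) else 0).sum =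
          (L.countP fun χ => χ.toFinset ⊆ A : ℕ) := by
      intro L A
      induction L with
      | nil => rfl
      | cons χ L ih =>
        rw [List.map_cons, List.sum_cons, ih, List.countP_cons]
        by_cases h : χ.toFinset ⊆ A <;> simp [h, add_comm]
    simp only [hc, and_true]
    rw [h2, ZMod.natCast_eq_zero_iff_even]
    by_cases h : ∃ ψ ∈ cocycleFacets, ψ.toFinset ⊆ l.toFinset
    · obtain ⟨ψ, hψ, hψl⟩ := h
      have hψc := card_of_mem_cocycleFacets ψ hψ
      obtain ⟨v, hv, e⟩ := Finset.exists_eq_insert_iff.2 ⟨hψl, by omega⟩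
      rw [← e]
      exact even_countP_cocycleFacets ψ hψ v (e ▸ hface) fun h => hv (List.mem_toFinset.2 h)
    · rw [List.countP_eq_zero.2 fun ψ hψ => by simpa using fun h' => h ⟨ψ, hψ, h'⟩]
      exact Even.zero
  · simp [hc]

/-- A facet of the join of two points, a hexagon and a triangle. -/
def sphereFacet (a : Fin 2) (j j' k : Fin 3) : List (Fin 7 × Fin 3) :=
  (6, ![0, 1] a) :: (![0, 1, 2] j, 0) :: (![0, 1, 2] j', 1) ::
    ((List.finRange 3).filter (· ≠ k)).map fun i => (![3, 4, 5] i, 2)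

/-- The facets of the join of two points, a hexagon and a triangle. -/
def sphereFacets : List (List (Fin 7 × Fin 3)) :=
  (List.finRange 2).flatMap fun a => (List.finRange 3).flatMap fun j =>
    ((List.finRange 3).filter (· ≠ j)).flatMap fun j' => (List.finRange 3).map (sphereFacet a j j')

theorem mem_sphereFacets {l : List (Fin 7 × Fin 3)} :
    l ∈ sphereFacets ↔ ∃ a j j' k, j ≠ j' ∧ l = sphereFacet a j j' k := by
  simp only [sphereFacets, List.mem_flatMap, List.mem_map, List.mem_finRange, List.mem_filter,
    true_and, decide_eq_true_eq]
  constructor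
  · rintro ⟨a, j, j', h, k, rfl⟩
    exact ⟨a, j, j', k, h.symm, rfl⟩
  · rintro ⟨a, j, j', k, h, rfl⟩
    exact ⟨a, j, j', h.symm, k, rfl⟩

theorem length_of_mem_sphereFacets : ∀ l ∈ sphereFacets, l.length = 5 := by
  decide +kernel

theorem isFace_of_mem_sphereFacets : ∀ l ∈ sphereFacets,
    IsFace 7 3 (fun _ => 2) (fun _ => 1) l.toFinset := by
  decide +kernel

theorem boundary_sphere : boundary (sumChain sphereFacets) = 0 :=
  boundary_sumChain_eq_zero _ (by decide +kernel)

theorem cocycle_sphere : cocycle (sumChain sphereFacets) = 1 := by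
  simp only [cocycle_apply, map_sumChain, indicatorCochain_single]
  decide +kernel

end Chessboard

section Sphere

theorem fin_three_eq (i k : Fin 3) : k = i ∨ k = i + 1 ∨ k = i + 2 := by decide +revert

theorem fin_three_add_one_ne (i : Fin 3) : i + 1 ≠ i := by decide +revert

theorem fin_three_add_two_ne (i : Fin 3) : i + 2 ≠ i := by decide +revert

theorem fin_three_add_one_ne_add_two (i : Fin 3) : i + 1 ≠ i + 2 := by decide +revert

/-- The excess of a coordinate that is strictly larger than the other two. -/
noncomputable def excess (y : Fin 3 → ℝ) (j : Fin 3) : ℝ :=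
  max 0 (min (y j - y (j + 1)) (y j - y (j + 2)))

/-- The excess of a coordinate over the smallest one. -/
noncomputable def height (y : Fin 3 → ℝ) (j : Fin 3) : ℝ :=
  max 0 (max (y j - y (j + 1)) (y j - y (j + 2)))

theorem excess_nonneg (y : Fin 3 → ℝ) (j : Fin 3) : 0 ≤ excess y j := le_max_left _ _

theorem height_nonneg (y : Fin 3 → ℝ) (j : Fin 3) : 0 ≤ height y j := le_max_left _ _

theorem excess_le (y : Fin 3 → ℝ) (j : Fin 3) {b : ℝ} (hy : ∀ i, |y i| ≤ b) :
    excess y j ≤ 2 * b := by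
  have h1 := abs_le.1 (hy j)
  have h2 := abs_le.1 (hy (j + 1))
  exact max_le (by linarith) ((min_le_left _ _).trans (by linarith))

theorem height_le (y : Fin 3 → ℝ) (j : Fin 3) {b : ℝ} (hy : ∀ i, |y i| ≤ b) :
    height y j ≤ 2 * b := by
  have h1 := abs_le.1 (hy j)
  have h2 := abs_le.1 (hy (j + 1))
  have h3 := abs_le.1 (hy (j + 2))
  exact max_le (by linarith) (max_le (by linarith) (by linarith))

theorem exists_excess_eq_zero (y : Fin 3 → ℝ) :
    ∃ j j', j ≠ j' ∧ (∀ i, i ≠ j → excess y i = 0) ∧ ∀ i, i ≠ j' → excess (-y) i = 0 := by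
  have h0 : ∀ y : Fin 3 → ℝ, ∀ i k, k ≠ i → y i ≤ y k → excess y i = 0 := by
    intro y i k hk h
    refine max_eq_left ?_
    obtain rfl | rfl := (fin_three_eq i k).resolve_left hk
    · exact (min_le_left _ _).trans (by linarith)
    · exact (min_le_right _ _).trans (by linarith)
  obtain ⟨j, hj⟩ := Finite.exists_max y
  obtain ⟨j', hj'⟩ := Finite.exists_min y
  have h1 : ∀ i, i ≠ j → excess y i = 0 := fun i hi => h0 y i j hi.symm (hj i)
  by_cases hjj' : j = j'
  · subst hjj'
    refine ⟨j, j + 1, (fin_three_add_one_ne j).symm, h1, fun i hi => ?_⟩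
    exact h0 (-y) i (j + 1) hi.symm (neg_le_neg ((hj (j + 1)).trans (hj' i)))
  · exact ⟨j, j', hjj', h1, fun i hi => h0 (-y) i j' hi.symm (neg_le_neg (hj' i))⟩

theorem exists_height_eq_zero (y : Fin 3 → ℝ) : ∃ j, height y j = 0 := by
  obtain ⟨j, hj⟩ := Finite.exists_min y
  refine ⟨j, max_eq_left (max_le ?_ ?_)⟩ <;> linarith [hj (j + 1), hj (j + 2)]

theorem excess_eq {y p q : Fin 3 → ℝ} {j j' : Fin 3} (hjj' : j ≠ j') (hp : ∀ i, 0 ≤ p i)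
    (hq : ∀ i, 0 ≤ q i) (hpj : ∀ i, i ≠ j → p i = 0) (hqj : ∀ i, i ≠ j' → q i = 0)
    (hy : ∀ i k, y i - y k = 6 * (p i - q i - (p k - q k))) (i : Fin 3) :
    excess y i = 6 * p i := by
  have hpi := hp i
  have hqi := hq i
  simp only [excess, hy]
  by_cases hij : i = j
  · subst hij
    rw [hqj i hjj', hpj _ (fin_three_add_one_ne i), hpj _ (fin_three_add_two_ne i)]
    have h : min (6 * (p i - 0 - (0 - q (i + 1)))) (6 * (p i - 0 - (0 - q (i + 2)))) = 6 * p i := by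
      by_cases h : i + 1 = j'
      · rw [hqj (i + 2) (h ▸ (fin_three_add_one_ne_add_two i).symm), min_eq_right] <;>
          linarith [hq (i + 1)]
      · rw [hqj _ h, min_eq_left] <;> linarith [hq (i + 2)]
    rw [h, max_eq_right (by linarith)]
  · rw [hpj i hij, mul_zero]
    refine max_eq_left ?_
    by_cases hij' : i + 1 = j'
    · have h : i + 2 ≠ j' := hij' ▸ (fin_three_add_one_ne_add_two i).symm
      refine (min_le_right _ _).trans ?_
      rw [hqj _ h]
      linarith [hp (i + 2)]
    · refine (min_le_left _ _).trans ?_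
      rw [hqj _ hij']
      linarith [hp (i + 1)]

theorem height_eq {y p : Fin 3 → ℝ} {k : Fin 3} (hp : ∀ i, 0 ≤ p i) (hpk : p k = 0)
    (hy : ∀ i k, y i - y k = 6 * (p i - p k)) (i : Fin 3) : height y i = 6 * p i := by
  have h := hp i
  have h1 := hp (i + 1)
  have h2 := hp (i + 2)
  simp only [height, hy]
  obtain rfl | rfl | rfl := fin_three_eq i k
  · rw [hpk, mul_zero]
    exact max_eq_left (max_le (by linarith) (by linarith))
  · rw [hpk, max_eq_left (a := 6 * (p i - 0)) (by linarith), max_eq_right (by linarith), sub_zero]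
  · rw [hpk, max_eq_right (b := 6 * (p i - 0)) (by linarith), max_eq_right (by linarith), sub_zero]

theorem mem_sphereFacet (a : Fin 2) (j j' k : Fin 3) :
    (∀ i : Fin 3, (![0, 1, 2] i, 0) ∈ sphereFacet a j j' k ↔ i = j) ∧
    (∀ i : Fin 3, (![0, 1, 2] i, 1) ∈ sphereFacet a j j' k ↔ i = j') ∧
    (∀ i : Fin 3, (![3, 4, 5] i, 2) ∈ sphereFacet a j j' k ↔ i ≠ k) ∧
    ∀ i : Fin 2, (6, ![0, 1] i) ∈ sphereFacet a j j' k ↔ i = a := by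
  decide +revert +kernel

theorem notMem_sphereFacet (a : Fin 2) (j j' k : Fin 3) (p : Fin 7 × Fin 3)
    (hp : p.1 < 3 ∧ p.2 = 2 ∨ 3 ≤ p.1 ∧ p.1 < 6 ∧ p.2 ≠ 2 ∨ p = (6, 2)) :
    p ∉ sphereFacet a j j' k := by
  decide +revert +kernel

/-- Coordinates on the join of two points, a hexagon and a triangle. -/
noncomputable def joinCoords (v : (Fin 4 → ℝ) × ℝ) : Fin 7 × Fin 3 → ℝ := fun p =>
  let y : Fin 3 → ℝ := ![v.1 0, v.1 1, 0]
  let w : Fin 3 → ℝ := ![v.1 2, v.1 3, 0]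
  ![![excess y 0, excess (-y) 0, 0], ![excess y 1, excess (-y) 1, 0],
    ![excess y 2, excess (-y) 2, 0], ![0, 0, height w 0], ![0, 0, height w 1], ![0, 0, height w 2],
    ![max 0 v.2, max 0 (-v.2), 0]] p.1 p.2

theorem continuous_excess (j : Fin 3) : Continuous fun y => excess y j := by
  unfold excess
  fun_prop

theorem continuous_height (j : Fin 3) : Continuous fun y => height y j := by
  unfold height
  fun_prop

theorem continuous_vec_three {E : Type*} [TopologicalSpace E] {f g : E → ℝ} (hf : Continuous f)
    (hg : Continuous g) : Continuous fun v => ![f v, g v, 0] :=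
  continuous_pi fun i => by
    fin_cases i
    exacts [hf, hg, continuous_const]

theorem continuous_joinCoords : Continuous joinCoords := by
  have hy : Continuous fun v : (Fin 4 → ℝ) × ℝ => ![v.1 0, v.1 1, 0] :=
    continuous_vec_three (by fun_prop) (by fun_prop)
  have hw : Continuous fun v : (Fin 4 → ℝ) × ℝ => ![v.1 2, v.1 3, 0] :=
    continuous_vec_three (by fun_prop) (by fun_prop)
  refine continuous_pi fun p => ?_
  obtain ⟨j, i⟩ := p
  fin_cases j <;> fin_cases i <;> first
    | exact continuous_const
    | exact (continuous_excess _).comp hy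
    | exact (continuous_excess _).comp hy.neg
    | exact (continuous_height _).comp hw
    | exact continuous_const.max continuous_snd
    | exact continuous_const.max continuous_snd.neg

theorem joinCoords_nonneg (v : (Fin 4 → ℝ) × ℝ) (p : Fin 7 × Fin 3) : 0 ≤ joinCoords v p := by
  obtain ⟨j, i⟩ := p
  fin_cases j <;> fin_cases i <;> simp [joinCoords, excess_nonneg, height_nonneg]

theorem sum_joinCoords_eq (v : (Fin 4 → ℝ) × ℝ) :
    ∑ p, joinCoords v p = ∑ j, excess ![v.1 0, v.1 1, 0] j + ∑ j, excess (-![v.1 0, v.1 1, 0]) j +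
      ∑ j, height ![v.1 2, v.1 3, 0] j + |v.2| := by
  have h : |v.2| = max 0 v.2 + max 0 (-v.2) := by
    rcases le_total 0 v.2 with h | h
    · rw [abs_of_nonneg h, max_eq_right h, max_eq_left (by linarith), add_zero]
    · rw [abs_of_nonpos h, max_eq_left h, max_eq_right (by linarith), zero_add]
  rw [h, Fintype.sum_prod_type]
  simp [joinCoords, Fin.sum_univ_succ]
  ring

theorem sum_joinCoords_pos {v : (Fin 4 → ℝ) × ℝ} (hv : v ≠ 0) : 0 < ∑ p, joinCoords v p := by
  refine lt_of_le_of_ne (Finset.sum_nonneg fun p _ => joinCoords_nonneg v p) fun h => hv ?_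
  rw [eq_comm, sum_joinCoords_eq] at h
  have h1 := excess_nonneg ![v.1 0, v.1 1, 0]
  have h2 := excess_nonneg (-![v.1 0, v.1 1, 0])
  have h3 := height_nonneg ![v.1 2, v.1 3, 0]
  have s1 := Finset.sum_nonneg fun j (_ : j ∈ Finset.univ) => h1 j
  have s2 := Finset.sum_nonneg fun j (_ : j ∈ Finset.univ) => h2 j
  have s3 := Finset.sum_nonneg fun j (_ : j ∈ Finset.univ) => h3 j
  have s4 := abs_nonneg v.2
  have e1 := fun j => (Finset.sum_eq_zero_iff_of_nonneg fun j _ => h1 j).1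
    (by linarith) j (Finset.mem_univ j)
  have e2 := fun j => (Finset.sum_eq_zero_iff_of_nonneg fun j _ => h2 j).1
    (by linarith) j (Finset.mem_univ j)
  have e3 := fun j => (Finset.sum_eq_zero_iff_of_nonneg fun j _ => h3 j).1
    (by linarith) j (Finset.mem_univ j)
  have e4 : v.2 = 0 := abs_eq_zero.1 (by linarith)
  simp only [excess, height, max_eq_left_iff, min_le_iff, max_le_iff] at e1 e2 e3
  have a0 := e1 0
  have a1 := e1 1
  have a2 := e1 2
  have b0 := e2 0
  have b1 := e2 1
  have b2 := e2 2
  have c0 := e3 0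
  have c1 := e3 1
  have c2 := e3 2
  simp at a0 a1 a2 b0 b1 b2 c0 c1 c2
  have v0 : v.1 0 = 0 := by grind
  have v1 : v.1 1 = 0 := by grind
  have v2 : v.1 2 = 0 := by linarith
  have v3 : v.1 3 = 0 := by linarith
  refine Prod.ext (funext fun i => ?_) e4
  fin_cases i <;> assumption

theorem one_le_of_sum_joinCoords_eq {v : (Fin 4 → ℝ) × ℝ} (hv : ∑ p, joinCoords v p = 6) :
    1 ≤ 4 * ‖v.1‖ + v.2 ^ 2 := by
  by_contra! h
  have hn := norm_nonneg v.1
  have hu : ∀ i, |v.1 i| ≤ 1 / 4 := fun i => (norm_le_pi_norm v.1 i).trans (by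
    nlinarith [sq_nonneg v.2])
  have h1 : |v.2| ≤ 1 := (sq_le_one_iff_abs_le_one _).1 (by linarith)
  have hy : ∀ i, |![v.1 0, v.1 1, 0] i| ≤ 1 / 4 := fun i => by
    fin_cases i <;> simp <;> simpa using hu _
  have hy' : ∀ i, |(-![v.1 0, v.1 1, 0]) i| ≤ 1 / 4 := fun i => by
    rw [Pi.neg_apply, abs_neg]
    exact hy i
  have hw : ∀ i, |![v.1 2, v.1 3, 0] i| ≤ 1 / 4 := fun i => by
    fin_cases i <;> simp <;> simpa using hu _
  rw [sum_joinCoords_eq] at hv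
  have s1 := Finset.sum_le_card_nsmul _ _ _ fun j (_ : j ∈ Finset.univ) => excess_le _ j hy
  have s2 := Finset.sum_le_card_nsmul _ _ _ fun j (_ : j ∈ Finset.univ) => excess_le _ j hy'
  have s3 := Finset.sum_le_card_nsmul _ _ _ fun j (_ : j ∈ Finset.univ) => height_le _ j hw
  rw [Finset.card_univ, Fintype.card_fin, nsmul_eq_mul] at s1 s2 s3
  rw [show ((3 : ℕ) : ℝ) * (2 * (1 / 4)) = 3 / 2 by norm_num] at s1 s2 s3
  linarith

theorem exists_joinCoords_eq_zero (v : (Fin 4 → ℝ) × ℝ) :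
    ∃ l ∈ sphereFacets, ∀ p, p ∉ l → joinCoords v p = 0 := by
  obtain ⟨j, j', hjj', h1, h2⟩ := exists_excess_eq_zero ![v.1 0, v.1 1, 0]
  obtain ⟨k, h3⟩ := exists_height_eq_zero ![v.1 2, v.1 3, 0]
  obtain ⟨a, h4, h5⟩ : ∃ a : Fin 2, (a ≠ 0 → max 0 v.2 = 0) ∧ (a ≠ 1 → max 0 (-v.2) = 0) := by
    rcases le_total 0 v.2 with h | h
    · exact ⟨0, by simp, fun _ => max_eq_left (by linarith)⟩
    · exact ⟨1, fun _ => max_eq_left h, by simp⟩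
  refine ⟨sphereFacet a j j' k, mem_sphereFacets.2 ⟨a, j, j', k, hjj', rfl⟩, fun p hp => ?_⟩
  obtain ⟨m1, m2, m3, m4⟩ := mem_sphereFacet a j j' k
  have h6 : ∀ i, ¬i ≠ k → height ![v.1 2, v.1 3, 0] i = 0 := fun i hi => not_not.1 hi ▸ h3
  obtain ⟨c, r⟩ := p
  fin_cases c <;> fin_cases r <;> first
    | rfl
    | exact h1 0 fun h => hp ((m1 0).2 h)
    | exact h1 1 fun h => hp ((m1 1).2 h)
    | exact h1 2 fun h => hp ((m1 2).2 h)
    | exact h2 0 fun h => hp ((m2 0).2 h)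
    | exact h2 1 fun h => hp ((m2 1).2 h)
    | exact h2 2 fun h => hp ((m2 2).2 h)
    | exact h6 0 fun h => hp ((m3 0).2 h)
    | exact h6 1 fun h => hp ((m3 1).2 h)
    | exact h6 2 fun h => hp ((m3 2).2 h)
    | exact h4 fun h => hp ((m4 0).2 h.symm)
    | exact h5 fun h => hp ((m4 1).2 h.symm)

/-- A linear map inverse to the join coordinates, up to a factor of `6`. -/
noncomputable def joinMap : (Fin 7 × Fin 3 → ℝ) →ₗ[ℝ] (Fin 4 → ℝ) × ℝ where
  toFun x := (![6 * (x (0, 0) - x (0, 1) - (x (2, 0) - x (2, 1))),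
    6 * (x (1, 0) - x (1, 1) - (x (2, 0) - x (2, 1))), 6 * (x (3, 2) - x (5, 2)),
    6 * (x (4, 2) - x (5, 2))], 6 * (x (6, 0) - x (6, 1)))
  map_add' x x' := by
    ext i
    · fin_cases i <;> simp <;> ring
    · simp
      ring
  map_smul' c x := by
    ext i
    · fin_cases i <;> simp <;> ring
    · simp
      ring

theorem joinCoords_joinMap {l : List (Fin 7 × Fin 3)} (hl : l ∈ sphereFacets)
    {x : Fin 7 × Fin 3 → ℝ} (hx : ∀ p, 0 ≤ x p) (hxl : ∀ p, p ∉ l → x p = 0) :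
    joinCoords (joinMap x) = (6 : ℝ) • x := by
  obtain ⟨a, j, j', k, hjj', rfl⟩ := mem_sphereFacets.1 hl
  obtain ⟨m1, m2, m3, m4⟩ := mem_sphereFacet a j j' k
  have hp : ∀ i, i ≠ j → x (![0, 1, 2] i, 0) = 0 := fun i hi => hxl _ fun h => hi ((m1 i).1 h)
  have hq : ∀ i, i ≠ j' → x (![0, 1, 2] i, 1) = 0 := fun i hi => hxl _ fun h => hi ((m2 i).1 h)
  have e1 := excess_eq (y := ![(joinMap x).1 0, (joinMap x).1 1, 0]) hjj' (fun i => hx _)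
    (fun i => hx _) hp hq fun i i' => by
      fin_cases i <;> fin_cases i' <;> simp [joinMap] <;> ring
  have e2 := excess_eq (y := -![(joinMap x).1 0, (joinMap x).1 1, 0]) hjj'.symm (fun i => hx _)
    (fun i => hx _) hq hp fun i i' => by
      fin_cases i <;> fin_cases i' <;> simp [joinMap] <;> ring
  have e3 := height_eq (y := ![(joinMap x).1 2, (joinMap x).1 3, 0])
    (p := fun i => x (![3, 4, 5] i, 2)) (fun i => hx _)
    (hxl _ fun h => (m3 k).1 h rfl) fun i i' => by
      fin_cases i <;> fin_cases i' <;> simp [joinMap] <;> ring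
  have e4 : max 0 (6 * (x (6, 0) - x (6, 1))) = 6 * x (6, 0) ∧
      max 0 (-(6 * (x (6, 0) - x (6, 1)))) = 6 * x (6, 1) := by
    have h0 := hx (6, 0)
    have h1 := hx (6, 1)
    obtain h | h : x (6, 0) = 0 ∨ x (6, 1) = 0 := by
      by_cases ha : a = 0
      · exact Or.inr (hxl _ fun h => absurd ((m4 1).1 h) (by simp [ha]))
      · exact Or.inl (hxl _ fun h => ha ((m4 0).1 h).symm)
    · rw [h]
      exact ⟨by rw [max_eq_left (by linarith)]; ring, by rw [max_eq_right (by linarith)]; ring⟩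
    · rw [h]
      exact ⟨by rw [max_eq_right (by linarith)]; ring, by rw [max_eq_left (by linarith)]; ring⟩
  have hz : ∀ p, p ∉ sphereFacet a j j' k → 0 = 6 * x p := fun p hp => by rw [hxl p hp, mul_zero]
  funext p
  obtain ⟨c, r⟩ := p
  fin_cases c <;> fin_cases r <;> first
    | exact e1 0
    | exact e1 1
    | exact e1 2
    | exact e2 0
    | exact e2 1
    | exact e2 2
    | exact e3 0
    | exact e3 1
    | exact e3 2
    | exact e4.1
    | exact e4.2
    | exact hz _ (notMem_sphereFacet a j j' k _ (by decide))

end Sphere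

theorem isLowerSet_setOf_isFace (m n : ℕ) (k : Fin n → ℕ) (l : Fin m → ℕ) :
    IsLowerSet {A | IsFace m n k l A} := fun _ _ h hA =>
  ⟨fun i => (Finset.card_le_card (Finset.filter_subset_filter _ h)).trans (hA.1 i),
    fun j => (Finset.card_le_card (Finset.filter_subset_filter _ h)).trans (hA.2 j)⟩

theorem single_mem_geom_simplex {V : Type*} [Fintype V] [DecidableEq V] {v : V} {s : Finset V}
    (hv : v ∈ s) : Pi.single v 1 ∈ geom {A | A ⊆ s} := by
  rw [geom_simplex]
  refine ⟨fun w => ?_, by simp, fun w hw => Pi.single_eq_of_ne (ne_of_mem_of_not_mem hv hw).symm _⟩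
  rw [Pi.single_apply]
  split_ifs
  exacts [zero_le_one, le_rfl]

section Degree

/-- A vertex labelling of an iterated subdivision that respects carriers preserves the values of
cocycles on cycles. -/
theorem cochain_subdivision_eq {V E : Type*} [NormedAddCommGroup E] [NormedSpace ℝ E]
    {P : List V → Prop} (hP : ∀ l m, P l → m ⊆ l → P m) (e : V → E) (T : E → V)
    (hT : ∀ l, P l → ∀ p ∈ convexHull ℝ (e '' {v | v ∈ l}), T p ∈ l) (n : ℕ)
    (φ : Chain V →ₗ[ZMod 2] ZMod 2)
    (hφ : ∀ l, l.length = n + 2 → P l → φ (listBoundary l) = 0) {z : Chain V}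
    (hz : z ∈ chainsOn fun l => l.length = n + 1 ∧ P l) (hz0 : boundary z = 0) (N : ℕ) :
    φ (pushforward T ((subdivision (n + 1))^[N] (pushforward e z))) = φ z := by
  let Ψ : ℕ → Chain V →ₗ[ZMod 2] Chain V := fun k =>
    pushforward T ∘ₗ (subdivision k ^ N) ∘ₗ pushforward e
  have hΨ' : ∀ k c, Ψ k c = pushforward T ((subdivision k)^[N] (pushforward e c)) := fun k c => by
    simp only [Ψ, LinearMap.comp_apply, Module.End.pow_apply]
  have hΨ0 : Ψ 0 (Finsupp.single [] 1) = Finsupp.single [] 1 := by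
    have h : (subdivision 0 : Chain E →ₗ[ZMod 2] Chain E) = LinearMap.id := rfl
    simp [hΨ', h, Function.iterate_id]
  have hΨb : ∀ k l, l.length = k + 1 → P l →
      boundary (Ψ (k + 1) (Finsupp.single l 1)) = Ψ k (listBoundary l) := by
    intro k l hl _
    rw [hΨ', hΨ', boundary_pushforward, boundary_subdivision_iterate, boundary_pushforward,
      boundary_single, one_smul]
    rw [pushforward_single]
    exact single_mem_chainsOn (by simpa using hl)
  have hΨc : ∀ k l, l.length = k → P l →
      Ψ k (Finsupp.single l 1) ∈ chainsOn fun m => m.length = k ∧ m ⊆ l := by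
    intro k l hl hPl
    have hb := (List.finite_toSet (l.map e)).isBounded
    have h := subdivision_iterate_mem_chainsOn k k N k.le_succ _ (convex_convexHull ℝ _)
      (Metric.diam {x | x ∈ l.map e}) (single_mem_chainsOn ⟨by simpa using hl, fun x hx => by
        obtain ⟨v, hv, rfl⟩ := List.mem_map.1 hx
        exact subset_convexHull ℝ _ (mem_image_of_mem e hv),
        fun x hx y hy => Metric.dist_le_diam_of_mem hb hx hy⟩)
    rw [hΨ', pushforward_single]
    refine map_mem_of_mem_chainsOn (pushforward T) (fun m hm => ?_) h
    rw [pushforward_single]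
    refine single_mem_chainsOn ⟨by simpa using hm.1, fun v hv => ?_⟩
    obtain ⟨p, hp, rfl⟩ := List.mem_map.1 hv
    exact hT l hPl p (hm.2.1 p hp)
  have h1 : boundary (prism Ψ (n + 1) z) = Ψ (n + 1) z + z := by
    have h := map_eq_of_mem_chainsOn (boundary ∘ₗ prism Ψ (n + 1))
      (Ψ (n + 1) + LinearMap.id + prism Ψ n ∘ₗ boundary)
      (fun l hl => by simp [boundary_prism hP hΨb hΨ0 n l hl.1 hl.2]) hz
    simpa [hz0] using h
  have h2 : φ (boundary (prism Ψ (n + 1) z)) = 0 := by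
    have h : prism Ψ (n + 1) z ∈ chainsOn fun l => l.length = n + 2 ∧ P l :=
      map_mem_of_mem_chainsOn _ (fun l hl => chainsOn_mono (fun m hm => ⟨hm.1, hP _ _ hl.2 hm.2⟩)
        (prism_mem_chainsOn hP hΨc (n + 1) l hl.1 hl.2)) hz
    exact map_eq_of_mem_chainsOn (φ ∘ₗ boundary) 0 (fun l hl => by simp [hφ l hl.1 hl.2]) h
  rw [← hΨ']
  rw [h1, map_add] at h2
  exact CharTwo.add_eq_zero.1 h2

/-- The sphere spanned by `sphereFacets` does not bound a singular ball in the chessboard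
complex. -/
theorem not_exists_extension (S : (Fin 4 → ℝ) × ℝ → Fin 7 × Fin 3 → ℝ) (hS : Continuous S)
    (hSK : ∀ v, S v ∈ geom {A | IsFace 7 3 (fun _ => 2) (fun _ => 1) A})
    (hSj : ∀ l ∈ sphereFacets, ∀ x ∈ geom {A | A ⊆ l.toFinset}, S (joinMap x) = x) : False := by
  have hK := isLowerSet_setOf_isFace 7 3 (fun _ => 2) (fun _ => 1)
  have hcard : (0 : ℝ) < (Fintype.card (Fin 7 × Fin 3) : ℝ)⁻¹ := by
    simp
  choose T hT using fun v => exists_card_inv_le (hSK v).2.1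
  let e : Fin 7 × Fin 3 → (Fin 4 → ℝ) × ℝ := fun p => joinMap (Pi.single p 1)
  let P : List (Fin 7 × Fin 3) → Prop := fun l => ∃ F ∈ sphereFacets, l ⊆ F
  have hP : ∀ l m, P l → m ⊆ l → P m := fun l m ⟨F, hF, hlF⟩ hml =>
    ⟨F, hF, List.Subset.trans hml hlF⟩
  have hTP : ∀ l, P l → ∀ p ∈ convexHull ℝ (e '' {v | v ∈ l}), T p ∈ l := by
    rintro l ⟨F, hF, hlF⟩ p hp
    have hsub : convexHull ℝ (e '' {v | v ∈ l}) ⊆ joinMap '' geom {A | A ⊆ l.toFinset} := by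
      have hconv : Convex ℝ (geom {A | A ⊆ l.toFinset}) := by
        rw [geom_simplex]
        intro x hx y hy a b ha hb hab
        refine ⟨fun v => add_nonneg (mul_nonneg ha (hx.1 v)) (mul_nonneg hb (hy.1 v)), ?_,
          fun v hv => ?_⟩
        · simp [Finset.sum_add_distrib, ← Finset.mul_sum, hx.2.1, hy.2.1, hab]
        · simp [hx.2.2 v hv, hy.2.2 v hv]
      refine convexHull_min ?_ (hconv.linear_image joinMap)
      rintro _ ⟨v, hv, rfl⟩
      exact ⟨Pi.single v 1, single_mem_geom_simplex (List.mem_toFinset.2 hv), rfl⟩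
    obtain ⟨x, hx, rfl⟩ := hsub hp
    have hlF' : l.toFinset ⊆ F.toFinset := fun v hv =>
      List.mem_toFinset.2 (hlF (List.mem_toFinset.1 hv))
    have h := hcard.trans_le (hT (joinMap x))
    rw [hSj F hF x (geom_mono (fun A hA => Finset.Subset.trans hA hlF') hx)] at h
    exact List.mem_toFinset.1 (hx.2.2 (mem_supp.2 h))
  have hz : sumChain sphereFacets ∈ chainsOn fun l => l.length = 4 + 1 ∧ P l :=
    sumChain_mem_chainsOn _ fun l hl =>
      ⟨length_of_mem_sphereFacets l hl, l, hl, List.Subset.refl l⟩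
  have h1 := fun N => cochain_subdivision_eq hP e T hTP 4 cocycle
    (fun l hl ⟨F, hF, hlF⟩ => cocycle_listBoundary l hl (hK (fun v hv =>
      List.mem_toFinset.2 (hlF (List.mem_toFinset.1 hv))) (isFace_of_mem_sphereFacets F hF)))
    hz boundary_sphere N
  obtain ⟨R, hR⟩ := ((finite_range e).insert 0).isBounded.subset_closedBall 0
  have huc := (isCompact_closedBall (0 : (Fin 4 → ℝ) × ℝ) R).uniformContinuousOn_of_continuous
    hS.continuousOn
  obtain ⟨δ, hδ, hSδ⟩ := Metric.uniformContinuousOn_iff.1 huc _ hcard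
  obtain ⟨N, hN⟩ : ∃ N : ℕ, (((5 : ℕ) : ℝ) / ((5 : ℕ) + 1)) ^ N * (2 * R) < δ := by
    have h := (tendsto_pow_atTop_nhds_zero_of_lt_one (r := ((5 : ℕ) : ℝ) / ((5 : ℕ) + 1))
      (by positivity) (by norm_num)).mul_const (2 * R)
    rw [zero_mul] at h
    exact (h.eventually_lt_const hδ).exists
  have hc0 : coneMap 0 (pushforward e (sumChain sphereFacets)) ∈ chainsOn fun m => m.length = 6 ∧
      (∀ x ∈ m, x ∈ Metric.closedBall 0 R) ∧ ∀ x ∈ m, ∀ y ∈ m, dist x y ≤ 2 * R := by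
    refine map_mem_of_mem_chainsOn (coneMap 0 ∘ₗ pushforward e) (fun l hl => ?_) hz
    have hmem : ∀ x ∈ 0 :: l.map e, x ∈ Metric.closedBall 0 R := fun x hx => by
      refine hR ?_
      rcases List.mem_cons.1 hx with rfl | hx
      · exact mem_insert _ _
      · obtain ⟨v, -, rfl⟩ := List.mem_map.1 hx
        exact mem_insert_of_mem _ (mem_range_self v)
    rw [LinearMap.comp_apply, pushforward_single, coneMap_single]
    refine single_mem_chainsOn ⟨by simp [hl.1], hmem, fun x hx y hy => ?_⟩
    have hx' := Metric.mem_closedBall.1 (hmem x hx)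
    have hy' := Metric.mem_closedBall.1 (hmem y hy)
    linarith [dist_triangle_right x y 0]
  have h2 := boundary_subdivision_iterate 5 N (chainsOn_mono (fun m hm => hm.1) hc0)
  rw [boundary_coneMap, boundary_pushforward, boundary_sphere, map_zero, map_zero, add_zero] at h2
  have h3 : cocycle (boundary (pushforward T ((subdivision (5 + 1))^[N]
      (coneMap 0 (pushforward e (sumChain sphereFacets)))))) = 0 := by
    refine map_eq_of_mem_chainsOn (cocycle ∘ₗ boundary ∘ₗ pushforward T) 0 (fun m hm => ?_)
      (subdivision_iterate_mem_chainsOn 5 6 N le_rfl _ (convex_closedBall 0 R) _ hc0)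
    obtain ⟨hm1, hm2, hm3⟩ := hm
    rw [LinearMap.comp_apply, LinearMap.comp_apply, pushforward_single, boundary_single, one_smul]
    refine cocycle_listBoundary _ (by simpa using hm1) ?_
    obtain ⟨q, hq⟩ := List.exists_mem_of_length_pos (l := m) (by omega)
    refine hK (fun v hv => ?_) (hSK q).2.2
    obtain ⟨p, hp, rfl⟩ := List.mem_map.1 (List.mem_toFinset.1 hv)
    have hd := hSδ p (hm2 p hp) q (hm2 q hq) ((hm3 p hp q hq).trans_lt hN)
    have hd' := (dist_le_pi_dist (S p) (S q) (T p)).trans_lt hd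
    rw [Real.dist_eq] at hd'
    exact mem_supp.2 (by linarith [(abs_lt.1 hd').2, hT p])
  rw [boundary_pushforward, h2] at h3
  have h4 := h1 N
  rw [cocycle_sphere] at h4
  exact one_ne_zero (h4.symm.trans h3)

end Degree

theorem realization_eq_geom (m n : ℕ) (k : Fin n → ℕ) (l : Fin m → ℕ) :
    Realization m n k l = geom {A | IsFace m n k l A} := by
  ext x
  refine ⟨fun h => ⟨fun v => (h.1 v).1, h.2.1, h.2.2⟩,
    fun h => ⟨fun v => ⟨h.1 v, ?_⟩, h.2.1, h.2.2⟩⟩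
  rw [← h.2.1]
  exact Finset.single_le_sum (fun w _ => h.1 w) (Finset.mem_univ v)

theorem nonempty_geom_chessboard :
    (geom {A | IsFace 7 3 (fun _ => 2) (fun _ => 1) A}).Nonempty := by
  refine ⟨_, geom_mono (fun A hA => ?_)
    (single_mem_geom_simplex (Finset.mem_singleton_self ((0, 0) : Fin 7 × Fin 3)))⟩
  exact isLowerSet_setOf_isFace 7 3 (fun _ => 2) (fun _ => 1) hA
    (show IsFace 7 3 (fun _ => 2) (fun _ => 1) {(0, 0)} by decide)

theorem not_subsingleton_homotopyGroup :
    ¬ ∀ x, Subsingleton (HomotopyGroup (Fin 4)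
      (geom {A | IsFace 7 3 (fun _ => 2) (fun _ => 1) A}) x) := by
  intro h
  classical
  obtain ⟨x₀, hx₀⟩ := nonempty_geom_chessboard
  have hK := isLowerSet_setOf_isFace 7 3 (fun _ => 2) (fun _ => 1)
  let t : (Fin 4 → ℝ) × ℝ → Fin 7 × Fin 3 → ℝ := fun v =>
    (∑ p, joinCoords v p)⁻¹ • joinCoords v
  have ht : ∀ v, v ≠ 0 → t v ∈ geom {A | IsFace 7 3 (fun _ => 2) (fun _ => 1) A} := by
    intro v hv
    have hpos := sum_joinCoords_pos hv
    obtain ⟨l, hl, hlv⟩ := exists_joinCoords_eq_zero v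
    have h1 : t v ∈ geom {A | A ⊆ l.toFinset} := by
      rw [geom_simplex]
      refine ⟨fun p => mul_nonneg (inv_nonneg.2 hpos.le) (joinCoords_nonneg v p), ?_,
        fun p hp => ?_⟩
      · simp only [t, Pi.smul_apply, smul_eq_mul, ← Finset.mul_sum]
        exact inv_mul_cancel₀ hpos.ne'
      · simp [t, hlv p fun h => hp (List.mem_toFinset.2 h)]
    exact geom_mono (fun A hA => hK hA (isFace_of_mem_sphereFacets l hl)) h1
  let s : (Fin 4 → ℝ) × ℝ → geom {A | IsFace 7 3 (fun _ => 2) (fun _ => 1) A} := fun v =>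
    if hv : v ≠ 0 then ⟨t v, ht v hv⟩ else ⟨x₀, hx₀⟩
  have hst : ∀ v, v ≠ 0 → (s v : Fin 7 × Fin 3 → ℝ) = t v := fun v hv => by simp [s, hv]
  have hs : ContinuousOn s {0}ᶜ := by
    rw [Topology.IsInducing.subtypeVal.continuousOn_iff]
    refine ContinuousOn.congr (f := t) ?_ fun v hv => hst v hv
    have hc : Continuous fun v => ∑ p, joinCoords v p :=
      continuous_finsetSum _ fun p _ => (continuous_apply p).comp continuous_joinCoords
    exact (hc.continuousOn.inv₀ fun v hv => (sum_joinCoords_pos hv).ne').smul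
      continuous_joinCoords.continuousOn
  obtain ⟨S, hS, hSs⟩ := exists_extension_of_subsingleton_homotopyGroup s hs (h _)
  refine not_exists_extension (fun v => S v) (continuous_subtype_val.comp hS) (fun v => (S v).2)
    fun l hl x hx => ?_
  rw [geom_simplex] at hx
  have hj : joinCoords (joinMap x) = (6 : ℝ) • x :=
    joinCoords_joinMap hl hx.1 fun p hp => hx.2.2 p fun h => hp (List.mem_toFinset.1 h)
  have h6 : ∑ p, joinCoords (joinMap x) p = 6 := by
    simp [hj, ← Finset.mul_sum, hx.2.1]
  have h1 := one_le_of_sum_joinCoords_eq h6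
  have h0 : joinMap x ≠ 0 := fun h0 => by norm_num [h0] at h1
  change (S (joinMap x) : Fin 7 × Fin 3 → ℝ) = x
  rw [hSs _ h1, hst _ h0]
  simp only [t]
  rw [h6, hj, inv_smul_smul₀ (by norm_num)]

end ChessboardComplex

theorem delta_7_3_2_1_is_3_connected_not_4_connected :
    CConnected 3 ↥(Realization 7 3 (fun _ => 2) fun _ => 1) ∧
    ¬ CConnected 4 ↥(Realization 7 3 (fun _ => 2) fun _ => 1) := by
  have hK := ChessboardComplex.isLowerSet_setOf_isFace 7 3 (fun _ => 2) (fun _ => 1)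
  rw [ChessboardComplex.realization_eq_geom]
  refine ⟨⟨ChessboardComplex.nonempty_geom_chessboard.to_subtype, fun _ => ?_, fun i _ hi x => ?_⟩,
    fun h => ?_⟩
  · exact ChessboardComplex.skeletonGlued_chessboard.pathConnectedSpace hK (by norm_num)
      ChessboardComplex.nonempty_geom_chessboard
  · exact ChessboardComplex.skeletonGlued_chessboard.subsingleton_homotopyGroup hK i (by omega) x
  · exact ChessboardComplex.not_subsingleton_homotopyGroup (h.2.2 4 (by norm_num) (by norm_num))
end

section
/- Let n ≥ 1 and let k_1, …, k_n be positive integers. If m ≥ k_1 + k_2 + ⋯ + k_n + n − 1, then the multiple chessboard complex Δ_{m,n}^{k_1,…,k_n;1} is shellable. -/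
open scoped BigOperators

/-- A facet of a (finite abstract) simplicial complex `Δ`, given as the set of its
faces: a face that is maximal under inclusion. -/
def IsFacet {V : Type} (Δ : Set (Finset V)) (A : Finset V) : Prop :=
  A ∈ Δ ∧ ∀ B ∈ Δ, A ⊆ B → A = B

/-- A finite abstract simplicial complex (whose facets all have the same cardinality)
is shellable if its facets can be enumerated `F 0, F 1, …` so that for all `i < j`
there are `l < j` and a vertex `v ∈ F j` with `F i ∩ F j ⊆ F l ∩ F j = F j \ {v}`. -/
def Shellable {V : Type} [DecidableEq V] (Δ : Set (Finset V)) : Prop :=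
  (∀ A B, IsFacet Δ A → IsFacet Δ B → A.card = B.card) ∧
  ∃ t : ℕ, ∃ F : Fin t → Finset V,
    Function.Injective F ∧ (∀ i, IsFacet Δ (F i)) ∧
    (∀ A, IsFacet Δ A → ∃ i, F i = A) ∧
    ∀ i j : Fin t, i < j → ∃ l : Fin t, l < j ∧ ∃ v ∈ F j,
      F i ∩ F j ⊆ F l ∩ F j ∧ F l ∩ F j = F j \ {v}

theorem card_filter_eq_of_agree {α : Type*} {M : Finset α} {a b : α → ℕ} {p : α → Prop}
    [DecidablePred p] (hc : ∀ i, (M.filter (a · = i)).card = (M.filter (b · = i)).card)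
    (h : ∀ y ∈ M, ¬ p y → a y = b y) (i : ℕ) :
    ((M.filter p).filter (a · = i)).card = ((M.filter p).filter (b · = i)).card := by
  have split (f : α → ℕ) : (M.filter (f · = i)).card =
      ((M.filter p).filter (f · = i)).card + ((M.filter (¬ p ·)).filter (f · = i)).card := by
    rw [Finset.filter_comm p, Finset.filter_comm (¬ p ·),
      Finset.card_filter_add_card_filter_not]
  have hrest : (M.filter (¬ p ·)).filter (a · = i) = (M.filter (¬ p ·)).filter (b · = i) :=
    Finset.filter_congr fun y hy => by
      rw [h y (Finset.mem_filter.1 hy).1 (Finset.mem_filter.1 hy).2]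
  have := hc i
  rw [split a, split b, hrest] at this
  omega

section WordOrder

variable {α : Type*} [LinearOrder α]

/-- Given a relation `r` on words, depending on the set of columns on which they are read, compare
two words lexicographically up to their first common zero, and by `r` beyond it. -/
def UpToZero (r : Finset α → (α → ℕ) → (α → ℕ) → Prop) (M : Finset α) (a b : α → ℕ) : Prop :=
  ∃ d ∈ M, (∀ y ∈ M, y < d → a y = b y ∧ a y ≠ 0) ∧
    (a d < b d ∨ (a d = 0 ∧ b d = 0 ∧ r (M.filter (d < ·)) a b))

/-- The shelling order on words with letters `0, …, n` read on the columns in `M`: first compare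
lexicographically the sets of positions of the letter `n`, then compare the words obtained by
deleting these positions lexicographically up to their first common zero, and then
recursively. -/
def WordLT : ℕ → Finset α → (α → ℕ) → (α → ℕ) → Prop
  | 0, _, _, _ => False
  | n + 1, M, a, b =>
    (∃ d ∈ M, (∀ y ∈ M, y < d → (a y = n + 1 ↔ b y = n + 1)) ∧ a d = n + 1 ∧ b d ≠ n + 1) ∨
    ((∀ y ∈ M, a y = n + 1 ↔ b y = n + 1) ∧
      UpToZero (WordLT n) (M.filter (a · ≠ n + 1)) a b)

theorem UpToZero.irrefl {r : Finset α → (α → ℕ) → (α → ℕ) → Prop} (hr : ∀ M a, ¬ r M a a)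
    (M : Finset α) (a : α → ℕ) : ¬ UpToZero r M a a := by
  rintro ⟨d, _, _, h | h⟩
  · exact lt_irrefl _ h
  · exact hr _ _ h.2.2

theorem UpToZero.trans {r : Finset α → (α → ℕ) → (α → ℕ) → Prop}
    (hr : ∀ M a b c, r M a b → r M b c → r M a c) {M : Finset α} {a b c : α → ℕ}
    (hab : UpToZero r M a b) (hbc : UpToZero r M b c) : UpToZero r M a c := by
  obtain ⟨d, hd, h₁, h₂⟩ := hab
  obtain ⟨e, he, h₃, h₄⟩ := hbc
  rcases lt_trichotomy d e with h | rfl | h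
  · exact ⟨d, hd, fun y hy hyd => by grind, by grind⟩
  · refine ⟨d, hd, fun y hy hyd => by grind, ?_⟩
    rcases h₂ with h₂ | h₂ <;> rcases h₄ with h₄ | h₄
    · left; omega
    · left; omega
    · left; omega
    · exact Or.inr ⟨h₂.1, h₄.2.1, hr _ _ _ _ h₂.2.2 h₄.2.2⟩
  · exact ⟨e, he, fun y hy hyd => by grind, by grind⟩

theorem UpToZero.trichotomous {r : Finset α → (α → ℕ) → (α → ℕ) → Prop} {M : Finset α}
    {a b : α → ℕ}
    (hr : ∀ d ∈ M, r (M.filter (d < ·)) a b ∨ (∀ y ∈ M.filter (d < ·), a y = b y) ∨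
      r (M.filter (d < ·)) b a) :
    UpToZero r M a b ∨ (∀ y ∈ M, a y = b y) ∨ UpToZero r M b a := by
  rcases (M.filter fun y => a y ≠ b y ∨ a y = 0).eq_empty_or_nonempty with h | h
  · right; left
    intro y hy
    by_contra hne
    exact Finset.notMem_empty y (h ▸ Finset.mem_filter.2 ⟨hy, Or.inl hne⟩)
  · obtain ⟨d, hd, hmin⟩ := Finset.exists_min_image _ id h
    obtain ⟨hdM, hd⟩ := Finset.mem_filter.1 hd
    have hlt : ∀ y ∈ M, y < d → a y = b y ∧ a y ≠ 0 := by
      intro y hy hyd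
      by_contra hne
      have := hmin y (Finset.mem_filter.2 ⟨hy, by tauto⟩)
      exact absurd hyd (not_lt.2 this)
    rcases lt_trichotomy (a d) (b d) with hab | hab | hab
    · exact Or.inl ⟨d, hdM, hlt, Or.inl hab⟩
    · have ha : a d = 0 := by tauto
      rcases hr d hdM with h' | h' | h'
      · exact Or.inl ⟨d, hdM, hlt, Or.inr ⟨ha, hab ▸ ha, h'⟩⟩
      · right; left
        intro y hy
        rcases lt_trichotomy y d with hyd | rfl | hyd
        · exact (hlt y hy hyd).1
        · exact hab
        · exact h' y (Finset.mem_filter.2 ⟨hy, hyd⟩)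
      · exact Or.inr (Or.inr ⟨d, hdM, by grind, Or.inr ⟨hab ▸ ha, ha, h'⟩⟩)
    · exact Or.inr (Or.inr ⟨d, hdM, by grind, Or.inl hab⟩)

theorem WordLT.irrefl (n : ℕ) (M : Finset α) (a : α → ℕ) : ¬ WordLT n M a a := by
  induction n generalizing M a with
  | zero => exact id
  | succ n ih =>
    rintro (⟨d, _, _, h₁, h₂⟩ | ⟨_, h⟩)
    · exact h₂ h₁
    · exact UpToZero.irrefl ih _ _ h

theorem WordLT.trans {n : ℕ} {M : Finset α} {a b c : α → ℕ}
    (hab : WordLT n M a b) (hbc : WordLT n M b c) : WordLT n M a c := by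
  induction n generalizing M a b c with
  | zero => exact hab
  | succ n ih =>
    rcases hab with ⟨d, hd, h₁, h₂, h₃⟩ | ⟨h₁, h₂⟩ <;>
      rcases hbc with ⟨e, he, h₄, h₅, h₆⟩ | ⟨h₄, h₅⟩
    · rcases lt_trichotomy d e with h | rfl | h
      · exact Or.inl ⟨d, hd, fun y hy hyd => by grind, h₂, by grind⟩
      · exact absurd h₅ h₃
      · exact Or.inl ⟨e, he, fun y hy hyd => by grind, by grind, h₆⟩
    · exact Or.inl ⟨d, hd, fun y hy hyd => by grind, h₂, by grind⟩
    · exact Or.inl ⟨e, he, fun y hy hyd => by grind, by grind, h₆⟩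
    · refine Or.inr ⟨fun y hy => (h₁ y hy).trans (h₄ y hy), ?_⟩
      have hM : M.filter (b · ≠ n + 1) = M.filter (a · ≠ n + 1) :=
        Finset.filter_congr fun y hy => not_congr (h₁ y hy).symm
      rw [hM] at h₅
      exact h₂.trans (r := WordLT n) (fun _ _ _ _ => ih) h₅

theorem WordLT.trichotomous {n : ℕ} {M : Finset α} {a b : α → ℕ}
    (ha : ∀ y ∈ M, a y ≤ n) (hb : ∀ y ∈ M, b y ≤ n) :
    WordLT n M a b ∨ (∀ y ∈ M, a y = b y) ∨ WordLT n M b a := by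
  induction n generalizing M with
  | zero => exact Or.inr (Or.inl fun y hy => by have := ha y hy; have := hb y hy; omega)
  | succ n ih =>
    rcases (M.filter fun y => ¬ (a y = n + 1 ↔ b y = n + 1)).eq_empty_or_nonempty with h | h
    · have hiff : ∀ y ∈ M, a y = n + 1 ↔ b y = n + 1 := by
        intro y hy
        by_contra hne
        exact Finset.notMem_empty y (h ▸ Finset.mem_filter.2 ⟨hy, hne⟩)
      have hM : M.filter (b · ≠ n + 1) = M.filter (a · ≠ n + 1) :=
        Finset.filter_congr fun y hy => not_congr (hiff y hy).symm
      rcases UpToZero.trichotomous (r := WordLT n) (M := M.filter (a · ≠ n + 1)) (a := a)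
        (b := b) (fun d _ => ih (by grind) (by grind)) with h' | h' | h'
      · exact Or.inl (Or.inr ⟨hiff, h'⟩)
      · exact Or.inr (Or.inl fun y hy => by grind)
      · exact Or.inr (Or.inr (Or.inr ⟨fun y hy => (hiff y hy).symm, hM ▸ h'⟩))
    · obtain ⟨d, hd, hmin⟩ := Finset.exists_min_image _ id h
      obtain ⟨hdM, hd⟩ := Finset.mem_filter.1 hd
      have hlt : ∀ y ∈ M, y < d → (a y = n + 1 ↔ b y = n + 1) := by
        intro y hy hyd
        by_contra hne
        exact absurd hyd (not_lt.2 (hmin y (Finset.mem_filter.2 ⟨hy, hne⟩)))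
      by_cases had : a d = n + 1
      · exact Or.inl (Or.inl ⟨d, hdM, hlt, had, by tauto⟩)
      · exact Or.inr (Or.inr (Or.inl ⟨d, hdM, fun y hy hyd => (hlt y hy hyd).symm, by tauto, had⟩))

theorem UpToZero.exists_swap {n : ℕ} {M : Finset α} {a b : α → ℕ}
    (ih : ∀ d ∈ M, (∀ i, ((M.filter (d < ·)).filter (a · = i)).card =
        ((M.filter (d < ·)).filter (b · = i)).card) →
      n ≤ ((M.filter (d < ·)).filter (b · = 0)).card + 1 → WordLT n (M.filter (d < ·)) a b →
      ∃ x ∈ M.filter (d < ·), ∃ y ∈ M.filter (d < ·), b x ≠ 0 ∧ a x ≠ b x ∧ b y = 0 ∧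
        WordLT n (M.filter (d < ·)) (b ∘ Equiv.swap x y) b)
    (hc : ∀ i, (M.filter (a · = i)).card = (M.filter (b · = i)).card)
    (hb : ∀ y ∈ M, b y ≤ n) (hz : n ≤ (M.filter (b · = 0)).card)
    (h : UpToZero (WordLT n) M a b) :
    ∃ x ∈ M, ∃ y ∈ M, b x ≠ 0 ∧ a x ≠ b x ∧ b y = 0 ∧
      UpToZero (WordLT n) M (b ∘ Equiv.swap x y) b := by
  obtain ⟨d, hd, hlt, h | ⟨had, hbd, h⟩⟩ := h
  · have hpos : 0 < (M.filter (b · = 0)).card := by have := hb d hd; omega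
    obtain ⟨y, hy⟩ := Finset.card_pos.1 hpos
    obtain ⟨hyM, hy⟩ := Finset.mem_filter.1 hy
    refine ⟨d, hd, y, hyM, by omega, by omega, hy, d, hd, fun z hz hzd => ?_, Or.inl ?_⟩
    · have hzy : z ≠ y := by grind
      simp only [Function.comp, Equiv.swap_apply_of_ne_of_ne hzd.ne hzy]
      grind
    · simp only [Function.comp, Equiv.swap_apply_left, hy]
      omega
  · have hzero : (M.filter (b · = 0)).card ≤ ((M.filter (d < ·)).filter (b · = 0)).card + 1 := by
      rw [← Finset.card_insert_of_notMem (a := d) (by simp)]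
      refine Finset.card_le_card fun z hz => ?_
      rcases lt_trichotomy z d with hzd | rfl | hzd <;> grind
    obtain ⟨x, hx, y, hy, hbx, hne, hby, hless⟩ := ih d hd
      (card_filter_eq_of_agree hc fun y hy hyd => by
        rcases (not_lt.1 hyd).lt_or_eq with h' | rfl
        · exact (hlt y hy h').1
        · rw [had, hbd])
      (by omega) h
    obtain ⟨hxM, hdx⟩ := Finset.mem_filter.1 hx
    obtain ⟨hyM, hdy⟩ := Finset.mem_filter.1 hy
    refine ⟨x, hxM, y, hyM, hbx, hne, hby, d, hd, fun z hz hzd => ?_, Or.inr ⟨?_, hbd, hless⟩⟩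
    · simp only [Function.comp,
        Equiv.swap_apply_of_ne_of_ne (hzd.trans hdx).ne (hzd.trans hdy).ne]
      grind
    · simp only [Function.comp, Equiv.swap_apply_of_ne_of_ne hdx.ne hdy.ne, hbd]

/-- The shelling property of `WordLT`: if `a` precedes `b`, then `b` has a nonzero letter at which
it differs from `a`, and which can be exchanged with a zero to give a smaller word. -/
theorem WordLT.exists_swap {n : ℕ} {M : Finset α} {a b : α → ℕ}
    (hc : ∀ i, (M.filter (a · = i)).card = (M.filter (b · = i)).card)
    (hb : ∀ y ∈ M, b y ≤ n) (hz : n ≤ (M.filter (b · = 0)).card + 1)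
    (h : WordLT n M a b) :
    ∃ x ∈ M, ∃ y ∈ M, b x ≠ 0 ∧ a x ≠ b x ∧ b y = 0 ∧ WordLT n M (b ∘ Equiv.swap x y) b := by
  induction n generalizing M with
  | zero => exact h.elim
  | succ n ih =>
    rcases h with ⟨d, hd, hlt, had, hbd⟩ | ⟨hiff, h⟩
    · by_cases hcd : ∃ c ∈ M, c ≤ d ∧ b c = 0
      · obtain ⟨c, hcM, hcd, hbc⟩ := hcd
        obtain ⟨x, hxM, hbx, hax⟩ : ∃ x ∈ M, b x = n + 1 ∧ a x ≠ n + 1 := by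
          by_contra! hsub
          have : M.filter (b · = n + 1) ⊂ M.filter (a · = n + 1) :=
            Finset.ssubset_iff_of_subset (fun z hz => by grind) |>.2 ⟨d, by grind, by grind⟩
          exact (Finset.card_lt_card this).ne (hc _).symm
        have hdx : d < x := by
          by_contra! hle
          rcases hle.lt_or_eq with h' | rfl
          · exact hax ((hlt x hxM h').2 hbx)
          · exact hax had
        refine ⟨x, hxM, c, hcM, by omega, by omega, hbc,
          Or.inl ⟨c, hcM, fun z hz hzc => ?_, ?_, by omega⟩⟩
        · rw [Function.comp, Equiv.swap_apply_of_ne_of_ne (by grind) hzc.ne]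
        · rw [Function.comp, Equiv.swap_apply_right, hbx]
      · push Not at hcd
        have hbd0 := hcd d hd le_rfl
        have hpos : 0 < (M.filter (b · = 0)).card := by have := hb d hd; omega
        obtain ⟨y, hy⟩ := Finset.card_pos.1 hpos
        obtain ⟨hyM, hy⟩ := Finset.mem_filter.1 hy
        have hmem : ∀ z, (b ∘ Equiv.swap d y) z = n + 1 ↔ b z = n + 1 := by
          intro z
          simp only [Function.comp, Equiv.swap_apply_def]
          split_ifs <;> grind
        refine ⟨d, hd, y, hyM, hbd0, by omega, hy,
          Or.inr ⟨fun z _ => hmem z, d, ?_, fun z hz hzd => ?_, Or.inl ?_⟩⟩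
        · exact Finset.mem_filter.2 ⟨hd, (hmem d).not.2 hbd⟩
        · have hzM := (Finset.mem_filter.1 hz).1
          have hzy : z ≠ y := fun h' => hcd z hzM hzd.le (h' ▸ hy)
          rw [Function.comp, Equiv.swap_apply_of_ne_of_ne hzd.ne hzy]
          exact ⟨rfl, hcd z hzM hzd.le⟩
        · rw [Function.comp, Equiv.swap_apply_left, hy]
          omega
    · have hzero : (M.filter (b · = 0)).card ≤
          ((M.filter (a · ≠ n + 1)).filter (b · = 0)).card :=
        Finset.card_le_card fun z hz => by grind
      have hb' : ∀ y ∈ M.filter (a · ≠ n + 1), b y ≤ n := fun y hy => by grind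
      obtain ⟨x, hx, y, hy, hbx, hne, hby, hless⟩ := UpToZero.exists_swap
        (fun d _ hc' hz' h' => ih hc' (fun y hy => hb' y (Finset.mem_filter.1 hy).1) hz' h')
        (card_filter_eq_of_agree hc fun y hy hp => by grind) hb' (by omega) h
      obtain ⟨hxM, hax⟩ := Finset.mem_filter.1 hx
      obtain ⟨hyM, hay⟩ := Finset.mem_filter.1 hy
      have hmem : ∀ z, (b ∘ Equiv.swap x y) z = n + 1 ↔ b z = n + 1 := by
        intro z
        simp only [Function.comp, Equiv.swap_apply_def]
        split_ifs <;> grind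
      refine ⟨x, hxM, y, hyM, hbx, hne, hby, Or.inr ⟨fun z _ => hmem z, ?_⟩⟩
      convert hless using 1
      exact Finset.filter_congr fun z hz => not_congr ((hmem z).trans (hiff z hz).symm)

end WordOrder

theorem exists_equiv_fin_of_isStrictTotalOrder {S : Type*} [Finite S] (s : S → S → Prop)
    [IsStrictTotalOrder S s] : ∃ t : ℕ, ∃ e : Fin t ≃ S, ∀ i j, i < j ↔ s (e i) (e j) := by
  classical
  let _ : LinearOrder S := linearOrderOfSTO s
  let _ : Fintype S := Fintype.ofFinite S
  let e := Fintype.orderIsoFinOfCardEq S rfl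
  exact ⟨_, e.toEquiv, fun i j => e.lt_iff_lt.symm⟩

/-- A complex whose facets have constant cardinality is shellable if there is a strict order on
its facets with the exchange property of a shelling. -/
theorem shellable_of_strictOrder {V : Type} [DecidableEq V] [Finite V] {Δ : Set (Finset V)}
    (r : Finset V → Finset V → Prop)
    (hcard : ∀ A B, IsFacet Δ A → IsFacet Δ B → A.card = B.card)
    (irrefl : ∀ A, ¬ r A A) (trans : ∀ A B C, r A B → r B C → r A C)
    (tri : ∀ A B, IsFacet Δ A → IsFacet Δ B → r A B ∨ A = B ∨ r B A)
    (exch : ∀ A B, IsFacet Δ A → IsFacet Δ B → r A B →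
      ∃ C, IsFacet Δ C ∧ r C B ∧ ∃ v ∈ B, v ∉ A ∧ C ∩ B = B \ {v}) :
    Shellable Δ := by
  classical
  refine ⟨hcard, ?_⟩
  let S := {A : Finset V // IsFacet Δ A}
  have hS : IsStrictTotalOrder S (fun A B => r A.1 B.1) :=
    { irrefl := fun A => irrefl A.1
      trans := fun A B C => trans A.1 B.1 C.1
      trichotomous := fun A B h₁ h₂ => by
        rcases tri A.1 B.1 A.2 B.2 with h | h | h
        · exact absurd h h₁
        · exact Subtype.ext h
        · exact absurd h h₂ }
  obtain ⟨t, e, he⟩ := exists_equiv_fin_of_isStrictTotalOrder (fun A B : S => r A.1 B.1)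
  refine ⟨t, fun i => (e i).1, fun i j h => e.injective (Subtype.ext h),
    fun i => (e i).2, fun A hA => ⟨e.symm ⟨A, hA⟩, by simp⟩, fun i j hij => ?_⟩
  have hlt : r (e i).1 (e j).1 := (he i j).1 hij
  obtain ⟨C, hC, hCr, v, hv, hvA, hCB⟩ := exch _ _ (e i).2 (e j).2 hlt
  refine ⟨e.symm ⟨C, hC⟩, ?_, v, hv, ?_, ?_⟩
  · rw [he, e.apply_symm_apply]
    exact hCr
  · simp only [Equiv.apply_symm_apply]
    grind
  · simpa using hCB

section Chessboard

variable {m n : ℕ} {k : Fin n → ℕ}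

/-- The word of a face: its letter in column `j` is `i + 1` if the face contains `(j, i)`, and
`0` if the face has no vertex in column `j`. -/
def columnWord (A : Finset (Fin m × Fin n)) (j : Fin m) : ℕ :=
  ∑ i : Fin n, if (j, i) ∈ A then (i : ℕ) + 1 else 0

theorem columnWord_eq_zero {A : Finset (Fin m × Fin n)} {j : Fin m} :
    columnWord A j = 0 ↔ ∀ i, (j, i) ∉ A := by
  simp [columnWord]

theorem IsFace.eq_of_mem {A : Finset (Fin m × Fin n)} (hA : IsFace m n k (fun _ => 1) A)
    {j : Fin m} {i i' : Fin n} (h : (j, i) ∈ A) (h' : (j, i') ∈ A) : i = i' := by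
  have := Finset.card_le_one.1 (hA.2 j) (j, i) (by simp [h]) (j, i') (by simp [h'])
  exact (Prod.mk.inj this).2

theorem IsFace.columnWord_of_mem {A : Finset (Fin m × Fin n)}
    (hA : IsFace m n k (fun _ => 1) A) {j : Fin m} {i : Fin n} (h : (j, i) ∈ A) :
    columnWord A j = i + 1 := by
  rw [columnWord, Finset.sum_eq_single i, if_pos h]
  · exact fun i' _ hi' => if_neg fun h' => hi' (hA.eq_of_mem h' h)
  · simp

theorem IsFace.columnWord_eq_succ {A : Finset (Fin m × Fin n)}
    (hA : IsFace m n k (fun _ => 1) A) {j : Fin m} {i : Fin n} :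
    columnWord A j = i + 1 ↔ (j, i) ∈ A := by
  refine ⟨fun h => ?_, hA.columnWord_of_mem⟩
  obtain ⟨i', hi'⟩ : ∃ i', (j, i') ∈ A := by
    by_contra! hne
    rw [columnWord_eq_zero.2 hne] at h
    omega
  have := hA.columnWord_of_mem hi'
  rwa [Fin.ext (by omega : (i : ℕ) = i')]

theorem IsFace.columnWord_le {A : Finset (Fin m × Fin n)}
    (hA : IsFace m n k (fun _ => 1) A) (j : Fin m) : columnWord A j ≤ n := by
  by_cases h : ∃ i, (j, i) ∈ A
  · obtain ⟨i, hi⟩ := h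
    rw [hA.columnWord_of_mem hi]
    exact i.2
  · push Not at h
    simp [columnWord_eq_zero.2 h]

theorem IsFace.eq_of_columnWord_eq {A B : Finset (Fin m × Fin n)}
    (hA : IsFace m n k (fun _ => 1) A) (hB : IsFace m n k (fun _ => 1) B)
    (h : ∀ j, columnWord A j = columnWord B j) : A = B := by
  ext ⟨j, i⟩
  rw [← hA.columnWord_eq_succ, ← hB.columnWord_eq_succ, h]

theorem IsFace.card_columnWord_eq_succ {A : Finset (Fin m × Fin n)}
    (hA : IsFace m n k (fun _ => 1) A) (i : Fin n) :
    (Finset.univ.filter (columnWord A · = i + 1)).card = (A.filter (·.2 = i)).card := by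
  refine Finset.card_bij (fun j _ => (j, i)) ?_ ?_ ?_
  · intro j hj
    simpa [hA.columnWord_eq_succ] using hj
  · intro j _ j' _ h
    exact (Prod.mk.inj h).1
  · rintro ⟨j, i'⟩ h
    obtain ⟨h, rfl⟩ := Finset.mem_filter.1 h
    exact ⟨j, by simpa [hA.columnWord_eq_succ] using h, rfl⟩

theorem IsFace.card_columnWord_ne_zero {A : Finset (Fin m × Fin n)}
    (hA : IsFace m n k (fun _ => 1) A) :
    (Finset.univ.filter (¬ columnWord A · = 0)).card = A.card := by
  symm
  refine Finset.card_bij (fun v _ => v.1) ?_ ?_ ?_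
  · rintro ⟨j, i⟩ h
    simp [hA.columnWord_of_mem h]
  · rintro ⟨j, i⟩ h ⟨j', i'⟩ h' (rfl : j = j')
    rw [hA.eq_of_mem h h']
  · intro j hj
    have := (Finset.mem_filter.1 hj).2
    rw [columnWord_eq_zero] at this
    push Not at this
    obtain ⟨i, hi⟩ := this
    exact ⟨(j, i), hi, rfl⟩

theorem IsFace.card_columnWord_eq_zero_add {A : Finset (Fin m × Fin n)}
    (hA : IsFace m n k (fun _ => 1) A) :
    (Finset.univ.filter (columnWord A · = 0)).card + A.card = m := by
  rw [← hA.card_columnWord_ne_zero, Finset.card_filter_add_card_filter_not, Finset.card_univ,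
    Fintype.card_fin]

theorem card_eq_sum_card_row (A : Finset (Fin m × Fin n)) :
    A.card = ∑ i, (A.filter (·.2 = i)).card :=
  Finset.card_eq_sum_card_fiberwise fun _ _ => Finset.mem_coe.2 (Finset.mem_univ _)

/-- With enough columns, every row of a facet is filled up to its capacity. -/
theorem card_row_of_isFacet (hm : ∑ i, k i ≤ m) {A : Finset (Fin m × Fin n)}
    (hA : IsFacet {A | IsFace m n k (fun _ => 1) A} A) (i : Fin n) :
    (A.filter (·.2 = i)).card = k i := by
  have hface : IsFace m n k (fun _ => 1) A := hA.1
  refine (hface.1 i).eq_of_not_lt fun hlt => ?_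
  have hAcard : A.card < m := by
    rw [card_eq_sum_card_row]
    exact (Finset.sum_lt_sum (fun i _ => hface.1 i) ⟨i, Finset.mem_univ _, hlt⟩).trans_le hm
  have hpos : 0 < (Finset.univ.filter (columnWord A · = 0)).card := by
    have := hface.card_columnWord_eq_zero_add
    omega
  obtain ⟨j, hj⟩ := Finset.card_pos.1 hpos
  have hfree := columnWord_eq_zero.1 (Finset.mem_filter.1 hj).2
  have hins : IsFace m n k (fun _ => 1) (insert (j, i) A) := by
    refine ⟨fun i' => ?_, fun j' => ?_⟩
    · rw [Finset.filter_insert]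
      split_ifs with h
      · obtain rfl : i = i' := h
        exact (Finset.card_insert_le _ _).trans hlt
      · exact hface.1 i'
    · rw [Finset.filter_insert]
      split_ifs with h
      · obtain rfl : j = j' := h
        have : A.filter (·.1 = j) = ∅ :=
          Finset.filter_eq_empty_iff.2 fun v hv hvj => hfree v.2 (by rw [← hvj]; exact hv)
        rw [this]
        simp
      · exact hface.2 j'
  exact hfree i (hA.2 _ hins (Finset.subset_insert _ _) ▸ Finset.mem_insert_self _ _)

/-- The action of a permutation of the columns on sets of vertices of the chessboard. -/
def permuteColumns (σ : Equiv.Perm (Fin m)) (A : Finset (Fin m × Fin n)) :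
    Finset (Fin m × Fin n) :=
  A.map (σ.prodCongr (Equiv.refl (Fin n))).toEmbedding

theorem mem_permuteColumns {σ : Equiv.Perm (Fin m)} {A : Finset (Fin m × Fin n)} {j : Fin m}
    {i : Fin n} : (j, i) ∈ permuteColumns σ A ↔ (σ.symm j, i) ∈ A := by
  simp [permuteColumns, Finset.mem_map_equiv]

theorem columnWord_permuteColumns (σ : Equiv.Perm (Fin m)) (A : Finset (Fin m × Fin n)) :
    columnWord (permuteColumns σ A) = columnWord A ∘ σ.symm := by
  funext j
  simp [columnWord, mem_permuteColumns]

theorem IsFace.permuteColumns {A : Finset (Fin m × Fin n)} (hA : IsFace m n k (fun _ => 1) A)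
    (σ : Equiv.Perm (Fin m)) : IsFace m n k (fun _ => 1) (permuteColumns σ A) := by
  refine ⟨fun i => ?_, fun j => ?_⟩
  · rw [_root_.permuteColumns, Finset.filter_map, Finset.card_map]
    exact hA.1 i
  · rw [_root_.permuteColumns, Finset.filter_map, Finset.card_map]
    convert hA.2 (σ.symm j) using 3 with v
    simp [Equiv.eq_symm_apply]

theorem IsFacet.permuteColumns {A : Finset (Fin m × Fin n)}
    (hA : IsFacet {A | IsFace m n k (fun _ => 1) A} A) (σ : Equiv.Perm (Fin m)) :
    IsFacet {A | IsFace m n k (fun _ => 1) A} (permuteColumns σ A) := by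
  refine ⟨IsFace.permuteColumns hA.1 σ, fun B hB hAB => ?_⟩
  have h := hA.2 _ (IsFace.permuteColumns hB σ.symm) fun ⟨j, i⟩ hv => by
    rw [mem_permuteColumns]
    exact hAB (by simpa [mem_permuteColumns] using hv)
  ext ⟨j, i⟩
  rw [mem_permuteColumns, h, mem_permuteColumns]
  simp

end Chessboard

theorem shellability_of_multiple_chessboard_complex
    (m n : ℕ) (hn : 1 ≤ n) (k : Fin n → ℕ) (hk : ∀ i, 1 ≤ k i)
    (hm : (∑ i, k i) + n - 1 ≤ m) :
    Shellable {A : Finset (Fin m × Fin n) | IsFace m n k (fun _ => 1) A} := by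
  have hm' : ∑ i, k i ≤ m := by omega
  have hrow {A} := card_row_of_isFacet (k := k) hm' (A := A)
  have hcard : ∀ A, IsFacet {A : Finset (Fin m × Fin n) | IsFace m n k (fun _ => 1) A} A →
      A.card = ∑ i, k i := fun A hA => by
    rw [card_eq_sum_card_row]
    exact Finset.sum_congr rfl fun i _ => hrow hA i
  have hzero : ∀ A, IsFacet {A : Finset (Fin m × Fin n) | IsFace m n k (fun _ => 1) A} A →
      (Finset.univ.filter (columnWord A · = 0)).card + ∑ i, k i = m := fun A hA => by
    rw [← hcard A hA]
    exact IsFace.card_columnWord_eq_zero_add hA.1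
  refine shellable_of_strictOrder
    (fun A B => WordLT n Finset.univ (columnWord A) (columnWord B))
    (fun A B hA hB => (hcard A hA).trans (hcard B hB).symm)
    (fun A => WordLT.irrefl _ _ _) (fun A B C => WordLT.trans) (fun A B hA hB => ?_)
    (fun A B hA hB hlt => ?_)
  · have hA' : IsFace m n k (fun _ => 1) A := hA.1
    have hB' : IsFace m n k (fun _ => 1) B := hB.1
    rcases WordLT.trichotomous (fun j _ => hA'.columnWord_le j) (fun j _ => hB'.columnWord_le j)
      with h | h | h
    · exact Or.inl h
    · exact Or.inr (Or.inl (hA'.eq_of_columnWord_eq hB' fun j => h j (Finset.mem_univ j)))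
    · exact Or.inr (Or.inr h)
  · have hA' : IsFace m n k (fun _ => 1) A := hA.1
    have hB' : IsFace m n k (fun _ => 1) B := hB.1
    have hcontent : ∀ i, (Finset.univ.filter (columnWord A · = i)).card =
        (Finset.univ.filter (columnWord B · = i)).card := by
      rintro (_ | i)
      · have := hzero A hA
        have := hzero B hB
        omega
      · by_cases hi : i < n
        · have h₁ := hA'.card_columnWord_eq_succ ⟨i, hi⟩
          have h₂ := hB'.card_columnWord_eq_succ ⟨i, hi⟩
          rw [hrow hA] at h₁
          rw [hrow hB] at h₂
          exact h₁.trans h₂.symm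
        · rw [Finset.filter_false_of_mem, Finset.filter_false_of_mem]
          · exact fun j _ => by have := hB'.columnWord_le j; omega
          · exact fun j _ => by have := hA'.columnWord_le j; omega
    obtain ⟨x, -, y, -, hBx, hAx, hBy, hless⟩ := hlt.exists_swap hcontent
      (fun j _ => hB'.columnWord_le j) (by have := hzero B hB; omega)
    obtain ⟨i, hi⟩ : ∃ i, (x, i) ∈ B := by
      by_contra! h
      exact hBx (columnWord_eq_zero.2 h)
    refine ⟨permuteColumns (Equiv.swap x y) B, hB.permuteColumns _, ?_, (x, i), hi, ?_, ?_⟩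
    · rwa [columnWord_permuteColumns, Equiv.symm_swap]
    · exact fun h => hAx (by rw [hA'.columnWord_of_mem h, hB'.columnWord_of_mem hi])
    · have hyfree := columnWord_eq_zero.1 hBy
      ext ⟨j, i'⟩
      simp only [Finset.mem_inter, mem_permuteColumns, Equiv.symm_swap, Finset.mem_sdiff,
        Finset.mem_singleton, Prod.mk.injEq]
      by_cases hjx : j = x
      · subst hjx
        rw [Equiv.swap_apply_left]
        exact ⟨fun h => absurd h.1 (hyfree i'),
          fun h => absurd ⟨rfl, hB'.eq_of_mem h.1 hi⟩ h.2⟩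
      · by_cases hjy : j = y
        · subst hjy
          exact ⟨fun h => absurd h.2 (hyfree i'), fun h => absurd h.1 (hyfree i')⟩
        · rw [Equiv.swap_apply_of_ne_of_ne hjx hjy]
          exact ⟨fun h => ⟨h.1, fun h' => hjx h'.1⟩, fun h => ⟨h.1, h.1⟩⟩
end

section
/- Let m ≥ 2 and 1 ≤ p ≤ m − 1, and let K = [m]^{≤p} be the simplicial complex of all subsets of [m] of cardinality at most p. Then, under the identification of [m]×{1,2} with [m]×[2], the Bier sphere Bier_m(K) equals (as a family of subsets of [m]×[2]) the multiple chessboard complex Δ_{m,2}^{k_1,k_2;1} with row capacities k_1 = p and k_2 = m − p − 1 and all column capacities equal to 1. -/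
open scoped BigOperators

/-- The combinatorial Alexander dual of a simplicial complex on vertex set `[m]`:
`K° = {F ⊆ [m] : [m] \ F ∉ K}`. -/
def AlexanderDual (m : ℕ) (K : Set (Finset (Fin m))) : Set (Finset (Fin m)) :=
  {F | Finset.univ \ F ∉ K}

/-- The Bier sphere `Bier_m(K)`: the simplicial complex on `[m] × [2]` whose faces are
the sets `(F × {0}) ∪ (G × {1})` with `F ∈ K`, `G ∈ K°` and `F ∩ G = ∅`. -/
def BierSphere (m : ℕ) (K : Set (Finset (Fin m))) : Set (Finset (Fin m × Fin 2)) :=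
  {A | ∃ F G : Finset (Fin m), F ∈ K ∧ G ∈ AlexanderDual m K ∧ F ∩ G = ∅ ∧
    A = F.image (fun a => (a, (0 : Fin 2))) ∪ G.image (fun a => (a, (1 : Fin 2)))}

/-- The complex `[m]^{≤ p}` of all subsets of `[m]` of cardinality at most `p`. -/
def SkeletonComplex (m p : ℕ) : Set (Finset (Fin m)) := {F | F.card ≤ p}

theorem mem_alexanderDual_skeletonComplex {m p : ℕ} (hp : p < m) (G : Finset (Fin m)) :
    G ∈ AlexanderDual m (SkeletonComplex m p) ↔ G.card ≤ m - p - 1 := by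
  have hcard : (Finset.univ \ G).card = m - G.card := by
    rw [← Finset.compl_eq_univ_sdiff, Finset.card_compl, Fintype.card_fin]
  simp only [AlexanderDual, SkeletonComplex, Set.mem_ofPred_eq, hcard]
  omega

/-- The set of columns occupied by `A` in row `i`. -/
def rowSupport {m n : ℕ} (A : Finset (Fin m × Fin n)) (i : Fin n) : Finset (Fin m) :=
  Finset.univ.filter fun a => (a, i) ∈ A

theorem mem_rowSupport {m n : ℕ} {A : Finset (Fin m × Fin n)} {i : Fin n} {a : Fin m} :
    a ∈ rowSupport A i ↔ (a, i) ∈ A := by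
  simp [rowSupport]

theorem card_filter_snd_eq {m n : ℕ} (A : Finset (Fin m × Fin n)) (i : Fin n) :
    (A.filter fun v => v.2 = i).card = (rowSupport A i).card := by
  have himage : (A.filter fun v => v.2 = i) = (rowSupport A i).image fun a => (a, i) := by
    ext ⟨a, b⟩
    simp only [Finset.mem_filter, Finset.mem_image, mem_rowSupport, Prod.mk.injEq]
    grind
  rw [himage, Finset.card_image_of_injective _ (Prod.mk_left_injective i)]

theorem card_filter_fst_le_one_iff {m : ℕ} (A : Finset (Fin m × Fin 2)) :
    (∀ j : Fin m, (A.filter fun v => v.1 = j).card ≤ 1) ↔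
      rowSupport A 0 ∩ rowSupport A 1 = ∅ := by
  simp only [Finset.card_le_one, Finset.mem_filter, Finset.eq_empty_iff_forall_notMem,
    Finset.mem_inter, mem_rowSupport]
  constructor
  · rintro h a ⟨h0, h1⟩
    simpa using h a (a, 0) ⟨h0, rfl⟩ (a, 1) ⟨h1, rfl⟩
  · rintro h j ⟨a, b⟩ ⟨hab, rfl⟩ ⟨c, d⟩ ⟨hcd, rfl⟩
    have := h c
    fin_cases b <;> fin_cases d <;> simp_all

theorem eq_image_union_image_iff {m : ℕ} (A : Finset (Fin m × Fin 2)) (F G : Finset (Fin m)) :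
    A = F.image (fun a => (a, (0 : Fin 2))) ∪ G.image (fun a => (a, (1 : Fin 2))) ↔
      F = rowSupport A 0 ∧ G = rowSupport A 1 := by
  constructor
  · rintro rfl
    constructor <;> ext a <;> simp [mem_rowSupport]
  · rintro ⟨rfl, rfl⟩
    ext ⟨a, b⟩
    fin_cases b <;> simp [mem_rowSupport]

theorem bier_sphere_eq_multiple_chessboard_complex
    (m p : ℕ) (hm : 2 ≤ m) (hp1 : 1 ≤ p) (hp2 : p ≤ m - 1) :
    BierSphere m (SkeletonComplex m p) =
      {A : Finset (Fin m × Fin 2) | IsFace m 2 ![p, m - p - 1] (fun _ => 1) A} := by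
  ext A
  simp only [BierSphere, IsFace, Set.mem_ofPred_eq, eq_image_union_image_iff,
    card_filter_fst_le_one_iff, card_filter_snd_eq, Fin.forall_fin_two,
    mem_alexanderDual_skeletonComplex (show p < m by omega)]
  constructor
  · rintro ⟨_, _, hF, hG, hFG, rfl, rfl⟩
    exact ⟨⟨hF, hG⟩, hFG⟩
  · rintro ⟨⟨hF, hG⟩, hFG⟩
    exact ⟨_, _, hF, hG, hFG, rfl, rfl⟩
end

section
/- Let m ≥ 2 and 1 ≤ p ≤ m − 1. The geometric realization of the multiple chessboard complex Δ_{m,2}^{k_1,k_2;1} with row capacities k_1 = p and k_2 = m − p − 1 and all column capacities equal to 1 is homeomorphic to the sphere S^{m−2}. In particular, for every p ≥ 1 the geometric realization of Δ_{2p+1,2}^{p,1} (a (2p+1)×2 chessboard, at most p rooks in each row, at most one rook in each column) is homeomorphic to S^{2p−1}. -/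
open scoped BigOperators

/-- The `(p + 1)`-st largest coordinate of `x`. -/
noncomputable def orderStat {ι : Type*} [Fintype ι] (p : ℕ) [Nonempty (Fin (p + 1) ↪ ι)]
    (x : ι → ℝ) : ℝ := by
  classical
  exact Finset.univ.sup' Finset.univ_nonempty fun e : Fin (p + 1) ↪ ι =>
    Finset.univ.inf' Finset.univ_nonempty fun i => x (e i)

section OrderStat

variable {ι : Type*} [Fintype ι] {p : ℕ}

lemma exists_embedding_forall_iff (P : ι → Prop) [DecidablePred P] :
    (∃ e : Fin (p + 1) ↪ ι, ∀ i, P (e i)) ↔ p < (Finset.univ.filter P).card := by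
  constructor
  · rintro ⟨e, he⟩
    have h : Finset.univ.map e ⊆ Finset.univ.filter P := by
      intro j hj
      obtain ⟨i, -, rfl⟩ := Finset.mem_map.1 hj
      simp [he]
    simpa using Finset.card_le_card h
  · intro h
    obtain ⟨s, hs, hcard⟩ := Finset.exists_subset_card_eq (Nat.succ_le_of_lt h)
    refine ⟨(s.equivFinOfCardEq hcard).symm.toEmbedding.trans (Function.Embedding.subtype _),
      fun i => ?_⟩
    exact (Finset.mem_filter.1 (hs ((s.equivFinOfCardEq hcard).symm i).2)).2

variable [Nonempty (Fin (p + 1) ↪ ι)]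

lemma le_orderStat_iff (x : ι → ℝ) (c : ℝ) :
    c ≤ orderStat p x ↔ p < (Finset.univ.filter fun j => c ≤ x j).card := by
  rw [← exists_embedding_forall_iff]
  simp [orderStat, Finset.le_sup'_iff]

lemma lt_orderStat_iff (x : ι → ℝ) (c : ℝ) :
    c < orderStat p x ↔ p < (Finset.univ.filter fun j => c < x j).card := by
  rw [← exists_embedding_forall_iff]
  simp [orderStat, Finset.lt_sup'_iff]

lemma continuous_orderStat : Continuous (orderStat (ι := ι) p) := by
  unfold orderStat
  refine Continuous.finset_sup'_apply _ fun e _ => Continuous.finset_inf'_apply _ fun i _ => ?_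
  fun_prop

lemma orderStat_sub_const (x : ι → ℝ) (c : ℝ) :
    orderStat p (fun j => x j - c) = orderStat p x - c := by
  refine eq_of_forall_le_iff fun d => ?_
  rw [le_sub_iff_add_le, le_orderStat_iff, le_orderStat_iff]
  simp only [le_sub_iff_add_le]

lemma orderStat_mul_const (x : ι → ℝ) {c : ℝ} (hc : 0 < c) :
    orderStat p (fun j => x j * c) = orderStat p x * c := by
  refine eq_of_forall_le_iff fun d => ?_
  rw [← div_le_iff₀ hc, le_orderStat_iff, le_orderStat_iff]
  simp only [div_le_iff₀ hc]

lemma orderStat_zero : orderStat p (0 : ι → ℝ) = 0 := by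
  simp [orderStat]

lemma orderStat_eq_zero_iff {q : ℕ} (hpq : p + q + 1 = Fintype.card ι) (x : ι → ℝ) :
    orderStat p x = 0 ↔ (Finset.univ.filter fun j => 0 < x j).card ≤ p ∧
      (Finset.univ.filter fun j => x j < 0).card ≤ q := by
  have h := Finset.card_filter_add_card_filter_not (s := Finset.univ) (fun j => 0 ≤ x j)
  simp only [not_le, Finset.card_univ] at h
  rw [le_antisymm_iff, ← not_lt, lt_orderStat_iff, le_orderStat_iff]
  omega

end OrderStat

/-- The unit sphere of the `ℓ¹` norm inside the zero set of `orderStat p`. -/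
def orderStatSphere (n p : ℕ) [Nonempty (Fin (p + 1) ↪ Fin (n + 1))] :
    Set (Fin (n + 1) → ℝ) :=
  {x | orderStat p x = 0 ∧ ∑ j, |x j| = 1}

section Chessboard

variable {n p q : ℕ}

lemma isFace_two_iff {m : ℕ} (k : Fin 2 → ℕ) (P : Fin m × Fin 2 → Prop) [DecidablePred P] :
    IsFace m 2 k (fun _ => 1) (Finset.univ.filter P) ↔
      ((Finset.univ.filter fun j => P (j, 0)).card ≤ k 0 ∧
        (Finset.univ.filter fun j => P (j, 1)).card ≤ k 1) ∧
      ∀ j, ¬ (P (j, 0) ∧ P (j, 1)) := by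
  have hrow (i : Fin 2) : ((Finset.univ.filter P).filter fun v => v.2 = i).card =
      (Finset.univ.filter fun j => P (j, i)).card := by
    rw [← Finset.card_map (Function.Embedding.sectL (Fin m) i)]
    congr 1
    ext ⟨a, b⟩
    simp only [Finset.mem_filter, Finset.mem_univ, true_and, Finset.mem_map,
      Function.Embedding.sectL_apply, Prod.mk.injEq]
    constructor
    · rintro ⟨h, rfl⟩
      exact ⟨a, h, rfl, rfl⟩
    · rintro ⟨_, h, rfl, rfl⟩
      exact ⟨h, rfl⟩
  have hcol (j : Fin m) : ((Finset.univ.filter P).filter fun v => v.1 = j).card ≤ 1 ↔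
      ¬ (P (j, 0) ∧ P (j, 1)) := by
    rw [Finset.card_le_one]
    constructor
    · intro h hP
      have := h (j, 0) (by simp [hP.1]) (j, 1) (by simp [hP.2])
      simp at this
    · rintro h ⟨a, b⟩ hb ⟨c, d⟩ hd
      simp only [Finset.mem_filter, Finset.mem_univ, true_and] at hb hd
      obtain ⟨hb, rfl⟩ := hb
      obtain ⟨hd, rfl⟩ := hd
      fin_cases b <;> fin_cases d <;> simp_all
  simp only [IsFace, hrow, hcol, Fin.forall_fin_two]

variable [Nonempty (Fin (p + 1) ↪ Fin (n + 1))]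

/-- Subtracting the second row of a weighted rook placement from the first one is a
homeomorphism onto `orderStatSphere`. -/
noncomputable def realizationHomeomorph (hpq : p + q = n) (k : Fin 2 → ℕ) (hp : k 0 = p)
    (hq : k 1 = q) :
    Realization (n + 1) 2 k (fun _ => 1) ≃ₜ orderStatSphere n p where
  toFun f := ⟨fun j => f.1 (j, 0) - f.1 (j, 1), by
    obtain ⟨f, hf, hsum, hface⟩ := f
    rw [isFace_two_iff, hp, hq] at hface
    obtain ⟨⟨h0, h1⟩, hdisj⟩ := hface
    refine ⟨(orderStat_eq_zero_iff (q := q) (by simp; omega) _).2 ⟨?_, ?_⟩, ?_⟩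
    · refine (Finset.card_le_card fun j => ?_).trans h0
      simp only [Finset.mem_filter, Finset.mem_univ, true_and]
      intro h
      linarith [(hf (j, 1)).1]
    · refine (Finset.card_le_card fun j => ?_).trans h1
      simp only [Finset.mem_filter, Finset.mem_univ, true_and]
      intro h
      linarith [(hf (j, 0)).1]
    · refine Eq.trans ?_ ((Fintype.sum_prod_type f).symm.trans hsum)
      refine Finset.sum_congr rfl fun j _ => ?_
      rw [Fin.sum_univ_two]
      rcases (hf (j, 0)).1.eq_or_lt with h | h
      · simp [← h, abs_of_nonneg (hf (j, 1)).1]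
      · have := le_antisymm (not_lt.1 fun h' => hdisj j ⟨h, h'⟩) (hf (j, 1)).1
        simp [this, abs_of_pos h]⟩
  invFun x := ⟨fun v => if v.2 = 0 then max (x.1 v.1) 0 else max (-x.1 v.1) 0, by
    obtain ⟨x, hx, hsum⟩ := x
    have hle (j) : |x j| ≤ 1 := by
      rw [← hsum]
      exact Finset.single_le_sum (f := fun j => |x j|) (fun _ _ => abs_nonneg _)
        (Finset.mem_univ j)
    refine ⟨fun v => ?_, ?_, ?_⟩
    · have := abs_le.1 (hle v.1)
      dsimp only
      split_ifs
      · exact ⟨le_max_right _ _, max_le this.2 zero_le_one⟩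
      · exact ⟨le_max_right _ _, max_le (by linarith) zero_le_one⟩
    · refine Eq.trans ?_ hsum
      rw [Fintype.sum_prod_type]
      refine Finset.sum_congr rfl fun j _ => ?_
      rw [Fin.sum_univ_two]
      rcases le_total 0 (x j) with h | h
      · simp [h, abs_of_nonneg h]
      · simp [h, abs_of_nonpos h]
    · rw [isFace_two_iff, hp, hq]
      have := (orderStat_eq_zero_iff (q := q) (by simp; omega) _).1 hx
      refine ⟨by simpa using this, fun j => ?_⟩
      simp only [Fin.isValue, ↓reduceIte, lt_sup_iff, lt_self_iff_false, or_false, one_ne_zero]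
      rintro ⟨h, h'⟩
      linarith⟩
  left_inv f := by
    obtain ⟨f, hf, hsum, hface⟩ := f
    rw [isFace_two_iff] at hface
    ext ⟨j, i⟩
    have h0 := (hf (j, 0)).1
    have h1 := (hf (j, 1)).1
    have key : f (j, 0) = 0 ∨ f (j, 1) = 0 := by
      rcases h0.eq_or_lt with h | h
      · exact Or.inl h.symm
      · exact Or.inr (le_antisymm (not_lt.1 fun h' => hface.2 j ⟨h, h'⟩) h1)
    fin_cases i <;> rcases key with h | h <;> simp [h, h0, h1]
  right_inv x := by
    ext j
    rcases le_total 0 (x.1 j) with h | h <;> simp [h]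
  continuous_toFun := by
    have h (v) : Continuous fun f : Realization (n + 1) 2 k (fun _ => 1) => f.1 v :=
      (continuous_apply v).comp continuous_subtype_val
    exact Continuous.subtype_mk (continuous_pi fun j => (h (j, 0)).sub (h (j, 1))) _
  continuous_invFun := by
    refine Continuous.subtype_mk (continuous_pi fun v => ?_) _
    have h : Continuous fun x : orderStatSphere n p => x.1 v.1 :=
      (continuous_apply v.1).comp continuous_subtype_val
    split_ifs
    exacts [h.max continuous_const, h.neg.max continuous_const]

/-- The representative of `y` modulo constants on which `orderStat p` vanishes. -/
noncomputable def orderStatLift (p : ℕ) [Nonempty (Fin (p + 1) ↪ Fin (n + 1))]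
    (y : EuclideanSpace ℝ (Fin n)) (j : Fin (n + 1)) : ℝ :=
  (Fin.cons 0 y.ofLp : Fin (n + 1) → ℝ) j -
    orderStat p (Fin.cons 0 y.ofLp : Fin (n + 1) → ℝ)

lemma orderStat_orderStatLift (y : EuclideanSpace ℝ (Fin n)) :
    orderStat p (orderStatLift p y) = 0 := by
  unfold orderStatLift
  rw [orderStat_sub_const, sub_self]

lemma orderStatLift_succ_sub_zero (y : EuclideanSpace ℝ (Fin n)) (i : Fin n) :
    orderStatLift p y i.succ - orderStatLift p y 0 = y i := by
  simp [orderStatLift]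

lemma continuous_orderStatLift :
    Continuous (orderStatLift p : EuclideanSpace ℝ (Fin n) → _) := by
  have h : Continuous fun y : EuclideanSpace ℝ (Fin n) =>
      (Fin.cons 0 y.ofLp : Fin (n + 1) → ℝ) := by
    refine continuous_pi fun j => ?_
    cases j using Fin.cases <;> simp only [Fin.cons_zero, Fin.cons_succ] <;> fun_prop
  exact continuous_pi fun j =>
    ((continuous_apply j).comp h).sub (continuous_orderStat.comp h)

lemma orderStatLift_eq_mul {x : Fin (n + 1) → ℝ} (hx : orderStat p x = 0) {c : ℝ} (hc : 0 < c)
    {y : EuclideanSpace ℝ (Fin n)} (hy : ∀ i, y i = (x i.succ - x 0) * c) (j : Fin (n + 1)) :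
    orderStatLift p y j = x j * c := by
  have h : (Fin.cons 0 y.ofLp : Fin (n + 1) → ℝ) = fun j => x j * c - x 0 * c := by
    ext j
    cases j using Fin.cases
    · simp
    · simp [hy, sub_mul]
  rw [orderStatLift, h, orderStat_sub_const, orderStat_mul_const x hc, hx]
  ring

lemma sum_abs_orderStatLift_pos {y : EuclideanSpace ℝ (Fin n)} (hy : y ≠ 0) :
    0 < ∑ j, |orderStatLift p y j| := by
  refine (Finset.sum_nonneg fun _ _ => abs_nonneg _).lt_of_ne' fun h => hy ?_
  have hz := (Finset.sum_eq_zero_iff_of_nonneg fun _ _ => abs_nonneg _).1 h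
  ext i
  rw [← orderStatLift_succ_sub_zero (p := p) y i, abs_eq_zero.1 (hz i.succ (Finset.mem_univ _)),
    abs_eq_zero.1 (hz 0 (Finset.mem_univ _))]
  simp

/-- The radial projection of `orderStatLift` to `orderStatSphere`. -/
noncomputable def sphereToOrderStatSphere (n p : ℕ) [Nonempty (Fin (p + 1) ↪ Fin (n + 1))]
    (y : Metric.sphere (0 : EuclideanSpace ℝ (Fin n)) 1) : orderStatSphere n p :=
  ⟨fun j => orderStatLift p y.1 j * (∑ j, |orderStatLift p y.1 j|)⁻¹, by
    have hpos := sum_abs_orderStatLift_pos (p := p) (ne_zero_of_mem_unit_sphere y)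
    refine ⟨?_, ?_⟩
    · rw [orderStat_mul_const _ (inv_pos.2 hpos), orderStat_orderStatLift, zero_mul]
    · simp only [abs_mul, ← Finset.sum_mul, abs_inv, abs_of_pos hpos]
      exact mul_inv_cancel₀ hpos.ne'⟩

lemma continuous_sphereToOrderStatSphere : Continuous (sphereToOrderStatSphere n p) := by
  have h : Continuous fun y : Metric.sphere (0 : EuclideanSpace ℝ (Fin n)) 1 =>
      orderStatLift p y.1 := continuous_orderStatLift.comp continuous_subtype_val
  have hj := continuous_pi_iff.1 h
  refine Continuous.subtype_mk (continuous_pi fun j => (hj j).mul (Continuous.inv₀ ?_ fun y => ?_)) _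
  · exact continuous_finsetSum _ fun j _ => (hj j).abs
  · exact (sum_abs_orderStatLift_pos (ne_zero_of_mem_unit_sphere y)).ne'

lemma sphereToOrderStatSphere_bijective : Function.Bijective (sphereToOrderStatSphere n p) := by
  constructor
  · intro y y' h
    have hs := sum_abs_orderStatLift_pos (p := p) (ne_zero_of_mem_unit_sphere y)
    have hs' := sum_abs_orderStatLift_pos (p := p) (ne_zero_of_mem_unit_sphere y')
    have hj := congrFun (congrArg Subtype.val h)
    simp only [sphereToOrderStatSphere] at hj
    have hsmul : (∑ j, |orderStatLift p y.1 j|)⁻¹ • y.1 =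
        (∑ j, |orderStatLift p y'.1 j|)⁻¹ • y'.1 := by
      ext i
      rw [PiLp.smul_apply, PiLp.smul_apply, ← orderStatLift_succ_sub_zero (p := p) y.1 i,
        ← orderStatLift_succ_sub_zero (p := p) y'.1 i, smul_eq_mul, smul_eq_mul]
      linarith [hj i.succ, hj 0]
    have hinv : (∑ j, |orderStatLift p y.1 j|)⁻¹ = (∑ j, |orderStatLift p y'.1 j|)⁻¹ := by
      simpa [norm_smul, abs_of_pos hs, abs_of_pos hs'] using congrArg norm hsmul
    rw [hinv] at hsmul
    exact Subtype.ext (smul_right_injective _ (inv_pos.2 hs').ne' hsmul)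
  · rintro ⟨x, hx, hsum⟩
    set w : EuclideanSpace ℝ (Fin n) := WithLp.toLp 2 fun i => x i.succ - x 0 with hw
    have hw0 : w ≠ 0 := by
      intro h
      have hz := orderStatLift_eq_mul hx one_pos (y := w) (by simp [hw])
      have hz' := orderStatLift_eq_mul (p := p) (x := 0) (y := w) (c := 1)
        orderStat_zero one_pos
        (by simp [h])
      have : ∀ j, x j = 0 := fun j => by simpa using (hz j).symm.trans (hz' j)
      simp [this] at hsum
    have hc : 0 < ‖w‖⁻¹ := inv_pos.2 (norm_pos_iff.2 hw0)
    refine ⟨⟨‖w‖⁻¹ • w, by simp [norm_smul, hw0]⟩, ?_⟩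
    have hlift := orderStatLift_eq_mul hx hc (y := ‖w‖⁻¹ • w) (by simp [hw, mul_comm])
    ext j
    simp only [sphereToOrderStatSphere, hlift, abs_mul, ← Finset.sum_mul, hsum, abs_of_pos hc]
    rw [one_mul, mul_assoc, mul_inv_cancel₀ hc.ne', mul_one]

end Chessboard

lemma nonempty_realization_homeomorph_sphere {n p q : ℕ} (hpq : p + q = n) (k : Fin 2 → ℕ)
    (hp : k 0 = p) (hq : k 1 = q) :
    Nonempty (Realization (n + 1) 2 k (fun _ => 1) ≃ₜ
      Metric.sphere (0 : EuclideanSpace ℝ (Fin n)) 1) := by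
  have : Nonempty (Fin (p + 1) ↪ Fin (n + 1)) := ⟨Fin.castLEEmb (by omega)⟩
  exact ⟨(realizationHomeomorph hpq k hp hq).trans
    (Continuous.homeoOfEquivCompactToT2
      (f := Equiv.ofBijective _ sphereToOrderStatSphere_bijective)
      continuous_sphereToOrderStatSphere).symm⟩

theorem bier_type_chessboard_complexes_are_spheres :
    (∀ m p : ℕ, 2 ≤ m → 1 ≤ p → p ≤ m - 1 →
      Nonempty (↥(Realization m 2 ![p, m - p - 1] fun _ => 1) ≃ₜ
        Metric.sphere (0 : EuclideanSpace ℝ (Fin (m - 1))) 1)) ∧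
    (∀ p : ℕ, 1 ≤ p →
      Nonempty (↥(Realization (2 * p + 1) 2 (fun _ => p) fun _ => 1) ≃ₜ
        Metric.sphere (0 : EuclideanSpace ℝ (Fin (2 * p))) 1)) := by
  refine ⟨fun m p hm _ hp => ?_, fun p _ => ?_⟩
  · obtain ⟨n, rfl⟩ : ∃ n, m = n + 1 := ⟨m - 1, by omega⟩
    exact nonempty_realization_homeomorph_sphere (p := p) (q := n + 1 - p - 1) (by omega) _ rfl rfl
  · exact nonempty_realization_homeomorph_sphere (two_mul p).symm _ rfl rfl
end

section
/- The geometric realization of the multiple chessboard complex Δ_{3,2}^{2,1} (a 3×2 chessboard with at most 2 rooks in each row and at most 1 rook in each column) is homeomorphic to the cylinder S^1 × [0,1]. -/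
open scoped BigOperators

namespace ChessboardCylinder

theorem isFace_iff (A : Finset (Fin 3 × Fin 2)) :
    IsFace 3 2 (fun _ => 2) (fun _ => 1) A ↔
      (∀ i, ∃ j, (j, i) ∉ A) ∧ ∀ j, (j, 0) ∉ A ∨ (j, 1) ∉ A := by
  unfold IsFace
  revert A
  decide

theorem mem_realization_iff (f : Fin 3 × Fin 2 → ℝ) :
    f ∈ Realization 3 2 (fun _ => 2) (fun _ => 1) ↔
      (∀ v, 0 ≤ f v) ∧ ∑ v, f v = 1 ∧
        (∀ i, ∃ j, f (j, i) ≤ 0) ∧ ∀ j, f (j, 0) ≤ 0 ∨ f (j, 1) ≤ 0 := by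
  simp only [Realization, Set.mem_ofPred_eq, isFace_iff, Finset.mem_filter, Finset.mem_univ,
    true_and, not_lt]
  refine ⟨fun ⟨h, h'⟩ => ⟨fun v => (h v).1, h'⟩, fun ⟨h, hs, h'⟩ => ⟨fun v => ⟨h v, ?_⟩, hs, h'⟩⟩
  exact hs ▸ Finset.single_le_sum (fun v _ => h v) (Finset.mem_univ v)

/-- The largest coordinate of `w`. -/
def top (w : Fin 3 → ℝ) : ℝ := max (w 0) (max (w 1) (w 2))

/-- The smallest coordinate of `w`. -/
def bot (w : Fin 3 → ℝ) : ℝ := min (w 0) (min (w 1) (w 2))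

theorem le_top (w : Fin 3 → ℝ) (j : Fin 3) : w j ≤ top w := by
  fin_cases j <;> simp [top]

theorem bot_le (w : Fin 3 → ℝ) (j : Fin 3) : bot w ≤ w j := by
  fin_cases j <;> simp [bot]

theorem exists_eq_top (w : Fin 3 → ℝ) : ∃ j, w j = top w := by
  unfold top
  rcases max_choice (w 1) (w 2) with h | h <;> rw [h]
  · rcases max_choice (w 0) (w 1) with h | h <;> rw [h] <;> exact ⟨_, rfl⟩
  · rcases max_choice (w 0) (w 2) with h | h <;> rw [h] <;> exact ⟨_, rfl⟩

theorem exists_eq_bot (w : Fin 3 → ℝ) : ∃ j, w j = bot w := by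
  unfold bot
  rcases min_choice (w 1) (w 2) with h | h <;> rw [h]
  · rcases min_choice (w 0) (w 1) with h | h <;> rw [h] <;> exact ⟨_, rfl⟩
  · rcases min_choice (w 0) (w 2) with h | h <;> rw [h] <;> exact ⟨_, rfl⟩

theorem top_eq_of_affine {w x : Fin 3 → ℝ} {r c : ℝ} (hr : 0 ≤ r)
    (h : ∀ j, w j = r * x j + c) : top w = r * top x + c := by
  simp only [top, h, mul_max_of_nonneg _ _ hr, max_add_add_right]

theorem bot_eq_of_affine {w x : Fin 3 → ℝ} {r c : ℝ} (hr : 0 ≤ r)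
    (h : ∀ j, w j = r * x j + c) : bot w = r * bot x + c := by
  simp only [bot, h, mul_min_of_nonneg _ _ hr, min_add_add_right]

/-- The point of `ℝ³` whose third coordinate is zero and whose first two are those of `u`. -/
def embed (u : EuclideanSpace ℝ (Fin 2)) : Fin 3 → ℝ := ![u 0, u 1, 0]

/-- The translate of `embed u` along the diagonal whose largest coordinate is `t` times the
spread of its coordinates. -/
def slide (u : EuclideanSpace ℝ (Fin 2)) (t : ℝ) (j : Fin 3) : ℝ :=
  embed u j - top (embed u) + t * (top (embed u) - bot (embed u))

/-- The point of the octahedral sphere on the ray through `w`, in barycentric coordinates: `(j, 0)`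
and `(j, 1)` are the vertices on the positive and negative half of the `j`-th axis. -/
noncomputable def bary (w : Fin 3 → ℝ) (v : Fin 3 × Fin 2) : ℝ :=
  ![max (w v.1) 0, max (-w v.1) 0] v.2 / ∑ j, |w j|

theorem bary_sub (w : Fin 3 → ℝ) (j : Fin 3) :
    bary w (j, 0) - bary w (j, 1) = w j / ∑ j, |w j| := by
  simp only [bary, Matrix.cons_val_zero, Matrix.cons_val_one, ← sub_div]
  congr 1
  rcases le_total 0 (w j) with h | h <;> simp [h]

theorem sum_abs_pos {w : Fin 3 → ℝ} (h : bot w < top w) : 0 < ∑ j, |w j| := by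
  refine (Finset.sum_nonneg fun j _ => abs_nonneg (w j)).lt_of_ne fun h0 => h.ne ?_
  have := (Finset.sum_eq_zero_iff_of_nonneg fun j _ => abs_nonneg (w j)).1 h0.symm
  simp only [Finset.mem_univ, abs_eq_zero, true_imp_iff] at this
  simp [top, bot, this]

theorem bary_mem {w : Fin 3 → ℝ} (h : bot w < top w) (hb : bot w ≤ 0) (ht : 0 ≤ top w) :
    bary w ∈ Realization 3 2 (fun _ => 2) (fun _ => 1) := by
  have hN := sum_abs_pos h
  rw [mem_realization_iff]
  refine ⟨fun ⟨j, i⟩ => ?_, ?_, fun i => ?_, fun j => ?_⟩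
  · refine div_nonneg ?_ hN.le
    fin_cases i <;> simp
  · simp only [bary, ← Finset.sum_div]
    rw [div_eq_one_iff_eq hN.ne', Fintype.sum_prod_type]
    refine Finset.sum_congr rfl fun j _ => ?_
    rcases le_total 0 (w j) with h | h <;> simp [h, abs_of_nonneg, abs_of_nonpos]
  · fin_cases i
    · obtain ⟨j, hj⟩ := exists_eq_bot w
      exact ⟨j, by simp [bary, hj, hb]⟩
    · obtain ⟨j, hj⟩ := exists_eq_top w
      exact ⟨j, by simp [bary, hj, ht]⟩
  · rcases le_total 0 (w j) with h | h <;> simp [bary, h]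

theorem bot_lt_top_embed {u : EuclideanSpace ℝ (Fin 2)} (hu : u ≠ 0) :
    bot (embed u) < top (embed u) := by
  by_contra! h
  refine hu ?_
  have key (j) : embed u j = embed u 2 :=
    le_antisymm ((le_top _ _).trans (h.trans (bot_le _ _)))
      ((le_top _ _).trans (h.trans (bot_le _ _)))
  ext i
  fin_cases i
  · simpa [embed] using key 0
  · simpa [embed] using key 1

theorem top_slide (u : EuclideanSpace ℝ (Fin 2)) (t : ℝ) :
    top (slide u t) = t * (top (embed u) - bot (embed u)) := by
  rw [top_eq_of_affine (x := embed u) (r := 1)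
    (c := t * (top (embed u) - bot (embed u)) - top (embed u)) zero_le_one
    (fun j => by rw [slide]; ring)]
  ring

theorem bot_slide (u : EuclideanSpace ℝ (Fin 2)) (t : ℝ) :
    bot (slide u t) = (t - 1) * (top (embed u) - bot (embed u)) := by
  rw [bot_eq_of_affine (x := embed u) (r := 1)
    (c := t * (top (embed u) - bot (embed u)) - top (embed u)) zero_le_one
    (fun j => by rw [slide]; ring)]
  ring

theorem bot_lt_top_slide {u : EuclideanSpace ℝ (Fin 2)} (hu : u ≠ 0) (t : ℝ) :
    bot (slide u t) < top (slide u t) := by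
  rw [top_slide, bot_slide]
  linarith [bot_lt_top_embed hu]

/-- Parametrization of the realization by the cylinder. -/
noncomputable def cylinderMap
    (z : Metric.sphere (0 : EuclideanSpace ℝ (Fin 2)) 1 × Set.Icc (0 : ℝ) 1) :
    Realization 3 2 (fun _ => 2) (fun _ => 1) :=
  ⟨bary (slide z.1 z.2), by
    have hu := ne_zero_of_mem_unit_sphere z.1
    have := bot_lt_top_embed hu
    refine bary_mem (bot_lt_top_slide hu _) ?_ ?_
    · rw [bot_slide]
      exact mul_nonpos_of_nonpos_of_nonneg (sub_nonpos.2 z.2.2.2) (sub_pos.2 this).le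
    · rw [top_slide]
      exact mul_nonneg z.2.2.1 (sub_pos.2 this).le⟩

theorem continuous_cylinderMap : Continuous cylinderMap := by
  have hembed (j : Fin 3) : Continuous fun u : EuclideanSpace ℝ (Fin 2) => embed u j := by
    fin_cases j <;> simp only [embed] <;> simp <;> fun_prop
  have htop : Continuous fun u : EuclideanSpace ℝ (Fin 2) => top (embed u) := by
    unfold top; fun_prop
  have hbot : Continuous fun u : EuclideanSpace ℝ (Fin 2) => bot (embed u) := by
    unfold bot; fun_prop
  have hslide (j : Fin 3) : Continuous
      fun z : Metric.sphere (0 : EuclideanSpace ℝ (Fin 2)) 1 × Set.Icc (0 : ℝ) 1 =>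
        slide z.1 z.2 j := by
    have hu := continuous_subtype_val.comp (continuous_fst
      (X := Metric.sphere (0 : EuclideanSpace ℝ (Fin 2)) 1) (Y := Set.Icc (0 : ℝ) 1))
    exact (((hembed j).comp hu).sub (htop.comp hu)).add ((continuous_subtype_val.comp
      continuous_snd).mul ((htop.comp hu).sub (hbot.comp hu)))
  refine Continuous.subtype_mk (continuous_pi fun ⟨j, i⟩ => ?_) _
  refine Continuous.div ?_ (by fun_prop) fun z =>
    (sum_abs_pos (bot_lt_top_slide (ne_zero_of_mem_unit_sphere z.1) _)).ne'
  fin_cases i <;> simp <;> fun_prop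

theorem slide_sub_zero (u : EuclideanSpace ℝ (Fin 2)) (t : ℝ) :
    slide u t 0 - slide u t 2 = u 0 := by
  simp [slide, embed]

theorem slide_sub_one (u : EuclideanSpace ℝ (Fin 2)) (t : ℝ) :
    slide u t 1 - slide u t 2 = u 1 := by
  simp [slide, embed]

theorem cylinderMap_injective : Function.Injective cylinderMap := by
  rintro ⟨⟨u, hu⟩, t, ht⟩ ⟨⟨u', hu'⟩, t', ht'⟩ h
  have hu0 := ne_zero_of_mem_unit_sphere ⟨u, hu⟩
  have hu0' := ne_zero_of_mem_unit_sphere ⟨u', hu'⟩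
  have hN := sum_abs_pos (bot_lt_top_slide hu0 t)
  have hN' := sum_abs_pos (bot_lt_top_slide hu0' t')
  have h : bary (slide u t) = bary (slide u' t') := congrArg Subtype.val h
  have hd (j) : slide u t j / ∑ j, |slide u t j| = slide u' t' j / ∑ j, |slide u' t' j| := by
    rw [← bary_sub, h, bary_sub]
  set N := ∑ j, |slide u t j|
  set N' := ∑ j, |slide u' t' j|
  have hw (j) : slide u t j = N / N' * slide u' t' j := by
    have := hd j
    field_simp at this ⊢
    linarith
  have huu : u = (N / N') • u' := by
    ext i
    fin_cases i
    · simp [← slide_sub_zero u t, ← slide_sub_zero u' t', hw, mul_sub]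
    · simp [← slide_sub_one u t, ← slide_sub_one u' t', hw, mul_sub]
  have hc : N / N' = 1 := by
    have := congrArg norm huu
    rw [norm_smul, mem_sphere_zero_iff_norm.1 hu, mem_sphere_zero_iff_norm.1 hu',
      Real.norm_of_nonneg (div_pos hN hN').le] at this
    linarith
  obtain rfl : u = u' := by simpa [hc] using huu
  have htt : top (slide u t) = top (slide u t') := by
    simp only [top, hw, hc, one_mul]
  rw [top_slide, top_slide] at htt
  obtain rfl := mul_right_cancel₀ (sub_pos.2 (bot_lt_top_embed hu0)).ne' htt
  rfl

theorem cylinderMap_surjective : Function.Surjective cylinderMap := by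
  rintro ⟨f, hf⟩
  obtain ⟨h0, hs, hcol, hrow⟩ := (mem_realization_iff f).1 hf
  set x : Fin 3 → ℝ := fun j => f (j, 0) - f (j, 1)
  have hx0 (j) : f (j, 0) = max (x j) 0 := by
    have h₀ := h0 (j, 0)
    have h₁ := h0 (j, 1)
    have hj : x j = f (j, 0) - f (j, 1) := rfl
    rcases hrow j with h | h
    · rw [max_eq_right] <;> linarith
    · rw [max_eq_left] <;> linarith
  have hx1 (j) : f (j, 1) = max (-x j) 0 := by
    have h₀ := h0 (j, 0)
    have h₁ := h0 (j, 1)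
    have hj : x j = f (j, 0) - f (j, 1) := rfl
    rcases hrow j with h | h
    · rw [max_eq_left] <;> linarith
    · rw [max_eq_right] <;> linarith
  have habs : ∑ j, |x j| = 1 := by
    rw [← hs, Fintype.sum_prod_type]
    refine Finset.sum_congr rfl fun j _ => ?_
    rw [Fin.sum_univ_two, hx0, hx1]
    rcases le_total 0 (x j) with h | h <;> simp [h, abs_of_nonneg, abs_of_nonpos]
  have hb : bot x ≤ 0 := by
    obtain ⟨j, hj⟩ := hcol 0
    exact (bot_le x j).trans ((le_max_left _ _).trans (hx0 j ▸ hj))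
  have ht : 0 ≤ top x := by
    obtain ⟨j, hj⟩ := hcol 1
    have := (le_max_left _ _).trans (hx1 j ▸ hj)
    linarith [le_top x j]
  have hlt : bot x < top x := by
    by_contra! hle
    have hz (j) : x j = 0 := by linarith [le_top x j, bot_le x j]
    simp [hz] at habs
  set y : EuclideanSpace ℝ (Fin 2) := !₂[x 0 - x 2, x 1 - x 2] with hy
  have hy0 : y ≠ 0 := by
    intro h
    have h₀ : x 0 - x 2 = 0 := congrArg (fun y : EuclideanSpace ℝ (Fin 2) => y 0) h
    have h₁ : x 1 - x 2 = 0 := congrArg (fun y : EuclideanSpace ℝ (Fin 2) => y 1) h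
    refine hlt.ne ?_
    simp [top, bot, sub_eq_zero.1 h₀, sub_eq_zero.1 h₁]
  have hr : 0 < ‖y‖⁻¹ := inv_pos.2 (norm_pos_iff.2 hy0)
  set r := ‖y‖⁻¹
  have hemb (j) : embed (r • y) j = r * x j + -(r * x 2) := by
    fin_cases j <;> simp [embed, hy] <;> ring
  have hslide (j) : slide (r • y) (top x / (top x - bot x)) j = r * x j := by
    have := (sub_pos.2 hlt).ne'
    rw [slide, top_eq_of_affine hr.le hemb, bot_eq_of_affine hr.le hemb, hemb]
    field_simp
    ring
  refine ⟨⟨⟨r • y, ?_⟩, top x / (top x - bot x), ?_, ?_⟩, ?_⟩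
  · rw [mem_sphere_zero_iff_norm, norm_smul, Real.norm_of_nonneg hr.le]
    exact inv_mul_cancel₀ (norm_ne_zero_iff.2 hy0)
  · exact div_nonneg ht (sub_pos.2 hlt).le
  · rw [div_le_one (sub_pos.2 hlt)]
    linarith
  · refine Subtype.ext (funext fun ⟨j, i⟩ => ?_)
    have hsum : ∑ j, |r * x j| = r := by
      simp only [abs_mul, ← Finset.mul_sum, habs, mul_one, abs_of_pos hr]
    have hmax (a : ℝ) : max (r * a) 0 / r = max a 0 := by
      rw [← mul_zero r, ← mul_max_of_nonneg _ _ hr.le, mul_div_cancel_left₀ _ hr.ne', mul_zero]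
    simp only [cylinderMap, bary, hslide, hsum]
    fin_cases i
    · simp [hx0, hmax]
    · simp [hx1, hmax, ← mul_neg]

end ChessboardCylinder

theorem delta_3_2_2_1_is_cylinder :
    Nonempty (↥(Realization 3 2 (fun _ => 2) fun _ => 1) ≃ₜ
      (Metric.sphere (0 : EuclideanSpace ℝ (Fin 2)) 1 × ↥(Set.Icc (0 : ℝ) 1))) := by
  open ChessboardCylinder in
  exact ⟨((Equiv.ofBijective cylinderMap
    ⟨cylinderMap_injective, cylinderMap_surjective⟩).toHomeomorphOfContinuousClosed
      continuous_cylinderMap continuous_cylinderMap.isClosedMap).symm⟩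
end
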